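/- Any two finite groups G and H, each of order 2^5 · 3^2 · 5^2 · 7 · 29 · 59^3 · 163 and each having prime graph degrees deg(2) = 4, deg(3) = 2, deg(5) = 4, deg(7) = 1, deg(29) = 2, deg(59) = 2, deg(163) = 1, are isomorphic. -/

import Mathlib

/-- The degree of the prime `p` in the prime graph (Gruenberg–Kegel graph) `GK(G)` of the
group `G`: the number of primes `q ≠ p` such that `G` contains an element of order `p * q`
(two distinct primes being adjacent in `GK(G)` iff `G` has an element of order their
product). -/
noncomputable def gkDegree (G : Type*) [Group G] (p : ℕ) : ℕ :=
  Nat.card {q : ℕ // p ≠ q ∧ p.Prime ∧ q.Prime ∧ ∃ g : G, orderOf g = p * q}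

set_option linter.unusedSectionVars false

open Equiv.Perm in
theorem perm_order_four_aux {α : Type*} [Fintype α] [DecidableEq α] (σ : Equiv.Perm α) :
    σ ^ 4 = 1 → ∃ a b : ℕ, (σ ^ 2).support.card = 4 * b ∧ σ.support.card = 4 * b + 2 * a ∧
      sign σ = (-1) ^ (a + b) := by
  refine cycle_induction_on (fun σ => σ ^ 4 = 1 → ∃ a b : ℕ, (σ ^ 2).support.card = 4 * b ∧
    σ.support.card = 4 * b + 2 * a ∧ sign σ = (-1) ^ (a + b)) σ ?_ ?_ ?_
  · intro _
    exact ⟨0, 0, by simp⟩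
  · intro σ hσ h4
    have ho : orderOf σ ∣ 2 ^ 2 := orderOf_dvd_of_pow_eq_one h4
    obtain ⟨k, hk, hk'⟩ := (Nat.dvd_prime_pow Nat.prime_two).1 ho
    have hs := hσ.sign
    rw [← hσ.orderOf] at hs
    interval_cases k
    · have : σ = 1 := orderOf_eq_one_iff.1 (by simpa using hk')
      exact absurd this hσ.ne_one
    · have h2 : σ ^ 2 = 1 := by rw [← orderOf_dvd_iff_pow_eq_one, hk']; norm_num
      refine ⟨1, 0, by simp [h2], by rw [← hσ.orderOf, hk']; norm_num, ?_⟩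
      rw [hs, hk']; norm_num
    · have h2 : (σ ^ 2).support = σ.support := hσ.support_pow_eq_iff.2 (by rw [hk']; norm_num)
      refine ⟨0, 1, by rw [h2, ← hσ.orderOf, hk']; norm_num,
        by rw [← hσ.orderOf, hk']; norm_num, ?_⟩
      rw [hs, hk']; norm_num
  · intro σ τ hd hσ h1 h2 h4
    have hp := fun n : ℕ => hd.commute.mul_pow n
    rw [hp, (hd.pow_disjoint_pow 4 4).mul_eq_one_iff] at h4
    obtain ⟨a, b, e1, e2, e3⟩ := h1 h4.1
    obtain ⟨a', b', e1', e2', e3'⟩ := h2 h4.2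
    refine ⟨a + a', b + b', ?_, ?_, ?_⟩
    · rw [hp, (hd.pow_disjoint_pow 2 2).card_support_mul, e1, e1']; ring
    · rw [hd.card_support_mul, e2, e2']; ring
    · rw [map_mul, e3, e3', ← pow_add]; congr 1; ring

theorem natCard_fixed_add_support {α : Type*} [Fintype α] [DecidableEq α] (σ : Equiv.Perm α) :
    Nat.card {x // σ x = x} + σ.support.card = Nat.card α := by
  rw [Nat.card_eq_fintype_card, Nat.card_eq_fintype_card, Fintype.card_subtype,
    ← Finset.card_univ, ← Finset.card_filter_add_card_filter_not (s := Finset.univ) (fun x => σ x = x)]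
  rfl

/-- The sign of a permutation `σ` with `σ ^ 4 = 1` in terms of the numbers of fixed points of
`σ` and `σ ^ 2`. -/
theorem sign_of_pow_four {α : Type*} [Fintype α] [DecidableEq α] (σ : Equiv.Perm α)
    (h : σ ^ 4 = 1) : ∃ a b : ℕ,
      Nat.card {x // (σ ^ 2) x = x} = Nat.card {x // σ x = x} + 2 * a ∧
      Nat.card α = Nat.card {x // (σ ^ 2) x = x} + 4 * b ∧
      Equiv.Perm.sign σ = (-1) ^ (a + b) := by
  obtain ⟨a, b, h1, h2, h3⟩ := perm_order_four_aux σ h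
  have e1 := natCard_fixed_add_support σ
  have e2 := natCard_fixed_add_support (σ ^ 2)
  exact ⟨a, b, by omega, by omega, h3⟩

theorem sign_of_pow_two {α : Type*} [Fintype α] [DecidableEq α] (σ : Equiv.Perm α)
    (h : σ ^ 2 = 1) : ∃ a : ℕ, Nat.card α = Nat.card {x // σ x = x} + 2 * a ∧
      Equiv.Perm.sign σ = (-1) ^ a := by
  obtain ⟨a, b, h1, h2, h3⟩ := sign_of_pow_four σ (by rw [show 4 = 2 * 2 from rfl, pow_mul, h, one_pow])
  have : Nat.card {x // (σ ^ 2) x = x} = Nat.card α := by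
    rw [h]; exact Nat.card_congr (Equiv.subtypeUnivEquiv (by simp))
  exact ⟨a, by omega, by rw [h3, show b = 0 by omega, add_zero]⟩

/-- A permutation of prime power order of a finite set has as many fixed points as the
set has elements, modulo the prime. -/
theorem card_modEq_card_fixed {α : Type*} [Finite α] (σ : Equiv.Perm α) (l : ℕ) [Fact l.Prime]
    (n : ℕ) (h : σ ^ l ^ n = 1) : Nat.card α ≡ Nat.card {x // σ x = x} [MOD l] := by
  classical
  have := Fintype.ofFinite α
  have h1 := Equiv.Perm.card_compl_support_modEq h
  have h2 := natCard_fixed_add_support σ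
  have h3 : (σ.support)ᶜ.card = Nat.card {x // σ x = x} := by
    have := Finset.card_compl_add_card σ.support
    rw [Nat.card_eq_fintype_card (α := α)] at h2
    omega
  rw [h3] at h1
  rw [Nat.card_eq_fintype_card]
  exact h1.symm

/-- Conjugation by `z` as a permutation of a subgroup normalised by `z`. -/
def conjPerm {G : Type*} [Group G] (Q : Subgroup G) (z : G)
    (hz : ∀ x, z * x * z⁻¹ ∈ Q ↔ x ∈ Q) : Equiv.Perm Q :=
  Equiv.Perm.subtypePerm (MulAut.conj z).toEquiv (fun x => hz x)

theorem conjPerm_pow {G : Type*} [Group G] (Q : Subgroup G) (z : G)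
    (hz : ∀ x, z * x * z⁻¹ ∈ Q ↔ x ∈ Q) (n : ℕ) (x : Q) :
    ((conjPerm Q z hz ^ n) x : G) = z ^ n * x * (z ^ n)⁻¹ := by
  induction n generalizing x with
  | zero => simp
  | succ n ih =>
    rw [pow_succ, Equiv.Perm.mul_apply, ih]
    simp [conjPerm, pow_succ, mul_assoc]

theorem conj_mem_iff_of_forall {G : Type*} [Group G] [Finite G] {Q : Subgroup G} {z : G}
    (hz : ∀ x ∈ Q, z * x * z⁻¹ ∈ Q) (x : G) : z * x * z⁻¹ ∈ Q ↔ x ∈ Q := by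
  refine ⟨fun h => ?_, hz x⟩
  have key : ∀ n : ℕ, ∀ y ∈ Q, z ^ n * y * (z ^ n)⁻¹ ∈ Q := by
    intro n
    induction n with
    | zero => intro y hy; simpa using hy
    | succ n ih =>
      intro y hy
      have := hz _ (ih y hy)
      rw [pow_succ']
      convert this using 1
      group
  have h1 := key (orderOf z - 1) _ h
  have h2 : z ^ (orderOf z - 1) = z⁻¹ := by
    rw [eq_inv_iff_mul_eq_one, ← pow_succ, Nat.sub_add_cancel (orderOf_pos z), pow_orderOf_eq_one]
  rw [h2] at h1
  convert h1 using 1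
  group

theorem card_modEq_card_inf_centralizer {G : Type*} [Group G] [Finite G] (Q : Subgroup G) (z : G)
    (hz : ∀ x ∈ Q, z * x * z⁻¹ ∈ Q) (l : ℕ) [Fact l.Prime] (n : ℕ) (h : z ^ l ^ n = 1) :
    Nat.card Q ≡ Nat.card (Q ⊓ Subgroup.centralizer {z} : Subgroup G) [MOD l] := by
  have hz' := conj_mem_iff_of_forall hz
  have h1 := card_modEq_card_fixed (conjPerm Q z hz') l n (by
    ext x; rw [conjPerm_pow, h]; simp)
  suffices e : Nat.card {x // conjPerm Q z hz' x = x} =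
      Nat.card (Q ⊓ Subgroup.centralizer {z} : Subgroup G) by rwa [e] at h1
  refine Nat.card_congr ⟨fun x => ⟨x.1.1, x.1.2, ?_⟩, fun x => ⟨⟨x.1, x.2.1⟩, ?_⟩, fun _ => rfl,
    fun _ => rfl⟩
  · have : z * (x.1.1 : G) * z⁻¹ = x.1.1 := congrArg Subtype.val x.2
    exact Subgroup.mem_centralizer_singleton_iff.2 (mul_inv_eq_iff_eq_mul.1 this).symm
  · have := Subgroup.mem_centralizer_singleton_iff.1 x.2.2
    exact Subtype.ext (mul_inv_eq_iff_eq_mul.2 this.symm : z * (x : G) * z⁻¹ = x)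

/-- The common order of the groups considered here. -/
abbrev orderU : ℕ := 2^5 * 3^2 * 5^2 * 7 * 29 * 59^3 * 163

/-- `p` and `q` are joined by an element of order `p * q`. -/
def GKAdj (G : Type*) [Group G] (p q : ℕ) : Prop := ∃ g : G, orderOf g = p * q

theorem GKAdj.symm {G : Type*} [Group G] {p q : ℕ} (h : GKAdj G p q) : GKAdj G q p := by
  obtain ⟨g, hg⟩ := h
  exact ⟨g, by rw [hg, mul_comm]⟩

theorem gkAdj_of_commute {G : Type*} [Group G] {x y : G} {p q : ℕ} (hp : p.Prime) (hq : q.Prime)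
    (hpq : p ≠ q) (hx : orderOf x = p) (hy : orderOf y = q) (h : Commute x y) : GKAdj G p q :=
  ⟨x * y, by
    rw [h.orderOf_mul_eq_mul_orderOf_of_coprime (by rw [hx, hy]; exact (Nat.coprime_primes hp hq).2 hpq),
      hx, hy]⟩

theorem mem_primes_of_dvd_orderU {q : ℕ} (hq : q.Prime) (h : q ∣ orderU) :
    q ∈ ({2, 3, 5, 7, 29, 59, 163} : Finset ℕ) := by
  have : q ∈ orderU.primeFactors := Nat.mem_primeFactors.2 ⟨hq, h, by norm_num [orderU]⟩
  rw [orderU] at this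
  rw [Nat.primeFactors_mul (by norm_num) (by norm_num),
    Nat.primeFactors_mul (by norm_num) (by norm_num),
    Nat.primeFactors_mul (by norm_num) (by norm_num),
    Nat.primeFactors_mul (by norm_num) (by norm_num),
    Nat.primeFactors_mul (by norm_num) (by norm_num),
    Nat.primeFactors_mul (by norm_num) (by norm_num),
    Nat.primeFactors_pow _ (by norm_num), Nat.primeFactors_pow _ (by norm_num),
    Nat.primeFactors_pow _ (by norm_num), Nat.primeFactors_pow _ (by norm_num),
    Nat.Prime.primeFactors (by norm_num), Nat.Prime.primeFactors (by norm_num),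
    Nat.Prime.primeFactors (by norm_num), Nat.Prime.primeFactors (by norm_num),
    Nat.Prime.primeFactors (by norm_num), Nat.Prime.primeFactors (by norm_num),
    Nat.Prime.primeFactors (by norm_num)] at this
  simp only [Finset.mem_union, Finset.mem_singleton] at this
  simp only [Finset.mem_insert, Finset.mem_singleton]
  tauto

open scoped Classical in
theorem gkDegree_eq_card {G : Type*} [Group G] [Finite G] (hG : Nat.card G = orderU) {p : ℕ}
    (hp : p.Prime) : gkDegree G p =
      (({2, 3, 5, 7, 29, 59, 163} : Finset ℕ).filter fun q => p ≠ q ∧ GKAdj G p q).card := by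
  refine Nat.subtype_card _ fun q => ?_
  rw [Finset.mem_filter]
  refine ⟨fun h => ⟨h.2.1, hp, ?_, h.2.2⟩, fun h => ⟨mem_primes_of_dvd_orderU h.2.2.1 ?_, h.1, h.2.2.2⟩⟩
  · have := h.1
    simp only [Finset.mem_insert, Finset.mem_singleton] at this
    rcases this with rfl | rfl | rfl | rfl | rfl | rfl | rfl <;> norm_num
  · obtain ⟨g, hg⟩ := h.2.2.2
    have := orderOf_dvd_natCard g
    rw [hg, hG] at this
    exact (dvd_mul_left q p).trans this

/-- A centraliser computation: the index condition on a Sylow `163`-subgroup forces the unique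
neighbour of `163` to be `7`. -/
theorem sylow_163_numerics {r b e : ℕ} (hr : r ∈ ({2, 3, 5, 7, 29, 59} : Finset ℕ))
    (he : e ∣ 162) (hb : r ^ b ∣ 2^5 * 3^2 * 5^2 * 7 * 29 * 59^3) (h1 : 1 ≤ b)
    (h : r ^ b * e % 163 = 21) : r = 7 ∧ b = 1 ∧ e = 3 := by
  have he' : e ∈ ({1, 2, 3, 6, 9, 18, 27, 54, 81, 162} : Finset ℕ) := by
    have : e ∈ Nat.divisors 162 := Nat.mem_divisors.2 ⟨he, by norm_num⟩
    rwa [show Nat.divisors 162 = {1, 2, 3, 6, 9, 18, 27, 54, 81, 162} by decide +kernel] at this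
  have hb6 : b < 6 := by
    by_contra hb6
    have h6 : r ^ 6 ∣ 2^5 * 3^2 * 5^2 * 7 * 29 * 59^3 := (pow_dvd_pow r (by omega)).trans hb
    simp only [Finset.mem_insert, Finset.mem_singleton] at hr
    rcases hr with rfl | rfl | rfl | rfl | rfl | rfl <;> norm_num at h6
  have key : ∀ r ∈ ({2, 3, 5, 7, 29, 59} : Finset ℕ),
      ∀ e ∈ ({1, 2, 3, 6, 9, 18, 27, 54, 81, 162} : Finset ℕ), ∀ b ∈ Finset.range 6,
      2^5 * 3^2 * 5^2 * 7 * 29 * 59^3 % r ^ b = 0 → 1 ≤ b → r ^ b * e % 163 = 21 →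
      r = 7 ∧ b = 1 ∧ e = 3 := by decide +kernel
  exact key r hr e he' b (Finset.mem_range.2 hb6) (Nat.mod_eq_zero_of_dvd hb) h1 h

theorem card_centralizer_of_unique_neighbour {G : Type*} [Group G] [Finite G]
    (hG : Nat.card G = orderU) {x : G} (hx : orderOf x = 163) {r : ℕ}
    (huniq : ∀ q, q.Prime → q ≠ 163 → GKAdj G 163 q → q = r) :
    ∃ b, Nat.card (Subgroup.centralizer {x}) = 163 * r ^ b ∧
      r ^ b ∣ 2^5 * 3^2 * 5^2 * 7 * 29 * 59^3 := by
  have h1 : 163 ∣ Nat.card (Subgroup.centralizer {x}) := by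
    rw [← hx, ← Nat.card_zpowers]
    refine Subgroup.card_dvd_of_le ?_
    rw [Subgroup.zpowers_le, Subgroup.mem_centralizer_singleton_iff]
  obtain ⟨k, hk⟩ := h1
  have h2 : k ∣ 2^5 * 3^2 * 5^2 * 7 * 29 * 59^3 := by
    have := Subgroup.card_subgroup_dvd_card (Subgroup.centralizer {x})
    rw [hk, hG, orderU, mul_comm _ 163] at this
    exact Nat.dvd_of_mul_dvd_mul_left (by norm_num) this
  have hk0 : k ≠ 0 := by rintro rfl; norm_num at h2
  have := Nat.eq_prime_pow_of_unique_prime_dvd (n := k) (p := r) hk0 (by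
    intro d hd hdk
    have : Fact d.Prime := ⟨hd⟩
    obtain ⟨⟨y, hy⟩, hyo⟩ := exists_prime_orderOf_dvd_card' (G := Subgroup.centralizer {x}) d
      (hk ▸ hdk.mul_left 163)
    have hd163 : d ≠ 163 := by
      rintro rfl
      exact absurd (hdk.trans h2) (by norm_num)
    refine huniq d hd hd163 (gkAdj_of_commute (by norm_num) hd hd163.symm hx
      (y := y) (by rw [← hyo, Subgroup.orderOf_mk]) ?_)
    exact (Subgroup.mem_centralizer_singleton_iff.1 hy).symm)
  exact ⟨_, by rw [hk, ← this], this ▸ h2⟩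

theorem card_normalizer_dvd {G : Type*} [Group G] [Finite G] {x : G} {l : ℕ}
    (hl : l.Prime) (hx : orderOf x = l) :
    ∃ e, e ∣ l - 1 ∧ Nat.card (Subgroup.normalizer (Subgroup.zpowers x : Set G)) =
      Nat.card (Subgroup.centralizer {x}) * e := by
  set X := Subgroup.zpowers x
  have hc : Subgroup.centralizer (X : Set G) = Subgroup.centralizer {x} :=
    Subgroup.centralizer_closure {x} ▸ by rw [← Subgroup.zpowers_eq_closure]
  have hle := Subgroup.centralizer_le_normalizer (X : Set G)
  refine ⟨X.normalizerMonoidHom.ker.index, ?_, ?_⟩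
  · rw [Subgroup.index_ker]
    have h1 := Subgroup.card_subgroup_dvd_card X.normalizerMonoidHom.range
    rwa [IsCyclic.card_mulAut, Nat.card_zpowers, hx, Nat.totient_prime hl] at h1
  · rw [← Subgroup.card_mul_index X.normalizerMonoidHom.ker, Subgroup.normalizerMonoidHom_ker,
      Nat.card_congr (Subgroup.subgroupOfEquivOfLe hle).toEquiv, hc]

theorem factorization_orderU_163 : orderU.factorization 163 = 1 := by
  rw [orderU, Nat.factorization_mul (by norm_num) (by norm_num), Finsupp.add_apply,
    Nat.Prime.factorization_self (by norm_num),
    Nat.factorization_eq_zero_of_not_dvd (by norm_num)]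

theorem card_sylow_163 {G : Type*} [Group G] [Finite G] (hG : Nat.card G = orderU)
    (h163 : gkDegree G 163 = 1) :
    Nat.card (Sylow 163 G) * 3423 = orderU ∧
      ∀ q, q.Prime → q ≠ 163 → GKAdj G 163 q → q = 7 := by
  classical
  have hf : Fact (Nat.Prime 163) := ⟨by norm_num⟩
  rw [gkDegree_eq_card hG hf.out, Finset.card_eq_one] at h163
  obtain ⟨r, hr⟩ := h163
  have hrm : r ∈ ({2, 3, 5, 7, 29, 59, 163} : Finset ℕ) ∧ 163 ≠ r ∧ GKAdj G 163 r := by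
    exact Finset.mem_filter.1 (hr.symm ▸ Finset.mem_singleton_self r)
  have huniq : ∀ q, q.Prime → q ≠ 163 → GKAdj G 163 q → q = r := by
    intro q hq hne hadj
    rw [← Finset.mem_singleton, ← hr, Finset.mem_filter]
    obtain ⟨g, hg⟩ := id hadj
    have := orderOf_dvd_natCard g
    rw [hg, hG] at this
    exact ⟨mem_primes_of_dvd_orderU hq ((dvd_mul_left q 163).trans this), hne.symm, hadj⟩
  have hr6 : r ∈ ({2, 3, 5, 7, 29, 59} : Finset ℕ) := by
    have := hrm.1
    simp only [Finset.mem_insert, Finset.mem_singleton] at this ⊢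
    have := hrm.2.1
    omega
  have hrp : r.Prime := by
    simp only [Finset.mem_insert, Finset.mem_singleton] at hr6
    rcases hr6 with rfl | rfl | rfl | rfl | rfl | rfl <;> norm_num
  obtain ⟨g, hg⟩ := hrm.2.2
  have hx : orderOf (g ^ r) = 163 := by
    rw [orderOf_pow_of_dvd hrp.ne_zero (hg ▸ dvd_mul_left r 163), hg,
      Nat.mul_div_cancel _ hrp.pos]
  obtain ⟨b, hb, hbd⟩ := card_centralizer_of_unique_neighbour hG hx huniq
  obtain ⟨e, he, hN⟩ := card_normalizer_dvd hf.out hx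
  have hb1 : 1 ≤ b := by
    by_contra h0
    obtain rfl : b = 0 := by omega
    have h1 : orderOf (g ^ 163) = r := by
      rw [orderOf_pow_of_dvd (by norm_num) (hg ▸ dvd_mul_right 163 r), hg,
        Nat.mul_div_cancel_left _ (by norm_num)]
    have h2 : r ∣ Nat.card (Subgroup.centralizer {g ^ r}) := by
      rw [← h1, ← Nat.card_zpowers]
      refine Subgroup.card_dvd_of_le ?_
      rw [Subgroup.zpowers_le, Subgroup.mem_centralizer_singleton_iff, ← pow_add, ← pow_add,
        add_comm]
    rw [hb, pow_zero, mul_one, Nat.prime_dvd_prime_iff_eq hrp hf.out] at h2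
    exact hrm.2.1 h2.symm
  let X : Sylow 163 G := Sylow.ofCard (Subgroup.zpowers (g ^ r)) (by
    rw [Nat.card_zpowers, hx, hG, factorization_orderU_163, pow_one])
  have hX : Nat.card (Sylow 163 G) =
      (Subgroup.normalizer (Subgroup.zpowers (g ^ r) : Set G)).index :=
    X.card_eq_index_normalizer
  have h1 := card_sylow_modEq_one 163 G
  have h2 := Subgroup.card_mul_index (Subgroup.normalizer (Subgroup.zpowers (g ^ r) : Set G))
  rw [← hX, hN, hb, hG] at h2
  have h3 : r ^ b * e * Nat.card (Sylow 163 G) = 2^5 * 3^2 * 5^2 * 7 * 29 * 59^3 := by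
    have : 163 * (r ^ b * e * Nat.card (Sylow 163 G)) =
        163 * (2^5 * 3^2 * 5^2 * 7 * 29 * 59^3) := by
      rw [← mul_assoc, ← mul_assoc, h2, mul_comm 163]
    exact Nat.eq_of_mul_eq_mul_left (by norm_num) this
  have h4 : r ^ b * e % 163 = 21 := by
    have h5 : r ^ b * e * Nat.card (Sylow 163 G) ≡ r ^ b * e * 1 [MOD 163] := h1.mul_left _
    rw [h3, mul_one] at h5
    exact h5.symm.trans (show 2^5 * 3^2 * 5^2 * 7 * 29 * 59^3 % 163 = 21 % 163 by norm_num)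
  obtain ⟨rfl, rfl, rfl⟩ := sylow_163_numerics hr6 he hbd hb1 h4
  refine ⟨?_, huniq⟩
  rw [← h2]; ring

theorem hom_units_int_eq_one_of_odd {G : Type*} [Group G] [Finite G] (hG : Nat.card G = orderU)
    (h163 : Nat.card (Sylow 163 G) * 3423 = orderU) (φ : G →* ℤˣ) (g : G) : φ g = 1 := by
  have hf : Fact (Nat.Prime 163) := ⟨by norm_num⟩
  have hodd : ∀ (x : G) (n : ℕ), x ^ (2 * n + 1) = 1 → φ x = 1 := by
    intro x n hx
    have h1 : φ x ^ (2 * n + 1) = 1 := by rw [← map_pow, hx, map_one]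
    rwa [pow_succ, pow_mul, Int.units_sq, one_pow, one_mul] at h1
  let P : Sylow 163 φ.ker := default
  have hidx : φ.ker.index ∣ 2 := by
    rw [Subgroup.index_ker]
    have := Subgroup.card_subgroup_dvd_card φ.range
    rwa [Nat.card_eq_fintype_card (α := ℤˣ), show Fintype.card ℤˣ = 2 from rfl] at this
  have hPc : Nat.card (Subgroup.map φ.ker.subtype (P : Subgroup φ.ker)) = 163 ^ 1 := by
    rw [Subgroup.card_map_of_injective φ.ker.subtype_injective, P.card_eq_multiplicity]
    have h1 := Subgroup.card_mul_index φ.ker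
    suffices e : (Nat.card φ.ker).factorization 163 = 1 by rw [e]
    have h2 : ¬ 163 ∣ φ.ker.index := fun h => by
      have := Nat.le_of_dvd two_pos (h.trans hidx)
      omega
    rw [← factorization_orderU_163, ← hG, ← h1, Nat.factorization_mul Nat.card_pos.ne'
      Subgroup.index_ne_zero_of_finite, Finsupp.add_apply,
      Nat.factorization_eq_zero_of_not_dvd h2, add_zero]
  let X : Sylow 163 G := Sylow.ofCard (Subgroup.map φ.ker.subtype (P : Subgroup φ.ker)) (by
    rw [hPc, hG, factorization_orderU_163])
  have hX : Nat.card (Sylow 163 G) = (Subgroup.normalizer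
      (Subgroup.map φ.ker.subtype (P : Subgroup φ.ker) : Set G)).index :=
    X.card_eq_index_normalizer
  set N := Subgroup.normalizer (Subgroup.map φ.ker.subtype (P : Subgroup φ.ker) : Set G)
  have h2 := Subgroup.card_mul_index N
  rw [← hX, hG, ← h163, mul_comm] at h2
  have hNc : Nat.card N = 3423 := Nat.eq_of_mul_eq_mul_left Nat.card_pos h2
  have hNle : N ≤ φ.ker := by
    intro x hx
    refine hodd x 1711 ?_
    have := pow_card_eq_one' (x := (⟨x, hx⟩ : N))
    rw [hNc] at this
    exact congrArg Subtype.val this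
  have h3 : N ⊔ φ.ker = ⊤ := Sylow.normalizer_sup_eq_top P
  rw [sup_eq_right.2 hNle] at h3
  exact (h3 ▸ Subgroup.mem_top g : g ∈ φ.ker)

/-- The arithmetic information extracted from the order and the degree pattern. -/
structure ArithU (G : Type*) [Group G] : Prop where
  card : Nat.card G = orderU
  nbr163 : ∀ q, q.Prime → q ≠ 163 → GKAdj G 163 q → q = 7
  nbr59 : ∀ q, q.Prime → q ≠ 59 → GKAdj G 59 q → q = 2 ∨ q = 5
  nbr29 : ∀ q, q.Prime → q ≠ 29 → GKAdj G 29 q → q = 2 ∨ q = 5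
  hom_units : ∀ (φ : G →* ℤˣ) (g : G), φ g = 1

theorem dvd_orderU_of_gkAdj {G : Type*} [Group G] [Finite G] (hG : Nat.card G = orderU)
    {p q : ℕ} (h : GKAdj G p q) : q ∣ orderU := by
  obtain ⟨g, hg⟩ := h
  rw [← hG]
  exact (Dvd.intro_left p hg.symm).trans (orderOf_dvd_natCard g)

open scoped Classical in
theorem eq_or_eq_of_gkDegree_eq_two {G : Type*} [Group G] [Finite G] (hG : Nat.card G = orderU)
    {p : ℕ} (hp : p.Prime) (h : gkDegree G p = 2) (hp2 : p ≠ 2) (hp5 : p ≠ 5) (h2 : GKAdj G p 2)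
    (h5 : GKAdj G p 5) (q : ℕ) (hq : q.Prime) (hqp : q ≠ p) (hpq : GKAdj G p q) :
    q = 2 ∨ q = 5 := by
  rw [gkDegree_eq_card hG hp] at h
  by_contra! hne
  have hsub : ({2, 5, q} : Finset ℕ) ⊆
      ({2, 3, 5, 7, 29, 59, 163} : Finset ℕ).filter fun q => p ≠ q ∧ GKAdj G p q := by
    intro r hr
    simp only [Finset.mem_insert, Finset.mem_singleton] at hr
    rw [Finset.mem_filter]
    rcases hr with rfl | rfl | rfl
    · exact ⟨by simp, hp2, h2⟩
    · exact ⟨by simp, hp5, h5⟩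
    · exact ⟨mem_primes_of_dvd_orderU hq (dvd_orderU_of_gkAdj hG hpq), hqp.symm, hpq⟩
  have := Finset.card_le_card hsub
  rw [h, Finset.card_insert_of_notMem (by simp [Ne.symm hne.1]), Finset.card_insert_of_notMem
    (by simp [Ne.symm hne.2]), Finset.card_singleton] at this
  omega

theorem arithU_of_gkDegree {G : Type*} [Group G] [Finite G] (hG : Nat.card G = orderU)
    (h2 : gkDegree G 2 = 4) (h5 : gkDegree G 5 = 4) (h7 : gkDegree G 7 = 1)
    (h29 : gkDegree G 29 = 2) (h59 : gkDegree G 59 = 2) (h163 : gkDegree G 163 = 1) :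
    ArithU G := by
  classical
  obtain ⟨hs, n163⟩ := card_sylow_163 hG h163
  have a163 : GKAdj G 163 7 := by
    rw [gkDegree_eq_card hG (by norm_num), Finset.card_eq_one] at h163
    obtain ⟨r, hr⟩ := h163
    have h := Finset.mem_filter.1 (hr.symm ▸ Finset.mem_singleton_self r)
    have hrp : r.Prime := by
      have := h.1
      simp only [Finset.mem_insert, Finset.mem_singleton] at this
      rcases this with rfl | rfl | rfl | rfl | rfl | rfl | rfl <;> norm_num
    exact n163 r hrp h.2.1.symm h.2.2 ▸ h.2.2
  have n7 : ∀ q ∈ ({2, 3, 5, 7, 29, 59, 163} : Finset ℕ), 7 ≠ q → GKAdj G 7 q → q = 163 := by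
    rw [gkDegree_eq_card hG (by norm_num), Finset.card_eq_one] at h7
    obtain ⟨r, hr⟩ := h7
    have h : 163 ∈ ({r} : Finset ℕ) := by
      rw [← hr, Finset.mem_filter]
      exact ⟨by simp, by norm_num, a163.symm⟩
    intro q hq hq7 hadj
    have h' : q ∈ ({r} : Finset ℕ) := by
      rw [← hr, Finset.mem_filter]
      exact ⟨hq, hq7, hadj⟩
    rw [Finset.mem_singleton] at h h'
    rw [h', h]
  have full : ∀ p ∈ ({2, 5} : Finset ℕ), gkDegree G p = 4 →
      ∀ q ∈ ({2, 3, 5, 29, 59} : Finset ℕ), p ≠ q → GKAdj G p q := by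
    intro p hp hd q hq hpq
    have hpp : p.Prime := by
      simp only [Finset.mem_insert, Finset.mem_singleton] at hp
      rcases hp with rfl | rfl <;> norm_num
    rw [gkDegree_eq_card hG hpp] at hd
    have hp' : p ∈ ({2, 3, 5, 29, 59} : Finset ℕ) := by
      simp only [Finset.mem_insert, Finset.mem_singleton] at hp ⊢; tauto
    have hsub : (({2, 3, 5, 7, 29, 59, 163} : Finset ℕ).filter fun q => p ≠ q ∧ GKAdj G p q) ⊆
        ({2, 3, 5, 29, 59} : Finset ℕ).erase p := by
      intro r hr
      rw [Finset.mem_filter] at hr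
      have hr7 : r ≠ 7 := by
        rintro rfl
        have := n7 p (by simp only [Finset.mem_insert, Finset.mem_singleton] at hp ⊢; tauto)
          hr.2.1.symm hr.2.2.symm
        subst this
        simp at hp
      have hr163 : r ≠ 163 := by
        rintro rfl
        have := n163 p hpp hr.2.1 hr.2.2.symm
        subst this
        simp at hp
      have := hr.1
      rw [Finset.mem_erase]
      simp only [Finset.mem_insert, Finset.mem_singleton] at this ⊢
      exact ⟨hr.2.1.symm, by tauto⟩
    have := Finset.eq_of_subset_of_card_le hsub (by
      rw [hd, Finset.card_erase_of_mem hp']; rfl)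
    have hq' := this ▸ Finset.mem_erase.2 ⟨hpq.symm, hq⟩
    exact (Finset.mem_filter.1 hq').2.2
  refine ⟨hG, n163, ?_, ?_, hom_units_int_eq_one_of_odd hG hs⟩
  · exact eq_or_eq_of_gkDegree_eq_two hG (by norm_num) h59 (by norm_num) (by norm_num)
      (full 2 (by simp) h2 59 (by simp) (by norm_num)).symm
      (full 5 (by simp) h5 59 (by simp) (by norm_num)).symm
  · exact eq_or_eq_of_gkDegree_eq_two hG (by norm_num) h29 (by norm_num) (by norm_num)
      (full 2 (by simp) h2 29 (by simp) (by norm_num)).symm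
      (full 5 (by simp) h5 29 (by simp) (by norm_num)).symm

theorem ArithU.order_of_commute {G : Type*} [Group G] (h : ArithU G) {x y : G} {l : ℕ}
    (hl : l.Prime) (hx : orderOf x = 59) (hy : orderOf y = l) (hxy : Commute x y) :
    l = 2 ∨ l = 5 ∨ l = 59 := by
  by_cases e : l = 59
  · tauto
  · have := h.nbr59 l hl e (gkAdj_of_commute (by norm_num) hl (Ne.symm e) hx hy hxy)
    tauto

/-- The centraliser of an element of order `59` has order dividing `2^5 * 5^2 * 59^3`. -/
theorem ArithU.card_centralizer_dvd {G : Type*} [Group G] [Finite G] (h : ArithU G) {x : G}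
    (hx : orderOf x = 59) : Nat.card (Subgroup.centralizer {x}) ∣ 2^5 * 5^2 * 59^3 := by
  have h1 := Subgroup.card_subgroup_dvd_card (Subgroup.centralizer {x})
  rw [h.card, show orderU = 2^5 * 5^2 * 59^3 * (3^2 * 7 * 29 * 163) by norm_num] at h1
  refine Nat.Coprime.dvd_of_dvd_mul_right ?_ h1
  have key : ∀ l, l.Prime → l ≠ 2 → l ≠ 5 → l ≠ 59 →
      (Nat.card (Subgroup.centralizer {x})).Coprime l := by
    intro l hl l2 l5 l59
    rw [Nat.coprime_comm, hl.coprime_iff_not_dvd]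
    intro hd
    have : Fact l.Prime := ⟨hl⟩
    obtain ⟨⟨y, hy⟩, hyo⟩ := exists_prime_orderOf_dvd_card' (G := Subgroup.centralizer {x}) l hd
    rw [Subgroup.orderOf_mk] at hyo
    have := h.order_of_commute hl hx hyo (Subgroup.mem_centralizer_singleton_iff.1 hy).symm
    tauto
  exact ((((key 3 (by norm_num) (by norm_num) (by norm_num) (by norm_num)).pow_right 2).mul_right
    (key 7 (by norm_num) (by norm_num) (by norm_num) (by norm_num))).mul_right
    (key 29 (by norm_num) (by norm_num) (by norm_num) (by norm_num))).mul_right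
    (key 163 (by norm_num) (by norm_num) (by norm_num) (by norm_num))

theorem factorization_orderU_59 : orderU.factorization 59 = 3 := by
  have h : orderU = (2^5 * 3^2 * 5^2 * 7 * 29 * 163) * 59 ^ 3 := by norm_num
  rw [h, Nat.factorization_mul (by norm_num) (by norm_num), Finsupp.add_apply,
    Nat.Prime.factorization_pow (by norm_num), Finsupp.single_eq_same,
    Nat.factorization_eq_zero_of_not_dvd (by norm_num)]

instance fact_prime_59 : Fact (Nat.Prime 59) := ⟨by norm_num⟩

theorem exists_orderOf_pow_eq_59 {G : Type*} [Group G] {x : G} {n : ℕ} (hx : x ^ 59 ^ n = 1) (h1 : x ≠ 1) :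
    ∃ k, orderOf (x ^ k) = 59 := by
  obtain ⟨m, hm, hm'⟩ := (Nat.dvd_prime_pow fact_prime_59.out).1 (orderOf_dvd_of_pow_eq_one hx)
  have hm0 : m ≠ 0 := by
    rintro rfl
    exact h1 (orderOf_eq_one_iff.1 (by simpa using hm'))
  obtain ⟨j, rfl⟩ := Nat.exists_eq_succ_of_ne_zero hm0
  refine ⟨59 ^ j, ?_⟩
  rw [orderOf_pow_of_dvd (by positivity) (hm' ▸ pow_dvd_pow 59 (Nat.le_succ j)), hm',
    pow_succ, Nat.mul_div_cancel_left _ (by positivity)]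

namespace ArithU

variable {G : Type*} [Group G] [Finite G]

theorem card_sylow (h : ArithU G) (P : Sylow 59 G) : Nat.card (P : Subgroup G) = 59 ^ 3 := by
  have := P.card_eq_multiplicity
  rwa [h.card, factorization_orderU_59] at this

theorem pow_card_sylow (h : ArithU G) (P : Sylow 59 G) {x : G} (hx : x ∈ P) : x ^ 59 ^ 3 = 1 := by
  have := pow_card_eq_one' (x := (⟨x, hx⟩ : (P : Subgroup G)))
  rw [h.card_sylow P] at this
  exact congrArg Subtype.val this

/-- An element of prime order normalising a `59`-group of order `59 ^ n` and acting without fixed points. -/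
theorem pow_modEq_one {l : ℕ} (hl : l.Prime) (h : ArithU G) (hl2 : l ≠ 2) (hl5 : l ≠ 5)
    (hl59 : l ≠ 59) {z : G} (hz : orderOf z = l) (Q : Subgroup G) (hQ : IsPGroup 59 Q)
    (hzQ : ∀ x ∈ Q, z * x * z⁻¹ ∈ Q) : Nat.card Q ≡ 1 [MOD l] := by
  have : Fact l.Prime := ⟨hl⟩
  have h1 := card_modEq_card_inf_centralizer Q z hzQ l 1 (by rw [pow_one, ← hz, pow_orderOf_eq_one])
  suffices Nat.card (Q ⊓ Subgroup.centralizer {z} : Subgroup G) = 1 by rwa [this] at h1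
  rw [Subgroup.card_eq_one, eq_bot_iff]
  intro x hx
  rw [Subgroup.mem_bot]
  by_contra hne
  obtain ⟨n, hn⟩ := hQ ⟨x, hx.1⟩
  obtain ⟨k, hk⟩ := exists_orderOf_pow_eq_59 (n := n) (by simpa using congrArg Subtype.val hn) hne
  have := h.order_of_commute hl hk hz
    (Commute.pow_left (Subgroup.mem_centralizer_singleton_iff.1 hx.2) k)
  tauto

theorem card_normalizer_and_sylow (h : ArithU G) (P : Sylow 59 G) :
    Nat.card (Subgroup.normalizer (P : Set G)) = 59 ^ 3 * 1160 ∧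
      Nat.card (Sylow 59 G) = 59 ^ 3 + 1 := by
  set N := Subgroup.normalizer (P : Set G)
  have hle : (P : Subgroup G) ≤ N := Subgroup.le_normalizer
  obtain ⟨m, hm⟩ := Subgroup.card_dvd_of_le hle
  have hidx : Nat.card (Sylow 59 G) = N.index := P.card_eq_index_normalizer
  have h1 := Subgroup.card_mul_index N
  have h3 := card_sylow_modEq_one 59 G
  change Nat.card N = Nat.card P * m at hm
  rw [h.card_sylow P] at hm
  rw [← hidx, hm, h.card] at h1
  have h2 : m * Nat.card (Sylow 59 G) = 2^5 * 5^2 * 29 * (3^2 * 7 * 163) :=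
    Nat.eq_of_mul_eq_mul_left (show 0 < 59 ^ 3 by norm_num) (by rw [← mul_assoc, h1]; norm_num)
  have key : ∀ l, l.Prime → l ≠ 2 → l ≠ 5 → l ≠ 59 → 59 ^ 3 % l ≠ 1 % l → m.Coprime l := by
    intro l hl l2 l5 l59 hmod
    rw [Nat.coprime_comm, hl.coprime_iff_not_dvd]
    intro hd
    have : Fact l.Prime := ⟨hl⟩
    obtain ⟨⟨z, hz⟩, hzo⟩ := exists_prime_orderOf_dvd_card' (G := N) l (hm ▸ hd.mul_left _)
    rw [Subgroup.orderOf_mk] at hzo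
    have := pow_modEq_one hl h l2 l5 l59 hzo P P.2
      (fun x hx => (Subgroup.mem_normalizer_iff.1 hz x).1 hx)
    rw [h.card_sylow P] at this
    exact hmod this
  have hm' : m ∣ 2^5 * 5^2 * 29 := by
    refine Nat.Coprime.dvd_of_dvd_mul_right ?_ (h2 ▸ dvd_mul_right m _)
    exact (((key 3 (by norm_num) (by norm_num) (by norm_num) (by norm_num) (by norm_num)).pow_right
      2).mul_right (key 7 (by norm_num) (by norm_num) (by norm_num) (by norm_num)
      (by norm_num))).mul_right (key 163 (by norm_num) (by norm_num) (by norm_num) (by norm_num)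
      (by norm_num))
  have h4 : m % 59 = 39 := by
    have h5 : m * Nat.card (Sylow 59 G) ≡ m * 1 [MOD 59] := h3.mul_left _
    rw [h2, mul_one] at h5
    exact h5.symm.trans (show 2^5 * 5^2 * 29 * (3^2 * 7 * 163) % 59 = 39 % 59 by norm_num)
  have h6 : m = 1160 := by
    have : ∀ m ∈ Nat.divisors 23200, m % 59 = 39 → m = 1160 := by decide +kernel
    exact this m (Nat.mem_divisors.2 ⟨by simpa using hm', by norm_num⟩) h4
  subst h6
  exact ⟨hm, by omega⟩

/-- The elements of `59`-power order centralising a nontrivial such element lie in a common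
Sylow subgroup. -/
theorem exists_sylow_of_commute (h : ArithU G) {d : G} (hd1 : d ≠ 1) {n : ℕ} (hd : d ^ 59 ^ n = 1) :
    ∃ Q : Sylow 59 G, ∀ x : G, ∀ k, x ^ 59 ^ k = 1 → Commute x d → x ∈ Q := by
  obtain ⟨j, hj⟩ := exists_orderOf_pow_eq_59 hd hd1
  set C := Subgroup.centralizer {d ^ j}
  have hC := h.card_centralizer_dvd hj
  have hmod := card_sylow_modEq_one 59 C
  have hs : Nat.card (Sylow 59 C) ∣ 800 := by
    have h1 : Nat.card (Sylow 59 C) ∣ 2^5 * 5^2 * 59 ^ 3 := by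
      rw [(default : Sylow 59 C).card_eq_index_normalizer]
      exact (Subgroup.index_dvd_card _).trans hC
    refine Nat.Coprime.dvd_of_dvd_mul_right (n := 59 ^ 3) (Nat.Coprime.pow_right 3 ?_) (by simpa using h1)
    rw [Nat.coprime_comm, fact_prime_59.out.coprime_iff_not_dvd]
    intro hdvd
    have := (Nat.modEq_zero_iff_dvd.2 hdvd).symm.trans hmod
    exact absurd this (by decide)
  have hs1 : Nat.card (Sylow 59 C) = 1 := by
    have : ∀ m ∈ Nat.divisors 800, m % 59 = 1 → m = 1 := by decide +kernel
    exact this _ (Nat.mem_divisors.2 ⟨hs, by norm_num⟩) hmod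
  have : Subsingleton (Sylow 59 C) := (Nat.card_eq_one_iff_unique.1 hs1).1
  let R : Sylow 59 C := default
  obtain ⟨Q, hQ⟩ := (R.2.map C.subtype).exists_le_sylow
  refine ⟨Q, fun x k hx hxd => hQ ?_⟩
  have hxC : x ∈ C := Subgroup.mem_centralizer_singleton_iff.2 (hxd.pow_right j)
  have hp : IsPGroup 59 (Subgroup.zpowers (⟨x, hxC⟩ : C)) := by
    refine IsPGroup.of_card_dvd_pow (n := k) ?_
    rw [Nat.card_zpowers, orderOf_dvd_iff_pow_eq_one]
    exact Subtype.ext (by simpa using hx)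
  obtain ⟨S, hS⟩ := hp.exists_le_sylow
  rw [Subsingleton.elim S R] at hS
  exact ⟨⟨x, hxC⟩, hS (Subgroup.mem_zpowers _), rfl⟩

end ArithU

theorem dvd_card_of_card_stabilizer_dvd {P Ω : Type*} [Group P] [Finite P] [MulAction P Ω]
    [Finite Ω] {c m : ℕ} (hP : Nat.card P = c * m)
    (h : ∀ ω : Ω, Nat.card (MulAction.stabilizer P ω) ∣ c) : m ∣ Nat.card Ω := by
  classical
  have := Fintype.ofFinite (MulAction.orbitRel.Quotient P Ω)
  rw [Nat.card_congr (MulAction.selfEquivSigmaOrbits P Ω), Nat.card_sigma]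
  refine Finset.dvd_sum fun i _ => ?_
  have h1 := Subgroup.card_mul_index (MulAction.stabilizer P i.out)
  rw [MulAction.index_stabilizer, hP] at h1
  obtain ⟨k, hk⟩ := h i.out
  have hpos : 0 < Nat.card (MulAction.stabilizer P i.out) := Nat.card_pos
  rw [Nat.card_coe_set_eq]
  refine ⟨k, Nat.eq_of_mul_eq_mul_left hpos ?_⟩
  rw [h1, hk]; ring

theorem card_mul_card_le_of_disjoint {G : Type*} [Group G] [Finite G] {A B C : Subgroup G}
    (hA : A ≤ C) (hB : B ≤ C) (h : Disjoint A B) : Nat.card A * Nat.card B ≤ Nat.card C := by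
  rw [← Nat.card_prod]
  refine Nat.card_le_card_of_injective
    (fun x : A × B => (⟨x.1 * x.2, C.mul_mem (hA x.1.2) (hB x.2.2)⟩ : C)) fun x y hxy => ?_
  exact Subgroup.mul_injective_of_disjoint h (congrArg Subtype.val hxy)

/-- The centre of a Sylow subgroup, as a subgroup of the whole group. -/
def Sylow.zc {G : Type*} [Group G] {p : ℕ} (P : Sylow p G) : Subgroup G :=
  (P : Subgroup G) ⊓ Subgroup.centralizer (P : Set G)

namespace ArithU

variable {G : Type*} [Group G] [Finite G]

theorem exists_mem_zc (h : ArithU G) (P : Sylow 59 G) : ∃ d ∈ P.zc, d ≠ 1 := by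
  have : Nontrivial (P : Subgroup G) := by
    rw [← Finite.one_lt_card_iff_nontrivial, h.card_sylow]; norm_num
  have := P.2.center_nontrivial
  obtain ⟨⟨⟨d, hd⟩, hc⟩, hne⟩ := exists_ne (1 : Subgroup.center (P : Subgroup G))
  refine ⟨d, ⟨hd, Subgroup.mem_centralizer_iff.2 fun x hx => ?_⟩, fun e => hne ?_⟩
  · exact congrArg Subtype.val (Subgroup.mem_center_iff.1 hc ⟨x, hx⟩)
  · exact Subtype.ext (Subtype.ext e)

theorem mem_of_commute_zc (h : ArithU G) {P : Sylow 59 G} {d : G} (hd : d ∈ P.zc) (h1 : d ≠ 1)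
    {x : G} {k : ℕ} (hx : x ^ 59 ^ k = 1) (hxd : Commute x d) : x ∈ P := by
  obtain ⟨Q, hQ⟩ := h.exists_sylow_of_commute h1 (h.pow_card_sylow P hd.1)
  have hle : (P : Subgroup G) ≤ Q := fun y hy => hQ y 3 (h.pow_card_sylow P hy)
    (Subgroup.mem_centralizer_iff.1 hd.2 y hy)
  have : (Q : Subgroup G) = P := P.3 Q.2 hle
  have h2 : x ∈ (Q : Subgroup G) := hQ x k hx hxd
  rwa [this] at h2

/-- Two Sylow subgroups are near if one meets the centre of the other. -/
def Near (P P' : Sylow 59 G) : Prop := ∃ d ∈ P.zc, d ≠ 1 ∧ d ∈ P'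

theorem near_self (h : ArithU G) (P : Sylow 59 G) : Near P P := by
  obtain ⟨d, hd, h1⟩ := h.exists_mem_zc P
  exact ⟨d, hd, h1, hd.1⟩

theorem zc_le_of_near (h : ArithU G) {P P' : Sylow 59 G} (hn : Near P P') :
    P'.zc ≤ (P : Subgroup G) := by
  obtain ⟨d, hd, h1, hd'⟩ := hn
  exact fun x hx => h.mem_of_commute_zc hd h1 (h.pow_card_sylow P' hx.1)
    (Subgroup.mem_centralizer_iff.1 hx.2 d hd').symm

theorem near_symm (h : ArithU G) {P P' : Sylow 59 G} (hn : Near P P') : Near P' P := by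
  obtain ⟨d, hd, h1⟩ := h.exists_mem_zc P'
  exact ⟨d, hd, h1, h.zc_le_of_near hn hd⟩

theorem eq_of_le {P P' : Sylow 59 G} (hle : (P : Subgroup G) ≤ P') : P = P' :=
  Sylow.ext (P.3 P'.2 hle).symm

theorem eq_of_mem_zc (h : ArithU G) {P P' : Sylow 59 G} {d : G} (hd : d ∈ P.zc) (hd' : d ∈ P'.zc)
    (h1 : d ≠ 1) : P = P' :=
  eq_of_le fun x hx => h.mem_of_commute_zc hd' h1 (h.pow_card_sylow P hx)
    (Subgroup.mem_centralizer_iff.1 hd.2 x hx)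

theorem exists_card_eq_pow (h : ArithU G) {P : Sylow 59 G} {D : Subgroup G}
    (hD : D ≤ (P : Subgroup G)) : ∃ k ≤ 3, Nat.card D = 59 ^ k :=
  (Nat.dvd_prime_pow fact_prime_59.out).1 (h.card_sylow P ▸ Subgroup.card_dvd_of_le hD)

theorem exists_card_inf_eq_pow (h : ArithU G) {P P' : Sylow 59 G} (hne : P ≠ P') :
    ∃ k ≤ 2, Nat.card (P ⊓ P' : Subgroup G) = 59 ^ k := by
  obtain ⟨k, hk, hk'⟩ := h.exists_card_eq_pow (P := P) (D := P ⊓ P') inf_le_left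
  refine ⟨k, ?_, hk'⟩
  by_contra h3
  obtain rfl : k = 3 := by omega
  have := Subgroup.eq_of_le_of_card_ge (inf_le_left : (P ⊓ P' : Subgroup G) ≤ P)
    (by rw [hk', h.card_sylow])
  exact hne (eq_of_le (inf_eq_left.1 this))

theorem exists_card_zc (h : ArithU G) (P : Sylow 59 G) : ∃ k, 1 ≤ k ∧ Nat.card P.zc = 59 ^ k := by
  obtain ⟨k, -, hk⟩ := h.exists_card_eq_pow (P := P) (D := P.zc) inf_le_left
  refine ⟨k, ?_, hk⟩
  by_contra h0
  obtain rfl : k = 0 := by omega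
  obtain ⟨d, hd, h1⟩ := h.exists_mem_zc P
  rw [pow_zero, Subgroup.card_eq_one] at hk
  rw [hk] at hd
  exact h1 hd

theorem disjoint_zc (h : ArithU G) {P P' : Sylow 59 G} (hne : P ≠ P') : Disjoint P.zc P'.zc := by
  rw [Subgroup.disjoint_def]
  intro x hx hx'
  by_contra h1
  exact hne (h.eq_of_mem_zc hx hx' h1)

theorem card_of_near (h : ArithU G) {P P' : Sylow 59 G} (hne : P ≠ P') (hn : Near P P') :
    Nat.card (P ⊓ P' : Subgroup G) = 59 ^ 2 ∧ Nat.card P.zc = 59 := by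
  obtain ⟨k, hk, hkc⟩ := h.exists_card_inf_eq_pow hne
  obtain ⟨i, hi, hic⟩ := h.exists_card_zc P
  obtain ⟨j, hj, hjc⟩ := h.exists_card_zc P'
  have h1 := card_mul_card_le_of_disjoint (A := P.zc) (B := P'.zc) (C := P ⊓ P')
    (le_inf inf_le_left (h.zc_le_of_near (h.near_symm hn)))
    (le_inf (h.zc_le_of_near hn) inf_le_left) (h.disjoint_zc hne)
  rw [hkc, hic, hjc, ← pow_add] at h1
  have h2 := (Nat.pow_le_pow_iff_right (by norm_num : 1 < 59)).1 h1
  obtain rfl : k = 2 := by omega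
  obtain rfl : i = 1 := by omega
  exact ⟨hkc, by rw [hic]; rfl⟩

theorem card_of_not_near (h : ArithU G) {P P' : Sylow 59 G} (hn : ¬ Near P P') :
    Nat.card (P ⊓ P' : Subgroup G) ∣ 59 := by
  have hne : P ≠ P' := by rintro rfl; exact hn (h.near_self P)
  obtain ⟨k, hk, hkc⟩ := h.exists_card_inf_eq_pow hne
  obtain ⟨j, hj, hjc⟩ := h.exists_card_zc P'
  rw [hkc, ← pow_one 59, ← pow_mul, one_mul]
  refine pow_dvd_pow 59 ?_
  by_contra hk2
  obtain rfl : k = 2 := by omega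
  have hdis : Disjoint P'.zc (P ⊓ P') := by
    rw [Subgroup.disjoint_def]
    intro x hx hx'
    by_contra h1
    exact hn (h.near_symm ⟨x, hx, h1, hx'.1⟩)
  have hinj : Function.Injective (fun x : P'.zc × (P ⊓ P' : Subgroup G) =>
      (⟨x.1 * x.2, mul_mem x.1.2.1 x.2.2.2⟩ : (P' : Subgroup G))) := fun x y hxy =>
    Subgroup.mul_injective_of_disjoint hdis (congrArg Subtype.val hxy)
  have hsurj := (hinj.bijective_of_nat_card_le (by
    rw [Nat.card_prod, hjc, hkc, h.card_sylow, ← pow_add]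
    exact Nat.pow_le_pow_right (by norm_num) (by omega))).2
  have hab := IsPGroup.commutative_of_card_eq_prime_sq (G := (P ⊓ P' : Subgroup G)) hkc
  have hle : (P ⊓ P' : Subgroup G) ≤ P'.zc := by
    intro d hd
    refine ⟨hd.2, Subgroup.mem_centralizer_iff.2 fun x hx => ?_⟩
    obtain ⟨⟨z, e⟩, he⟩ := hsurj ⟨x, hx⟩
    have he' : (z : G) * e = x := congrArg Subtype.val he
    have h1 : (e : G) * d = d * e := congrArg Subtype.val (hab e ⟨d, hd⟩)
    have h2 : d * z = z * d := Subgroup.mem_centralizer_iff.1 z.2.2 d hd.2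
    rw [← he', mul_assoc, h1, ← mul_assoc, ← h2, mul_assoc]
  have : (P ⊓ P' : Subgroup G) = ⊥ := by
    rw [eq_bot_iff]
    exact fun x hx => Subgroup.mem_bot.2 (Subgroup.disjoint_def.1 hdis (hle hx) hx)
  rw [this, Subgroup.card_bot] at hkc
  norm_num at hkc

theorem mem_of_smul_eq {P : Sylow 59 G} {x : G} {k : ℕ} (hx : x ^ 59 ^ k = 1)
    (hP : x • P = P) : x ∈ P := by
  have hp : IsPGroup 59 (Subgroup.zpowers x) := by
    refine IsPGroup.of_card_dvd_pow (n := k) ?_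
    rwa [Nat.card_zpowers, orderOf_dvd_iff_pow_eq_one]
  have h1 := hp.inf_normalizer_sylow P
  have h2 : x ∈ Subgroup.zpowers x ⊓ Subgroup.normalizer (P : Set G) :=
    ⟨Subgroup.mem_zpowers x, Sylow.smul_eq_iff_mem_normalizer.1 hP⟩
  rw [h1] at h2
  exact h2.2

theorem smul_eq_self (P : Sylow 59 G) {x : G} (hx : x ∈ P) : x • P = P :=
  Sylow.smul_eq_iff_mem_normalizer.2 (Subgroup.le_normalizer hx)

theorem mem_smul_iff (P : Sylow 59 G) (x g : G) : x ∈ g • P ↔ g⁻¹ * x * g ∈ P := by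
  have := Subgroup.mem_pointwise_smul_iff_inv_smul_mem (a := MulAut.conj g) (S := (P : Subgroup G))
    (x := x)
  rw [MulAut.smul_def, ← map_inv, MulAut.conj_apply, inv_inv] at this
  exact this

theorem near_smul_iff {P P' : Sylow 59 G} {x : G} (hx : x ∈ P) :
    Near P (x • P') ↔ Near P P' := by
  refine exists_congr fun d => and_congr_right fun hd => and_congr_right fun _ => ?_
  rw [mem_smul_iff]
  have : x * d = d * x := Subgroup.mem_centralizer_iff.1 hd.2 x hx
  rw [show x⁻¹ * d * x = d by rw [mul_assoc, ← this, inv_mul_cancel_left]]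

theorem dvd_card_not_near (h : ArithU G) (P : Sylow 59 G) :
    59 ^ 2 ∣ Nat.card {P' // ¬ Near P P'} := by
  let T : SubMulAction (P : Subgroup G) (Sylow 59 G) :=
    { carrier := {P' | ¬ Near P P'}
      smul_mem' := fun x P' hP' => fun hn => hP' ((near_smul_iff x.2).1 hn) }
  refine dvd_card_of_card_stabilizer_dvd (P := (P : Subgroup G)) (Ω := T) (c := 59) ?_ fun ω => ?_
  · rw [h.card_sylow]; rfl
  · refine dvd_trans (dvd_of_eq ?_) (h.card_of_not_near ω.2)
    refine Nat.card_congr ⟨fun x => ⟨x.1, x.1.2, ?_⟩, fun x => ⟨⟨x, x.2.1⟩, ?_⟩, fun _ => rfl,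
      fun _ => rfl⟩
    · exact mem_of_smul_eq (h.pow_card_sylow P x.1.2) (congrArg Subtype.val x.2)
    · exact Subtype.ext (smul_eq_self _ x.2.2)

theorem card_near_le (h : ArithU G) (P : Sylow 59 G) : Nat.card {P' // Near P P'} ≤ 3540 + 1 := by
  have hex : ∀ P' : Sylow 59 G, ∃ d ∈ P'.zc, orderOf d = 59 := fun P' => by
    obtain ⟨d, hd, h1⟩ := h.exists_mem_zc P'
    obtain ⟨k, hk⟩ := exists_orderOf_pow_eq_59 (h.pow_card_sylow P' hd.1) h1
    exact ⟨d ^ k, pow_mem hd k, hk⟩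
  choose d hd hdo using hex
  have hne : ∀ P' (i : Fin 58), d P' ^ (i.1 + 1) ≠ 1 := fun P' i =>
    pow_ne_one_of_lt_orderOf (by omega) (by rw [hdo]; omega)
  let F : Option ({P' // Near P P'} × Fin 58) → (P : Subgroup G) := fun o => o.elim 1 fun x =>
    ⟨d x.1.1 ^ (x.2.1 + 1), pow_mem (h.zc_le_of_near x.1.2 (hd x.1.1)) _⟩
  have hF : Function.Injective F := by
    rintro (_ | ⟨⟨A, hA⟩, i⟩) (_ | ⟨⟨B, hB⟩, j⟩) hxy
    · rfl
    · exact absurd (congrArg Subtype.val hxy).symm (hne _ _)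
    · exact absurd (congrArg Subtype.val hxy) (hne _ _)
    · have e : d A ^ (i.1 + 1) = d B ^ (j.1 + 1) := congrArg Subtype.val hxy
      obtain rfl : A = B := h.eq_of_mem_zc (pow_mem (hd A) (i.1 + 1))
        (by rw [e]; exact pow_mem (hd B) _) (hne A i)
      have := pow_injOn_Iio_orderOf (x := d A) (show i.1 + 1 < orderOf (d A) by rw [hdo]; omega)
        (show j.1 + 1 < orderOf (d A) by rw [hdo]; omega) e
      obtain rfl : i = j := by omega
      rfl
  have h1 := Nat.card_le_card_of_injective F hF
  rw [Finite.card_option, Nat.card_prod, h.card_sylow, Nat.card_fin] at h1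
  omega

theorem card_near (h : ArithU G) (P : Sylow 59 G) :
    Nat.card {P' // Near P P'} = 1 ∨ Nat.card {P' // Near P P'} = 59 ^ 2 + 1 := by
  classical
  obtain ⟨k, hk⟩ := h.dvd_card_not_near P
  have h1 := h.card_near_le P
  have h2 : Nat.card {P' // Near P P'} + Nat.card {P' // ¬ Near P P'} = 59 ^ 3 + 1 := by
    rw [← Nat.card_sum, Nat.card_congr (Equiv.sumCompl _), (h.card_normalizer_and_sylow P).2]
  omega

/-- One trivial intersection of Sylow subgroups makes all of them trivial. -/
theorem inf_eq_bot_of_exists (h : ArithU G) {P P₀ : Sylow 59 G}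
    (h0 : ∀ x ∈ P, x ∈ P₀ → x = 1) (hne : P₀ ≠ P) {Q R : Sylow 59 G} (hQR : Q ≠ R) {x : G}
    (hxQ : x ∈ Q) (hxR : x ∈ R) : x = 1 := by
  have hsurj : ∀ R : Sylow 59 G, R ≠ P → ∃ x ∈ P, x • P₀ = R := by
    let F : Option (P : Subgroup G) → Sylow 59 G := fun o => o.elim P fun x => (x : G) • P₀
    have hn : ∀ x : (P : Subgroup G), (x : G) • P₀ ≠ P := fun x hx => hne
      (smul_left_cancel (x : G) (hx.trans (smul_eq_self P x.2).symm))
    have hF : Function.Injective F := by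
      rintro (_ | x) (_ | y) hxy
      · rfl
      · exact absurd hxy.symm (hn y)
      · exact absurd hxy (hn x)
      · have hxy' : (x : G) • P₀ = (y : G) • P₀ := hxy
        have h1 : ((x : G)⁻¹ * y) • P₀ = P₀ := by rw [mul_smul, ← hxy', inv_smul_smul]
        have h2 : (x : G)⁻¹ * y ∈ P := mul_mem (inv_mem x.2) y.2
        have h3 := h0 _ h2 (mem_of_smul_eq (h.pow_card_sylow P h2) h1)
        rw [inv_mul_eq_one] at h3
        exact congrArg some (Subtype.ext h3)
    have hs := (hF.bijective_of_nat_card_le (by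
      rw [Finite.card_option, h.card_sylow, (h.card_normalizer_and_sylow P).2])).2
    intro R hR
    obtain ⟨_ | x, hx⟩ := hs R
    · exact absurd hx.symm hR
    · exact ⟨x, x.2, hx⟩
  obtain ⟨g, rfl⟩ := MulAction.exists_smul_eq G P Q
  obtain ⟨y, hy, hy'⟩ := hsurj (g⁻¹ • R) (by
    rintro e
    exact hQR (by rw [← e, smul_inv_smul]))
  have e : R = (g * y) • P₀ := by rw [mul_smul, hy', smul_inv_smul]
  rw [e, mem_smul_iff] at hxR
  rw [mem_smul_iff] at hxQ
  have h2 : (g * y)⁻¹ * x * (g * y) = y⁻¹ * (g⁻¹ * x * g) * y := by group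
  rw [h2] at hxR
  have h3 := h0 _ (mul_mem (mul_mem (inv_mem hy) hxQ) hy) hxR
  have h4 : x = (g * y) * (y⁻¹ * (g⁻¹ * x * g) * y) * (g * y)⁻¹ := by group
  rw [h4, h3]; group

end ArithU

namespace ArithU

variable {G : Type*} [Group G] [Finite G]

theorem not_centralizes_all (h : ArithU G) {x : G} {l : ℕ} (hl : l.Prime) (l7 : l ≠ 7)
    (l163 : l ≠ 163) (hx : orderOf x = l)
    (hc : ∀ P : Sylow 59 G, ∀ a ∈ P, Commute a x) : False := by
  set C := Subgroup.centralizer {x}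
  have hle : ∀ P : Sylow 59 G, (P : Subgroup G) ≤ C := fun P a ha =>
    Subgroup.mem_centralizer_singleton_iff.2 (hc P a ha)
  have : MulAction.IsPretransitive C (Sylow 59 G) := ⟨fun P Q => by
    obtain ⟨g, hg⟩ := MulAction.exists_smul_eq C (P.subtype (hle P)) (Q.subtype (hle Q))
    exact ⟨g, Sylow.subtype_injective (hP := hle _) (hQ := hle _)
      (by rw [← Sylow.smul_subtype]; exact hg)⟩⟩
  have h1 := MulAction.index_stabilizer_of_transitive C (default : Sylow 59 G)
  rw [(h.card_normalizer_and_sylow default).2] at h1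
  have h2 : 163 ∣ Nat.card C := by
    refine dvd_trans ?_ (h1 ▸ Subgroup.index_dvd_card _)
    norm_num
  have : Fact (Nat.Prime 163) := ⟨by norm_num⟩
  obtain ⟨⟨y, hy⟩, hyo⟩ := exists_prime_orderOf_dvd_card' (G := C) 163 h2
  rw [Subgroup.orderOf_mk] at hyo
  exact l7 (h.nbr163 l hl l163 (gkAdj_of_commute (by norm_num) hl l163.symm hyo hx
    (Subgroup.mem_centralizer_singleton_iff.1 hy)))

theorem conj_mem_smul {P : Sylow 59 G} {x : G} (g : G) (hx : x ∈ P) : g * x * g⁻¹ ∈ g • P := by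
  rw [mem_smul_iff]
  simpa [mul_assoc] using hx

theorem conj_mem_zc_smul {P : Sylow 59 G} {x : G} (g : G) (hx : x ∈ P.zc) :
    g * x * g⁻¹ ∈ (g • P).zc := by
  refine ⟨conj_mem_smul g hx.1, Subgroup.mem_centralizer_iff.2 fun y hy => ?_⟩
  have h1 : g⁻¹ * y * g ∈ P := (mem_smul_iff _ _ _).1 hy
  have h2 : (g⁻¹ * y * g) * x = x * (g⁻¹ * y * g) := Subgroup.mem_centralizer_iff.1 hx.2 _ h1
  have h3 := congrArg (fun u => g * u * g⁻¹) h2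
  simpa [mul_assoc] using h3

theorem near_smul {P P' : Sylow 59 G} (g : G) (hn : Near P P') : Near (g • P) (g • P') := by
  obtain ⟨d, hd, h1, hd'⟩ := hn
  exact ⟨g * d * g⁻¹, conj_mem_zc_smul g hd, fun e => h1 (conj_eq_one_iff.1 e),
    conj_mem_smul g hd'⟩

theorem exists_near_fixed {P : Sylow 59 G} (hcard : Nat.card {P' // Near P P'} = 59 ^ 2 + 1) {z : G}
    (hz : z ^ 5 ^ 1 = 1) (hzP : z • P = P) (hP : Near P P) :
    ∃ P', P' ≠ P ∧ Near P P' ∧ z • P' = P' := by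
  have : Fact (Nat.Prime 5) := ⟨by norm_num⟩
  have hiff : ∀ P', Near P (z • P') ↔ Near P P' := fun P' => by
    refine ⟨fun hn => ?_, fun hn => ?_⟩
    · have := near_smul z⁻¹ hn
      rwa [inv_smul_smul, inv_smul_eq_iff.2 hzP.symm] at this
    · have := near_smul z hn
      rwa [hzP] at this
  let σ : Equiv.Perm {P' // Near P P'} := (MulAction.toPerm z).subtypePerm hiff
  have hσ : ∀ (n : ℕ) x, ((σ ^ n) x : Sylow 59 G) = z ^ n • x.1 := by
    intro n
    induction n with
    | zero => intro x; simp
    | succ n ih =>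
      intro x
      rw [pow_succ, Equiv.Perm.mul_apply, ih, pow_succ, mul_smul]
      rfl
  have h1 := card_modEq_card_fixed σ 5 1 (by
    ext1 x
    refine Subtype.ext ?_
    rw [hσ, hz, one_smul]; rfl)
  rw [hcard] at h1
  by_contra! hno
  have h2 : Nat.card {x // σ x = x} = 1 := by
    rw [Nat.card_eq_one_iff_unique]
    have key : ∀ x : {x // σ x = x}, x.1.1 = P := fun x => by
      by_contra hne
      exact hno x.1.1 hne x.1.2 (congrArg Subtype.val x.2)
    exact ⟨⟨fun x y => Subtype.ext (Subtype.ext ((key x).trans (key y).symm))⟩,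
      ⟨⟨⟨P, hP⟩, Subtype.ext hzP⟩⟩⟩
  rw [h2] at h1
  exact absurd h1 (by decide)

theorem commute_of_card_near (h : ArithU G) {P : Sylow 59 G}
    (hcard : Nat.card {P' // Near P P'} = 59 ^ 2 + 1) {z : G} (hz : orderOf z = 5)
    (hzP : z • P = P) {a : G} (ha : a ∈ P) : Commute a z := by
  have : Fact (Nat.Prime 5) := ⟨by norm_num⟩
  have hz5 : z ^ 5 ^ 1 = 1 := by rw [pow_one, ← hz, pow_orderOf_eq_one]
  obtain ⟨P', hne, hn, hzP'⟩ := exists_near_fixed hcard hz5 hzP (h.near_self P)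
  have hinv : ∀ Q : Sylow 59 G, z • Q = Q → ∀ x ∈ Q, z * x * z⁻¹ ∈ Q := fun Q hQ x hx => by
    have := conj_mem_smul z hx
    rwa [hQ] at this
  obtain ⟨hD, hZ⟩ := h.card_of_near hne.symm hn
  have hc1 := card_modEq_card_inf_centralizer (P ⊓ P' : Subgroup G) z
    (fun x hx => ⟨hinv P hzP x hx.1, hinv P' hzP' x hx.2⟩) 5 1 hz5
  have hc2 := card_modEq_card_inf_centralizer P.zc z
    (fun x hx => by have := conj_mem_zc_smul z hx; rwa [hzP] at this) 5 1 hz5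
  have hc3 := card_modEq_card_inf_centralizer (P : Subgroup G) z (hinv P hzP) 5 1 hz5
  rw [hD] at hc1
  rw [hZ] at hc2
  rw [h.card_sylow] at hc3
  obtain ⟨i, hi, hic⟩ := h.exists_card_eq_pow (P := P)
    (D := P ⊓ P' ⊓ Subgroup.centralizer {z}) (inf_le_left.trans inf_le_left)
  obtain ⟨j, hj, hjc⟩ := h.exists_card_eq_pow (P := P)
    (D := P ⊓ Subgroup.centralizer {z}) inf_le_left
  have hi0 : i ≠ 0 := by
    rintro rfl
    rw [pow_zero, Subgroup.card_eq_one] at hic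
    have : Nat.card (P.zc ⊓ Subgroup.centralizer {z} : Subgroup G) = 1 := by
      rw [Subgroup.card_eq_one, eq_bot_iff, ← hic]
      exact le_inf (le_inf (inf_le_left.trans inf_le_left)
        (inf_le_left.trans (h.zc_le_of_near (h.near_symm hn)))) inf_le_right
    rw [this] at hc2
    exact absurd hc2 (by decide)
  rw [hic] at hc1
  rw [hjc] at hc3
  have hij : i ≤ j := by
    have := Subgroup.card_le_of_le (show ((P : Subgroup G) ⊓ P' ⊓ Subgroup.centralizer {z}) ≤
      (P : Subgroup G) ⊓ Subgroup.centralizer {z} from inf_le_inf_right _ inf_le_left)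
    rw [hic, hjc] at this
    exact (Nat.pow_le_pow_iff_right (by norm_num)).1 this
  have hj3 : j = 3 := by
    interval_cases i <;> interval_cases j <;> first | rfl | (revert hc1 hc3; decide) | omega
  rw [hj3, ← h.card_sylow P] at hjc
  have h4 := Subgroup.eq_of_le_of_card_ge
    (inf_le_left : ((P : Subgroup G) ⊓ Subgroup.centralizer {z}) ≤ P) hjc.ge
  exact Subgroup.mem_centralizer_singleton_iff.1 (inf_eq_left.1 h4 ha)

/-- Distinct Sylow `59`-subgroups intersect trivially. -/
theorem eq_one_of_mem_of_mem (h : ArithU G) {Q R : Sylow 59 G} (hQR : Q ≠ R) {x : G}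
    (hxQ : x ∈ Q) (hxR : x ∈ R) : x = 1 := by
  by_contra hx1
  have hall : ∀ P P' : Sylow 59 G, ∃ d ∈ P, d ≠ 1 ∧ d ∈ P' := by
    intro P P'
    by_cases e : P' = P
    · subst e
      obtain ⟨d, hd, h1⟩ := h.exists_mem_zc P'
      exact ⟨d, hd.1, h1, hd.1⟩
    · by_contra! hno
      exact hx1 (h.inf_eq_bot_of_exists (fun x hx hx' => by_contra fun h1 => hno x hx h1 hx') e
        hQR hxQ hxR)
  -- any two Sylow subgroups have a common near one
  have hmid : ∀ P P' : Sylow 59 G, ∃ S, Near P S ∧ Near S P' := by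
    intro P P'
    obtain ⟨d, hd, h1, hd'⟩ := hall P P'
    obtain ⟨S, hS⟩ := h.exists_sylow_of_commute h1 (h.pow_card_sylow P hd)
    have : ∀ P : Sylow 59 G, d ∈ P → Near P S := fun P hd => by
      obtain ⟨e, he, he1⟩ := h.exists_mem_zc P
      exact ⟨e, he, he1, hS e 3 (h.pow_card_sylow P he.1)
        (Subgroup.mem_centralizer_iff.1 he.2 d hd).symm⟩
    exact ⟨S, this P hd, h.near_symm (this P' hd')⟩
  have hcard : ∀ P : Sylow 59 G, Nat.card {P' // Near P P'} = 59 ^ 2 + 1 := by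
    intro P
    refine (h.card_near P).resolve_left fun h1 => ?_
    have hP : ∀ S, Near P S → S = P := fun S hS => by
      have := (Nat.card_eq_one_iff_unique.1 h1).1
      exact congrArg Subtype.val (Subsingleton.elim (⟨S, hS⟩ : {P' // Near P P'}) ⟨P, h.near_self P⟩)
    have : ∀ P', P' = P := fun P' => by
      obtain ⟨S, hS, hS'⟩ := hmid P P'
      obtain rfl := hP S hS
      exact hP P' hS'
    exact hQR ((this Q).trans (this R).symm)
  have : Fact (Nat.Prime 5) := ⟨by norm_num⟩
  obtain ⟨⟨z, hz⟩, hzo⟩ := exists_prime_orderOf_dvd_card'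
    (G := Subgroup.normalizer (Q : Set G)) 5 (by
      rw [(h.card_normalizer_and_sylow Q).1]; norm_num)
  rw [Subgroup.orderOf_mk] at hzo
  have hprop : ∀ P P' : Sylow 59 G, Near P P' → (∀ a ∈ P, Commute a z) → ∀ a ∈ P', Commute a z := by
    intro P P' hn hP a ha
    obtain ⟨d, hd, h1, hd'⟩ := h.near_symm hn
    refine h.commute_of_card_near (hcard P') hzo ?_ ha
    refine Sylow.ext (P'.3 (z • P').2 ?_).symm |>.symm
    intro y hy
    have hy' : z⁻¹ * y * z ∈ P' := by
      refine h.mem_of_commute_zc hd h1 (k := 3) ?_ ?_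
      · have := h.pow_card_sylow P' hy
        have e := conj_pow (i := 59 ^ 3) (a := z⁻¹) (b := y)
        rw [inv_inv] at e
        rw [e, this]; group
      · have c1 : Commute y d := Subgroup.mem_centralizer_iff.1 hd.2 y hy
        have c2 : Commute d z := hP d hd'
        exact ((c2.symm.inv_left).mul_left c1).mul_left c2.symm
    exact (mem_smul_iff _ _ _).2 hy'
  refine h.not_centralizes_all (l := 5) (by norm_num) (by norm_num) (by norm_num) hzo fun P => ?_
  obtain ⟨S, hS, hS'⟩ := hmid Q P
  exact hprop S P hS' (hprop Q S hS fun a ha =>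
    h.commute_of_card_near (hcard Q) hzo (Sylow.smul_eq_iff_mem_normalizer.2 hz) ha)

theorem faithful (h : ArithU G) {x : G} (hx : ∀ P : Sylow 59 G, x • P = P) : x = 1 := by
  by_contra hx1
  obtain ⟨l, hl, hlx⟩ := Nat.exists_prime_and_dvd (mt orderOf_eq_one_iff.1 hx1)
  obtain ⟨m, hm⟩ := hlx
  have hm0 : m ≠ 0 := by rintro rfl; exact (orderOf_pos x).ne' hm
  have hz : orderOf (x ^ m) = l := by
    rw [orderOf_pow_of_dvd hm0 (hm ▸ dvd_mul_left m l), hm, Nat.mul_div_cancel _ (by omega)]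
  have hzP : ∀ P : Sylow 59 G, x ^ m • P = P := fun P => by
    have : x ∈ MulAction.stabilizer G P := hx P
    exact pow_mem this m
  have hK : ∀ y : G, (∀ P : Sylow 59 G, y • P = P) → ∀ k, y ^ 59 ^ k = 1 → y = 1 := by
    intro y hy k hk
    have : 1 < Nat.card (Sylow 59 G) := by rw [(h.card_normalizer_and_sylow default).2]; norm_num
    rw [Finite.one_lt_card_iff_nontrivial] at this
    obtain ⟨P, Q, hPQ⟩ := exists_pair_ne (Sylow 59 G)
    exact h.eq_one_of_mem_of_mem hPQ (mem_of_smul_eq hk (hy P)) (mem_of_smul_eq hk (hy Q))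
  have hdvd : l ∣ 59 ^ 3 * 1160 := by
    rw [← (h.card_normalizer_and_sylow default).1, ← hz]
    exact Subgroup.orderOf_dvd_natCard _ (Sylow.smul_eq_iff_mem_normalizer.1 (hzP default))
  refine h.not_centralizes_all hl ?_ ?_ hz fun P a ha => ?_
  · rintro rfl; norm_num at hdvd
  · rintro rfl; norm_num at hdvd
  · have h1 : x ^ m * a * (x ^ m)⁻¹ ∈ P := by
      have := conj_mem_smul (x ^ m) ha
      rwa [hzP P] at this
    have h2 : x ^ m * a * (x ^ m)⁻¹ * a⁻¹ = 1 := by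
      refine hK _ (fun Q => ?_) 3 (h.pow_card_sylow P (mul_mem h1 (inv_mem ha)))
      rw [mul_smul, mul_smul, mul_smul, inv_smul_eq_iff.2 (hzP _).symm, smul_inv_smul, hzP]
    rw [mul_inv_eq_one, mul_inv_eq_iff_eq_mul] at h2
    exact h2.symm

end ArithU

/-- The data extracted from the order and the prime graph: a faithful action of `G` with
subgroups `P p` of the point stabilisers which are regular on the remaining points. -/
structure UAction (G Ω : Type*) [Group G] [MulAction G Ω] where
  P : Ω → Subgroup G
  card_P : ∀ p, Nat.card (P p) = 59 ^ 3
  card_Ω : Nat.card Ω = 59 ^ 3 + 1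
  card_G : Nat.card G = (59 ^ 3 + 1) * (59 ^ 3 * 1160)
  conj_mem : ∀ (g : G) (p : Ω) (x : G), x ∈ P p → g * x * g⁻¹ ∈ P (g • p)
  fix : ∀ p, ∀ x ∈ P p, x • p = p
  free : ∀ p q, q ≠ p → ∀ x ∈ P p, x • q = q → x = 1
  hom_units : ∀ (φ : G →* ℤˣ) (g : G), φ g = 1
  order29 : ∀ y : G, orderOf y = 29 → ∀ p, ∀ x ∈ P p, Commute x y → x = 1
  faithful : ∀ g : G, (∀ p : Ω, g • p = p) → g = 1

def ArithU.uAction {G : Type*} [Group G] [Finite G] (h : ArithU G) : UAction G (Sylow 59 G) where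
  P := Sylow.toSubgroup
  card_P := h.card_sylow
  card_Ω := (h.card_normalizer_and_sylow default).2
  card_G := by rw [h.card, orderU]; norm_num
  conj_mem g _ _ hx := ArithU.conj_mem_smul g hx
  fix p _ hx := ArithU.smul_eq_self p hx
  free p q hne x hx hq := h.eq_one_of_mem_of_mem hne.symm hx
    (ArithU.mem_of_smul_eq (h.pow_card_sylow p hx) hq)
  hom_units := h.hom_units
  order29 y hy p x hx hxy := by
    by_contra h1
    obtain ⟨k, hk⟩ := exists_orderOf_pow_eq_59 (h.pow_card_sylow p hx) h1
    have := h.order_of_commute (by norm_num) hk hy (hxy.pow_left k)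
    omega
  faithful _ hg := h.faithful hg

/-- A `UAction` with two distinguished points. -/
structure UPair (G Ω : Type*) [Group G] [MulAction G Ω] extends UAction G Ω where
  i : Ω
  o : Ω
  ne : o ≠ i

theorem UAction.nonempty_uPair {G Ω : Type*} [Group G] [MulAction G Ω] (U : UAction G Ω) :
    Nonempty (UPair G Ω) := by
  have h1 : 0 < Nat.card Ω := by rw [U.card_Ω]; norm_num
  have : Finite Ω := (Nat.card_pos_iff.1 h1).2
  have h2 : 1 < Nat.card Ω := by rw [U.card_Ω]; norm_num
  rw [Finite.one_lt_card_iff_nontrivial] at h2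
  obtain ⟨o, i, h⟩ := exists_pair_ne Ω
  exact ⟨⟨U, i, o, h⟩⟩

namespace UPair

variable {G Ω : Type*} [Group G] [MulAction G Ω] [Finite G] [Finite Ω] (U : UPair G Ω)

theorem conj_mem_iff (g : G) (p : Ω) (x : G) : g * x * g⁻¹ ∈ U.P (g • p) ↔ x ∈ U.P p := by
  refine ⟨fun h => ?_, U.conj_mem g p x⟩
  have := U.conj_mem g⁻¹ _ _ h
  rw [inv_smul_smul] at this
  convert this using 1
  group

theorem conj_mem_of_smul_eq {g : G} {p : Ω} (hg : g • p = p) {x : G} (hx : x ∈ U.P p) :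
    g * x * g⁻¹ ∈ U.P p := by
  have := U.conj_mem g p x hx
  rwa [hg] at this

theorem exists_mem_smul_eq {p q r : Ω} (hq : q ≠ p) (hr : r ≠ p) : ∃ x ∈ U.P p, x • q = r := by
  let F : Option (U.P p) → Ω := fun o => o.elim p fun x => (x : G) • q
  have hn : ∀ x : U.P p, (x : G) • q ≠ p := fun x hx => hq
    (smul_left_cancel (x : G) (hx.trans (U.fix p x x.2).symm))
  have hF : Function.Injective F := by
    rintro (_ | x) (_ | y) hxy
    · rfl
    · exact absurd hxy.symm (hn y)
    · exact absurd hxy (hn x)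
    · have hxy' : (x : G) • q = (y : G) • q := hxy
      have h1 : ((x : G)⁻¹ * y) • q = q := by rw [mul_smul, ← hxy', inv_smul_smul]
      have h3 := U.free p q hq _ (mul_mem (inv_mem x.2) y.2) h1
      rw [inv_mul_eq_one] at h3
      exact congrArg some (Subtype.ext h3)
  obtain ⟨_ | x, hx⟩ := (hF.bijective_of_nat_card_le
    (by rw [Finite.card_option, U.card_P, U.card_Ω])).2 r
  · exact absurd hx.symm hr
  · exact ⟨x, x.2, hx⟩

theorem eq_of_smul_eq {p q : Ω} (hq : q ≠ p) {x y : G} (hx : x ∈ U.P p) (hy : y ∈ U.P p)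
    (h : x • q = y • q) : x = y := by
  have := U.free p q hq (x⁻¹ * y) (mul_mem (inv_mem hx) hy) (by rw [mul_smul, ← h, inv_smul_smul])
  exact inv_mul_eq_one.1 this

theorem exists_ne_ne (U : UPair G Ω) (p q : Ω) : ∃ r, r ≠ p ∧ r ≠ q := by
  classical
  have := Fintype.ofFinite Ω
  by_contra! h
  have h1 : (Finset.univ : Finset Ω) ⊆ {p, q} := fun r _ => by
    rw [Finset.mem_insert, Finset.mem_singleton]
    by_cases e : r = p
    · exact .inl e
    · exact .inr (h r e)
  have h2 := (Finset.card_le_card h1).trans Finset.card_le_two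
  rw [Finset.card_univ, ← Nat.card_eq_fintype_card, U.card_Ω] at h2
  omega

theorem exists_smul_eq (U : UPair G Ω) (p q : Ω) : ∃ g : G, g • p = q := by
  obtain ⟨r, hp, hq⟩ := U.exists_ne_ne p q
  obtain ⟨x, -, hx⟩ := U.exists_mem_smul_eq hp.symm hq.symm
  exact ⟨x, hx⟩

/-- `G` acts doubly transitively. -/
theorem exists_smul_eq_smul_eq (U : UPair G Ω) {p q p' q' : Ω} (h : p ≠ q) (h' : p' ≠ q') :
    ∃ g : G, g • p = p' ∧ g • q = q' := by
  obtain ⟨g, hg⟩ := U.exists_smul_eq p p'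
  obtain ⟨x, hx, hx'⟩ := U.exists_mem_smul_eq (p := p') (q := g • q) (r := q')
    (fun e => h (smul_left_cancel g (hg.trans e.symm))) h'.symm
  exact ⟨x * g, by rw [mul_smul, hg, U.fix p' x hx], by rw [mul_smul, hx']⟩

/-- The two point stabiliser. -/
def H : Subgroup G := MulAction.stabilizer G U.i ⊓ MulAction.stabilizer G U.o

theorem mem_H {h : G} : h ∈ U.H ↔ h • U.i = U.i ∧ h • U.o = U.o := Iff.rfl

theorem conj_mem_P {h x : G} (hh : h ∈ U.H) (hx : x ∈ U.P U.i) : h * x * h⁻¹ ∈ U.P U.i :=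
  U.conj_mem_of_smul_eq hh.1 hx

theorem card_H : Nat.card U.H = 1160 := by
  have : MulAction.IsPretransitive G Ω := ⟨U.exists_smul_eq⟩
  have h1 := Subgroup.card_mul_index (MulAction.stabilizer G U.i)
  rw [MulAction.index_stabilizer_of_transitive, U.card_G, U.card_Ω, mul_comm] at h1
  have h2 := Nat.eq_of_mul_eq_mul_left (by norm_num) h1
  let F : U.P U.i × U.H → MulAction.stabilizer G U.i := fun x => ⟨x.1 * x.2, mul_mem
    (U.fix U.i _ x.1.2) x.2.2.1⟩
  have hF : Function.Bijective F := by
    constructor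
    · rintro ⟨⟨x, hx⟩, ⟨h, hh⟩⟩ ⟨⟨y, hy⟩, ⟨k, hk⟩⟩ hxy
      have e : x * h = y * k := congrArg Subtype.val hxy
      have e2 := congrArg (fun g => g • U.o) e
      simp only [mul_smul, U.mem_H.1 hh, U.mem_H.1 hk] at e2
      obtain rfl := U.eq_of_smul_eq U.ne hx hy e2
      obtain rfl := mul_left_cancel e
      rfl
    · rintro ⟨g, hg⟩
      have hg' : g • U.i = U.i := hg
      obtain ⟨x, hx, hx'⟩ := U.exists_mem_smul_eq (p := U.i) (q := U.o) (r := g • U.o) U.ne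
        (fun e => U.ne (smul_left_cancel g (e.trans hg'.symm)))
      refine ⟨⟨⟨x, hx⟩, ⟨x⁻¹ * g, ?_, ?_⟩⟩, Subtype.ext (mul_inv_cancel_left x g)⟩
      · exact (MulAction.stabilizer G U.i).mul_mem
          ((MulAction.stabilizer G U.i).inv_mem (U.fix U.i x hx)) hg
      · change (x⁻¹ * g) • U.o = U.o
        rw [mul_smul, ← hx', inv_smul_smul]
  have h3 := Nat.card_congr (Equiv.ofBijective F hF)
  rw [Nat.card_prod, U.card_P, h2] at h3
  exact Nat.eq_of_mul_eq_mul_left (by norm_num) h3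

/-- The fixed points of `h ∈ H` in terms of its centraliser in the Sylow subgroup. -/
theorem smul_smul_o_eq_iff {h x : G} (hh : h ∈ U.H) (hx : x ∈ U.P U.i) :
    h • x • U.o = x • U.o ↔ Commute h x := by
  have e : h • x • U.o = (h * x * h⁻¹) • U.o := by
    rw [mul_smul, mul_smul, inv_smul_eq_iff.2 hh.2.symm]
  rw [e]
  constructor
  · intro e
    have := U.eq_of_smul_eq U.ne (U.conj_mem_P hh hx) hx e
    rwa [mul_inv_eq_iff_eq_mul] at this
  · intro e
    rw [e.eq, mul_inv_cancel_right]

theorem smul_o_ne {x : G} (hx : x ∈ U.P U.i) : x • U.o ≠ U.i := fun e =>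
  U.ne (smul_left_cancel x (e.trans (U.fix _ _ hx).symm))

theorem card_fixed {h : G} (hh : h ∈ U.H) : Nat.card {q : Ω // h • q = q} =
    Nat.card (U.P U.i ⊓ Subgroup.centralizer {h} : Subgroup G) + 1 := by
  rw [← Finite.card_option]
  symm
  let F : Option (U.P U.i ⊓ Subgroup.centralizer {h} : Subgroup G) → {q : Ω // h • q = q} :=
    fun x => x.elim ⟨U.i, hh.1⟩ fun x => ⟨(x : G) • U.o, (U.smul_smul_o_eq_iff hh x.2.1).2
      (Subgroup.mem_centralizer_singleton_iff.1 x.2.2 : (x : G) * h = h * x).symm⟩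
  refine Nat.card_congr (Equiv.ofBijective F ⟨?_, ?_⟩)
  · rintro (_ | x) (_ | y) hxy
    · rfl
    · exact absurd (congrArg Subtype.val hxy).symm (U.smul_o_ne y.2.1)
    · exact absurd (congrArg Subtype.val hxy) (U.smul_o_ne x.2.1)
    · exact congrArg some (Subtype.ext (U.eq_of_smul_eq U.ne x.2.1 y.2.1
        (congrArg Subtype.val hxy)))
  · rintro ⟨q, hq⟩
    by_cases e : q = U.i
    · subst e; exact ⟨none, rfl⟩
    · obtain ⟨x, hx, rfl⟩ := U.exists_mem_smul_eq U.ne e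
      exact ⟨some ⟨x, hx, Subgroup.mem_centralizer_singleton_iff.2
        ((U.smul_smul_o_eq_iff hh hx).1 hq).symm⟩, rfl⟩

theorem eq_one_of_commute {h : G} (hh : h ∈ U.H) (hc : ∀ x ∈ U.P U.i, Commute h x) : h = 1 := by
  refine U.faithful h fun q => ?_
  by_cases e : q = U.i
  · subst e; exact hh.1
  · obtain ⟨x, hx, rfl⟩ := U.exists_mem_smul_eq U.ne e
    exact (U.smul_smul_o_eq_iff hh hx).2 (hc x hx)

theorem sign_toPerm (U : UPair G Ω) [Fintype Ω] [DecidableEq Ω] (g : G) :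
    Equiv.Perm.sign (MulAction.toPerm g : Equiv.Perm Ω) = 1 :=
  U.hom_units (Equiv.Perm.sign.comp (MulAction.toPermHom G Ω)) g

theorem exists_card_centralizer (h : G) : ∃ k ≤ 3,
    Nat.card (U.P U.i ⊓ Subgroup.centralizer {h} : Subgroup G) = 59 ^ k :=
  (Nat.dvd_prime_pow fact_prime_59.out).1 (U.card_P U.i ▸ Subgroup.card_dvd_of_le inf_le_left)

theorem eq_one_of_card_centralizer {h : G} (hh : h ∈ U.H)
    (hc : Nat.card (U.P U.i ⊓ Subgroup.centralizer {h} : Subgroup G) = 59 ^ 3) : h = 1 := by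
  have h1 := Subgroup.eq_of_le_of_card_ge
    (inf_le_left : (U.P U.i ⊓ Subgroup.centralizer {h} : Subgroup G) ≤ U.P U.i)
    (by rw [hc, U.card_P])
  exact U.eq_one_of_commute hh fun x hx =>
    (Subgroup.mem_centralizer_singleton_iff.1 (inf_eq_left.1 h1 hx) : x * h = h * x).symm

theorem toPerm_pow (g : G) (n : ℕ) :
    (MulAction.toPerm g : Equiv.Perm Ω) ^ n = MulAction.toPerm (g ^ n) :=
  (map_pow (MulAction.toPermHom G Ω) g n).symm

theorem card_centralizer_of_involution {h : G} (hh : h ∈ U.H) (h2 : h ^ 2 = 1) (h1 : h ≠ 1) :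
    Nat.card (U.P U.i ⊓ Subgroup.centralizer {h} : Subgroup G) = 59 := by
  classical
  have := Fintype.ofFinite Ω
  obtain ⟨a, ha, hs⟩ := sign_of_pow_two (MulAction.toPerm h : Equiv.Perm Ω)
    (by rw [toPerm_pow, h2]; ext; simp)
  rw [U.sign_toPerm] at hs
  have hev : Even a := by
    by_contra ho
    rw [Nat.not_even_iff_odd] at ho
    rw [ho.neg_one_pow] at hs
    exact absurd hs (by decide)
  obtain ⟨b, rfl⟩ := hev
  have e := U.card_fixed hh
  obtain ⟨k, hk, hkc⟩ := U.exists_card_centralizer h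
  change _ = Nat.card {q : Ω // h • q = q} + _ at ha
  rw [e, hkc, U.card_Ω] at ha
  interval_cases k
  · omega
  · exact hkc
  · omega
  · exact absurd (U.eq_one_of_card_centralizer hh hkc) h1

/-- An element of `H` whose square is an involution fixing `60` points is not free on the
remaining `58` of these. -/
theorem card_centralizer_of_pow_four {h : G} (hh : h ∈ U.H) (h4 : h ^ 4 = 1)
    (h2 : Nat.card (U.P U.i ⊓ Subgroup.centralizer {h ^ 2} : Subgroup G) = 59) :
    Nat.card (U.P U.i ⊓ Subgroup.centralizer {h} : Subgroup G) ≠ 1 := by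
  classical
  intro h1
  have := Fintype.ofFinite Ω
  obtain ⟨a, b, ha, hb, hs⟩ := sign_of_pow_four (MulAction.toPerm h : Equiv.Perm Ω)
    (by rw [toPerm_pow, h4]; ext; simp)
  rw [U.sign_toPerm] at hs
  rw [toPerm_pow] at ha hb
  change Nat.card {q : Ω // h ^ 2 • q = q} = Nat.card {q : Ω // h • q = q} + _ at ha
  change _ = Nat.card {q : Ω // h ^ 2 • q = q} + _ at hb
  rw [U.card_fixed hh, U.card_fixed (pow_mem hh 2), h1, h2] at ha
  rw [U.card_fixed (pow_mem hh 2), h2, U.card_Ω] at hb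
  have ho : Odd (a + b) := ⟨25679, by omega⟩
  rw [ho.neg_one_pow] at hs
  exact absurd hs (by decide)

end UPair

section SmallGroup

theorem eq_one_of_pow_five_eq_one : ∀ u : ZMod 29, u ^ 5 = 1 → u = 1 := by
  decide +kernel

variable {K : Type*} [Group K] [Finite K]

theorem zpowers_normal_of_index_dvd {p k : ℕ} [Fact p.Prime] {x : K} (hx : orderOf x = p)
    (hp : ¬ p ^ 2 ∣ Nat.card K) (hk : (Subgroup.normalizer (Subgroup.zpowers x : Set K)).index ∣ k)
    (h : ∀ d : ℕ, d ∣ k → d ≡ 1 [MOD p] → d = 1) : (Subgroup.zpowers x).Normal := by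
  have h1 : (Nat.card K).factorization p = 1 := by
    have h0 : p ∣ Nat.card K := hx ▸ orderOf_dvd_natCard x
    have ha := (Nat.Prime.pow_dvd_iff_le_factorization (Fact.out : p.Prime)
      (Nat.card_pos (α := K)).ne').not.1 hp
    have hb := ((Fact.out : p.Prime).dvd_iff_one_le_factorization
      (Nat.card_pos (α := K)).ne').1 h0
    omega
  let S : Sylow p K := Sylow.ofCard (Subgroup.zpowers x) (by rw [Nat.card_zpowers, hx, h1, pow_one])
  have h2 := S.card_eq_index_normalizer
  have h3 := card_sylow_modEq_one p K
  rw [h2] at h3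
  have h4 : (Subgroup.normalizer (Subgroup.zpowers x : Set K)).index = 1 := h _ hk h3
  rw [Subgroup.index_eq_one] at h4
  exact Subgroup.normalizer_eq_top_iff.1 h4

theorem exists_normal_of_card_eq_1160 (hK : Nat.card K = 1160) : ∃ y z : K, orderOf y = 29 ∧
    orderOf z = 5 ∧ Commute y z ∧ (Subgroup.zpowers y).Normal ∧ (Subgroup.zpowers z).Normal := by
  have f29 : Fact (Nat.Prime 29) := ⟨by norm_num⟩
  have f5 : Fact (Nat.Prime 5) := ⟨by norm_num⟩
  obtain ⟨y, hy⟩ := exists_prime_orderOf_dvd_card' (G := K) 29 (by rw [hK]; norm_num)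
  obtain ⟨z, hz⟩ := exists_prime_orderOf_dvd_card' (G := K) 5 (by rw [hK]; norm_num)
  have hdy : (Subgroup.normalizer (Subgroup.zpowers y : Set K)).index ∣ 40 := by
    have h1 : Nat.card (Subgroup.zpowers y) ∣
      Nat.card (Subgroup.normalizer (Subgroup.zpowers y : Set K)) :=
        Subgroup.card_dvd_of_le Subgroup.le_normalizer
    rw [Nat.card_zpowers, hy] at h1
    have h2 := Subgroup.card_mul_index (Subgroup.normalizer (Subgroup.zpowers y : Set K))
    obtain ⟨c, hc⟩ := h1
    rw [hc, hK, mul_assoc] at h2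
    exact ⟨c, by rw [mul_comm]; omega⟩
  have hny := zpowers_normal_of_index_dvd hy (by rw [hK]; norm_num) hdy (by
    intro d hd
    have := Nat.le_of_dvd (by norm_num) hd
    interval_cases d <;> revert hd <;> decide)
  have hyz : Commute y z := by
    obtain ⟨j, hj⟩ := Subgroup.mem_zpowers_iff.1 (hny.conj_mem y (Subgroup.mem_zpowers y) z)
    have h1 : ∀ n : ℕ, z ^ n * y * (z ^ n)⁻¹ = y ^ (j ^ n) := by
      intro n
      induction n with
      | zero => simp
      | succ n ih =>
        have : z ^ (n + 1) * y * (z ^ (n + 1))⁻¹ = z ^ n * (z * y * z⁻¹) * (z ^ n)⁻¹ := by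
          rw [pow_succ]; group
        rw [this, ← hj, ← conj_zpow, ih, ← zpow_mul, pow_succ]
    have h2 := h1 5
    rw [← hz, pow_orderOf_eq_one, one_mul, inv_one, mul_one, hz] at h2
    have h3 : ((j : ZMod 29)) ^ 5 = 1 := by
      have h4 : y ^ (j ^ 5 - 1) = 1 := by rw [zpow_sub, ← h2]; simp
      rw [← orderOf_dvd_iff_zpow_eq_one, hy] at h4
      have := (ZMod.intCast_zmod_eq_zero_iff_dvd _ 29).2 (by exact_mod_cast h4)
      push_cast at this
      exact sub_eq_zero.1 this
    have h5 : (j : ZMod 29) = 1 := eq_one_of_pow_five_eq_one _ h3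
    have h6 : y ^ (j - 1) = 1 := by
      rw [← orderOf_dvd_iff_zpow_eq_one, hy]
      refine (ZMod.intCast_zmod_eq_zero_iff_dvd _ 29).1 ?_
      push_cast
      rw [h5, sub_self]
    rw [zpow_sub, zpow_one, mul_inv_eq_one] at h6
    rw [h6] at hj
    exact ((mul_inv_eq_iff_eq_mul.1 hj.symm).symm : y * z = z * y)
  have hdz : (Subgroup.normalizer (Subgroup.zpowers z : Set K)).index ∣ 8 := by
    have h1 : Nat.card (Subgroup.zpowers z) ∣
      Nat.card (Subgroup.normalizer (Subgroup.zpowers z : Set K)) :=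
        Subgroup.card_dvd_of_le Subgroup.le_normalizer
    have h1' : Nat.card (Subgroup.zpowers y) ∣
      Nat.card (Subgroup.normalizer (Subgroup.zpowers z : Set K)) := by
        refine Subgroup.card_dvd_of_le ?_
        rw [Subgroup.zpowers_le, Subgroup.mem_normalizer_iff]
        have hcz : ∀ g ∈ Subgroup.zpowers z, y * g * y⁻¹ = g := by
          rintro g ⟨n, rfl⟩
          exact mul_inv_eq_of_eq_mul (hyz.zpow_right n).eq
        intro g
        refine ⟨fun hg => (hcz g hg).symm ▸ hg, fun hg => ?_⟩
        have := hcz _ hg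
        have e : g = y * g * y⁻¹ := by
          have := congrArg (fun u => y⁻¹ * u * y) this
          simpa [mul_assoc] using this.symm
        rw [e]
        exact hg
    rw [Nat.card_zpowers] at h1 h1'
    rw [hz] at h1
    rw [hy] at h1'
    have h2 := Subgroup.card_mul_index (Subgroup.normalizer (Subgroup.zpowers z : Set K))
    obtain ⟨c, hc⟩ := Nat.Coprime.mul_dvd_of_dvd_of_dvd (by norm_num) h1 h1'
    rw [hc, hK, mul_assoc] at h2
    exact ⟨c, by rw [mul_comm]; omega⟩
  exact ⟨y, z, hy, hz, hyz, hny, zpowers_normal_of_index_dvd hz (by rw [hK]; norm_num) hdz (by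
    intro d hd
    have := Nat.le_of_dvd (by norm_num) hd
    interval_cases d <;> revert hd <;> decide)⟩

end SmallGroup

instance fact_sq_ne : Fact (∀ r : ZMod 59, r ^ 2 ≠ -1 + 0 * r) := ⟨by decide +kernel⟩

/-- The field with `59 ^ 2` elements. -/
abbrev F59 := QuadraticAlgebra (ZMod 59) (-1) 0

instance : Finite F59 := Finite.of_equiv _ (QuadraticAlgebra.equivProd _ _).symm

theorem card_F59 : Nat.card F59 = 59 ^ 2 := by
  rw [Nat.card_congr (QuadraticAlgebra.equivProd _ _), Nat.card_prod, Nat.card_zmod, sq]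

section Linear

theorem zmod59_eq_one_of_pow_five : ∀ u : ZMod 59, u ^ 5 = 1 → u = 1 := by decide +kernel

variable {V : Type*} [AddCommGroup V] [Module (ZMod 59) V] [Finite V]

theorem exists_trace_of_pow_five (hV : Nat.card V = 59 ^ 2) (Z : V →ₗ[ZMod 59] V)
    (h5 : ∀ v, Z (Z (Z (Z (Z v)))) = v) (hfp : ∀ v, Z v = v → v = 0) :
    ∃ α : ZMod 59, (α = 33 ∨ α = 25) ∧ ∀ v, Z v + Z (Z (Z (Z v))) = α • v := by
  have hs : ∀ v, v + Z v + Z (Z v) + Z (Z (Z v)) + Z (Z (Z (Z v))) = 0 := fun v => by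
    refine hfp _ ?_
    simp only [map_add, h5]
    abel
  by_cases h : ∀ v, Z v + Z (Z (Z (Z v))) = (25 : ZMod 59) • v
  · exact ⟨25, .inr rfl, h⟩
  push Not at h
  obtain ⟨v, hv⟩ := h
  refine ⟨33, .inl rfl, ?_⟩
  obtain ⟨w, hw⟩ : ∃ w, w = Z v + Z (Z (Z (Z v))) - (25 : ZMod 59) • v := ⟨_, rfl⟩
  have hw0 : w ≠ 0 := hw ▸ sub_ne_zero.2 hv
  have hAw : Z w + Z (Z (Z (Z w))) = (33 : ZMod 59) • w := by
    have e1 : (33 * 25 : ZMod 59) = -1 := by decide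
    have e2 : (33 : ZMod 59) = -1 - 25 := by decide
    rw [hw]
    simp only [map_add, map_sub, map_smul, h5]
    rw [smul_sub, smul_smul, e1, e2]
    linear_combination (norm := module) hs v
  have hinj : Function.Injective fun x : ZMod 59 × ZMod 59 => x.1 • w + x.2 • Z w := by
    have key : ∀ x y : ZMod 59, x • w + y • Z w = 0 → x = 0 ∧ y = 0 := by
      intro x y h
      have hy : y = 0 := by
        by_contra hy
        have h1 : Z w = (-y⁻¹ * x) • w := by
          have h2 : y • Z w = -(x • w) := (neg_eq_of_add_eq_zero_right h).symm
          rw [mul_smul, neg_smul, ← smul_neg, ← h2, smul_smul, inv_mul_cancel₀ hy, one_smul]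
        generalize -y⁻¹ * x = c at h1
        have h2 := h5 w
        simp only [h1, map_smul, smul_smul] at h2
        have h3 : (c ^ 5 - 1) • w = 0 := by
          rw [sub_smul, one_smul, sub_eq_zero]
          convert h2 using 2
          ring
        have h4 := zmod59_eq_one_of_pow_five c
          (sub_eq_zero.1 ((smul_eq_zero.1 h3).resolve_right hw0))
        rw [h4, one_smul] at h1
        exact hw0 (hfp w h1)
      subst hy
      rw [zero_smul, add_zero] at h
      exact ⟨(smul_eq_zero.1 h).resolve_right hw0, rfl⟩
    rintro ⟨a, b⟩ ⟨c, d⟩ h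
    have h1 : a • w + b • Z w = c • w + d • Z w := h
    have := key (a - c) (b - d) (by linear_combination (norm := module) h1)
    rw [sub_eq_zero, sub_eq_zero] at this
    rw [this.1, this.2]
  have hbij := hinj.bijective_of_nat_card_le (by
    rw [hV, Nat.card_prod, Nat.card_zmod, sq])
  intro u
  obtain ⟨⟨x, y⟩, rfl⟩ := hbij.2 u
  have hZ := congrArg Z hAw
  simp only [map_add, map_smul] at hZ ⊢
  linear_combination (norm := module) x • hAw + y • hZ

theorem exists_sq_eq_neg (hV : Nat.card V = 59 ^ 2) (Z : V →ₗ[ZMod 59] V)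
    (h5 : ∀ v, Z (Z (Z (Z (Z v)))) = v) (hfp : ∀ v, Z v = v → v = 0) :
    ∃ α δ : ZMod 59, α ^ 2 - 2 ≠ α ∧ δ ≠ 0 ∧ (∀ v, Z v + Z (Z (Z (Z v))) = α • v) ∧
      ∃ J : V →ₗ[ZMod 59] V, (∀ v, δ • J v = (2 : ZMod 59) • Z v - α • v) ∧
        ∀ v, J (J v) = -v := by
  obtain ⟨α, hα, h⟩ := exists_trace_of_pow_five hV Z h5 hfp
  obtain ⟨δ, hδ, hδ'⟩ : ∃ δ : ZMod 59, δ ≠ 0 ∧ δ ^ 2 = 4 - α ^ 2 := by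
    rcases hα with rfl | rfl
    · exact ⟨6, by decide, by decide⟩
    · exact ⟨21, by decide, by decide⟩
  have hZ2 : ∀ v, Z (Z v) = α • Z v - v := fun v => by
    have := h (Z v)
    rw [h5] at this
    rw [← this]; abel
  refine ⟨α, δ, ?_, hδ, h, δ⁻¹ • ((2 : ZMod 59) • Z - α • LinearMap.id), fun v => ?_, fun v => ?_⟩
  · rcases hα with rfl | rfl <;> decide
  · simp [smul_smul, hδ]
  · have h4 : (4 - α ^ 2) ≠ 0 := hδ' ▸ pow_ne_zero 2 hδ
    have e : δ⁻¹ * δ⁻¹ * (4 - α ^ 2) = 1 := by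
      rw [← hδ']; field_simp
    simp only [LinearMap.smul_apply, LinearMap.sub_apply, LinearMap.id_apply, map_smul, map_sub,
      hZ2]
    linear_combination (norm := module) -e • v

/-- A twisted linear classification: a group acting on a plane over `ZMod 59` and normalising a
fixed point free subgroup of order `5` acts by semilinear maps over `F59`. -/
theorem exists_equiv_F59 (hV : Nat.card V = 59 ^ 2) {Γ : Type*} [Group Γ]
    (T : Γ →* Module.End (ZMod 59) V) (ζ : Γ) (hζ : ζ ^ 5 = 1) (hfp : ∀ v, T ζ v = v → v = 0)
    (hn : ∀ h : Γ, ∃ j : ℕ, h * ζ * h⁻¹ = ζ ^ j) :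
    ∃ φ : V ≃+ F59, ∀ h, ∃ a : F59, a ≠ 0 ∧ ((h * ζ = ζ * h ∧ ∀ v, φ (T h v) = a * φ v) ∨
      (h * ζ * h⁻¹ = ζ⁻¹ ∧ ∀ v, φ (T h v) = a * star (φ v))) := by
  have hT : ∀ g h v, T (g * h) v = T g (T h v) := fun g h v => by rw [map_mul]; rfl
  have h5 : ∀ v, T ζ (T ζ (T ζ (T ζ (T ζ v)))) = v := fun v => by
    have : T (ζ ^ 5) v = v := by rw [hζ, map_one]; rfl
    conv_rhs => rw [← this]
    simp only [pow_succ, hT, pow_zero, map_one, Module.End.one_apply]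
  obtain ⟨α, δ, hα, hδ, hA, J, hJ, hJ2⟩ := exists_sq_eq_neg hV (T ζ) h5 hfp
  have : Nontrivial V := Finite.one_lt_card_iff_nontrivial.1 (by rw [hV]; norm_num)
  obtain ⟨v, hv⟩ := exists_ne (0 : V)
  let S : F59 → V → V := fun a u => a.re • u + a.im • J u
  have hS : ∀ a b u, S (a * b) u = S a (S b u) := fun a b u => by
    simp only [S, QuadraticAlgebra.re_mul, QuadraticAlgebra.im_mul, map_add, map_smul, hJ2]
    module
  let ψ : F59 →+ V := { 
    toFun := fun a => S a v
    map_zero' := by simp [S]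
    map_add' := fun a b => by
      simp only [S, QuadraticAlgebra.re_add, QuadraticAlgebra.im_add]
      module }
  have hψ : ∀ a, ψ a = S a v := fun _ => rfl
  have hinj : Function.Injective ψ := by
    rw [injective_iff_map_eq_zero]
    intro a ha
    by_contra h0
    have h1 := hS a⁻¹ a v
    rw [inv_mul_cancel₀ h0, ← hψ a, ha] at h1
    have h2 : S 0 v = 0 := by simp [S]
    have h3 : S 1 v = v := by
      simp [S, show (1 : F59).re = 1 from rfl, show (1 : F59).im = 0 from rfl]
    have h4 : S a⁻¹ 0 = 0 := by simp [S]
    rw [h3, h4] at h1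
    exact hv h1
  have hbij := hinj.bijective_of_nat_card_le (by rw [hV, card_F59])
  let e := AddEquiv.ofBijective ψ hbij
  have he : ∀ a, e a = S a v := fun _ => rfl
  have hinv : ∀ h v, T h (T h⁻¹ v) = v := fun h v => by
    rw [← hT, mul_inv_cancel, map_one]; rfl
  refine ⟨e.symm, fun h => ⟨e.symm (T h v), ?_, ?_⟩⟩
  · intro h0
    rw [map_eq_zero_iff _ e.symm.injective] at h0
    have := hinv h⁻¹ v
    rw [inv_inv, h0, map_zero] at this
    exact hv this.symm
  obtain ⟨j, hj⟩ := hn h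
  have hconj : ∀ u, T h (T ζ u) = T (ζ ^ j) (T h u) := fun u => by
    rw [← hT, ← hT, ← hj, inv_mul_cancel_right]
  have hj5 : ζ ^ j = ζ ^ (j % 5) := by
    conv_lhs => rw [← Nat.mod_add_div j 5, pow_add, pow_mul, hζ, one_pow, mul_one]
  rw [hj5] at hconj hj
  have hlt := Nat.mod_lt j (show 5 > 0 by norm_num)
  have hAh : ∀ u, T (ζ ^ (j % 5)) u + T (ζ ^ (j % 5)) (T (ζ ^ (j % 5)) (T (ζ ^ (j % 5))
      (T (ζ ^ (j % 5)) u))) = α • u := fun u => by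
    have := congrArg (T h) (hA (T h⁻¹ u))
    simpa only [map_add, hconj, hinv, map_smul] using this
  have hadd : ∀ a x y, S a (x + y) = S a x + S a y := fun a x y => by
    simp only [S, map_add]; module
  generalize j % 5 = k at *
  have hlin : h * ζ = ζ * h → ∀ u, e.symm (T h u) = e.symm (T h v) * e.symm u := by
    intro hc u
    have hJc : ∀ u, T h (J u) = J (T h u) := fun u => by
      have h1 := congrArg (T h) (hJ u)
      have h2 := hJ (T h u)
      have h3 : T h (T ζ u) = T ζ (T h u) := by rw [← hT, ← hT, hc]
      rw [map_smul, map_sub, map_smul, map_smul, h3, ← h2] at h1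
      exact smul_right_injective V hδ h1
    have hSc : ∀ a u, T h (S a u) = S a (T h u) := fun a u => by
      simp only [S, map_add, map_smul, hJc]
    obtain ⟨a, rfl⟩ := e.surjective u
    rw [AddEquiv.symm_apply_eq, e.symm_apply_apply, mul_comm, he (_ * _), hS, ← he (e.symm _),
      e.apply_symm_apply, he, hSc]
  have hanti : h * ζ * h⁻¹ = ζ⁻¹ → ∀ u, e.symm (T h u) = e.symm (T h v) * star (e.symm u) := by
    intro hc u
    have h4 : ζ⁻¹ = ζ ^ 4 := by rw [inv_eq_iff_mul_eq_one, ← pow_succ', hζ]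
    have hJc : ∀ u, T h (J u) = -J (T h u) := fun u => by
      have h1 := congrArg (T h) (hJ u)
      have h2 := hJ (T h u)
      have h3 : T h (T ζ u) = T ζ (T ζ (T ζ (T ζ (T h u)))) := by
        have : h * ζ = ζ ^ 4 * h := by rw [← h4, ← hc, inv_mul_cancel_right]
        rw [← hT, this]
        simp only [pow_succ, hT, pow_zero, map_one, Module.End.one_apply]
      have h6 := hA (T h u)
      rw [map_smul, map_sub, map_smul, map_smul, h3] at h1
      refine smul_right_injective V hδ (?_ : δ • _ = δ • _)
      linear_combination (norm := module) h1 + h2 + (2 : ZMod 59) • h6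
    have hSc : ∀ a u, T h (S a u) = S (star a) (T h u) := fun a u => by
      simp only [S, map_add, map_smul, hJc, QuadraticAlgebra.re_star, QuadraticAlgebra.im_star]
      module
    obtain ⟨a, rfl⟩ := e.surjective u
    rw [AddEquiv.symm_apply_eq, e.symm_apply_apply, mul_comm, he (_ * _), hS, ← he (e.symm _),
      e.apply_symm_apply, he, hSc]
  have hp : ∀ n u, T (ζ ^ (n + 1)) u = T (ζ ^ n) (T ζ u) := fun n u => by rw [pow_succ, hT]
  have hb : ∀ u, T ζ (T ζ u) + T ζ (T ζ (T ζ u)) = (α ^ 2 - 2) • u := fun u => by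
    have h1 := hA u
    have h2 := congrArg (T ζ) h1
    have h3 := congrArg (fun x => T ζ (T ζ (T ζ x))) h2
    simp only [map_add, map_smul, h5] at h2 h3
    linear_combination (norm := module) α • h1 + h2 + h3
  have hz : ∀ u, T (ζ ^ 0) u = u := fun u => by rw [pow_zero, map_one]; rfl
  have hne : ¬ (α ^ 2 - 2) • v = α • v := fun h => by
    rw [← sub_eq_zero, ← sub_smul, smul_eq_zero, sub_eq_zero] at h
    exact h.elim hα hv
  interval_cases k
  · exfalso
    rw [pow_zero, mul_inv_eq_one] at hj
    have : ζ = 1 := by simpa using hj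
    refine hv (hfp v ?_)
    rw [this, map_one]; rfl
  · rw [pow_one, mul_inv_eq_iff_eq_mul] at hj
    exact .inl ⟨hj, hlin hj⟩
  · exfalso
    have := hAh v
    simp only [hp, hz, h5] at this
    exact hne ((hb v).symm.trans this)
  · exfalso
    have := hAh v
    simp only [hp, hz, h5] at this
    exact hne ((hb v).symm.trans ((add_comm _ _).trans this))
  · have : h * ζ * h⁻¹ = ζ⁻¹ := by rw [hj, eq_inv_iff_mul_eq_one, ← pow_succ, hζ]
    exact .inr ⟨this, hanti this⟩

end Linear

theorem card_center_ne_of_card_eq_prime_cube {Q : Type*} [Group Q] [Finite Q] {p : ℕ} [Fact p.Prime]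
    (hQ : Nat.card Q = p ^ 3) : Nat.card (Subgroup.center Q) ≠ p ^ 2 := by
  intro h
  have hp := (Fact.out : p.Prime)
  have h1 := Subgroup.card_mul_index (Subgroup.center Q)
  rw [h, hQ, pow_succ p 2] at h1
  have h2 := Nat.eq_of_mul_eq_mul_left (pow_pos hp.pos 2) h1
  have : IsCyclic (Q ⧸ Subgroup.center Q) := isCyclic_of_prime_card (p := p) h2
  have h3 := isMulCommutative_of_isCyclic_quotient_center_self (G := Q)
  have h4 : Subgroup.center Q = ⊤ := by
    rw [Subgroup.eq_top_iff']
    exact fun x => Subgroup.mem_center_iff.2 fun y => h3.is_comm.comm y x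
  rw [h4, Subgroup.card_top, hQ] at h
  exact absurd (Nat.pow_right_injective hp.two_le h) (by norm_num)

/-- A `UPair` with chosen elements of orders `29` and `5` in the two point stabiliser. -/
structure UElt (G Ω : Type*) [Group G] [MulAction G Ω] extends UPair G Ω where
  y : G
  z : G
  y_mem : y ∈ toUPair.H
  z_mem : z ∈ toUPair.H
  orderOf_y : orderOf y = 29
  orderOf_z : orderOf z = 5
  comm : Commute y z
  y_normal : ∀ h ∈ toUPair.H, ∃ n : ℕ, h * y * h⁻¹ = y ^ n
  z_normal : ∀ h ∈ toUPair.H, ∃ n : ℕ, h * z * h⁻¹ = z ^ n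

namespace UPair

variable {G Ω : Type*} [Group G] [MulAction G Ω] [Finite G] [Finite Ω] (U : UPair G Ω)

theorem nonempty_uElt : ∃ E : UElt G Ω, E.toUPair = U := by
  obtain ⟨y, z, hy, hz, hc, hny, hnz⟩ := exists_normal_of_card_eq_1160 U.card_H
  have key : ∀ x : U.H, (Subgroup.zpowers x).Normal → ∀ h ∈ U.H, ∃ n : ℕ,
      h * (x : G) * h⁻¹ = (x : G) ^ n := fun x hx h hh => by
    have h1 := hx.conj_mem x (Subgroup.mem_zpowers x) ⟨h, hh⟩
    obtain ⟨n, hn⟩ := (mem_powers_iff_mem_zpowers (x := x)).2 h1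
    exact ⟨n, congrArg Subtype.val hn.symm⟩
  exact ⟨⟨U, y, z, y.2, z.2, by rwa [Subgroup.orderOf_coe], by rwa [Subgroup.orderOf_coe],
    congrArg Subtype.val hc.eq, key y hny, key z hnz⟩, rfl⟩

end UPair

namespace UElt

variable {G Ω : Type*} [Group G] [MulAction G Ω] [Finite G] [Finite Ω] (U : UElt G Ω)

theorem z_pow : U.z ^ 5 = 1 := by rw [← U.orderOf_z, pow_orderOf_eq_one]

theorem y_pow : U.y ^ 29 = 1 := by rw [← U.orderOf_y, pow_orderOf_eq_one]

theorem z_ne_one : U.z ≠ 1 := fun h => by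
  have := U.orderOf_z
  rw [h, orderOf_one] at this
  omega

/-- The centraliser of `z` in the Sylow subgroup. -/
def Z : Subgroup G := U.P U.i ⊓ Subgroup.centralizer {U.z}

theorem mem_Z {x : G} : x ∈ U.Z ↔ x ∈ U.P U.i ∧ Commute x U.z :=
  and_congr_right fun _ => Subgroup.mem_centralizer_singleton_iff

theorem card_Z : Nat.card U.Z = 59 := by
  have : Fact (Nat.Prime 5) := ⟨by norm_num⟩
  have h1 := card_modEq_card_inf_centralizer (U.P U.i) U.z (fun x hx => U.conj_mem_P U.z_mem hx) 5 1
    U.z_pow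
  obtain ⟨k, hk, hkc⟩ := U.exists_card_centralizer U.z
  rw [U.card_P, hkc] at h1
  interval_cases k
  · exact absurd h1 (by decide)
  · exact hkc
  · exact absurd h1 (by decide)
  · exact absurd (U.eq_one_of_card_centralizer U.z_mem hkc) U.z_ne_one

theorem commute_of_mem_Z {x u : G} (hx : x ∈ U.Z) (hu : u ∈ U.P U.i) : Commute x u := by
  have : Fact (Nat.Prime 5) := ⟨by norm_num⟩
  set C := (Subgroup.center (U.P U.i)).map (U.P U.i).subtype
  have hC : Nat.card C = Nat.card (Subgroup.center (U.P U.i)) :=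
    Subgroup.card_map_of_injective (Subgroup.subtype_injective _)
  have hmem : ∀ c, c ∈ C ↔ c ∈ U.P U.i ∧ ∀ u ∈ U.P U.i, Commute c u := by
    intro c
    constructor
    · rintro ⟨d, hd, rfl⟩
      exact ⟨d.2, fun u hu => (congrArg Subtype.val
        (Subgroup.mem_center_iff.1 hd ⟨u, hu⟩) : u * (d : G) = d * u).symm⟩
    · rintro ⟨h1, h2⟩
      exact ⟨⟨c, h1⟩, Subgroup.mem_center_iff.2 fun v => Subtype.ext (h2 v v.2).symm, rfl⟩
  have h1 := card_modEq_card_inf_centralizer C U.z (fun c hc => by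
    rw [hmem] at hc ⊢
    refine ⟨U.conj_mem_P U.z_mem hc.1, fun u hu => ?_⟩
    have h2 := U.conj_mem_P (inv_mem U.z_mem) hu
    rw [inv_inv] at h2
    have h3 := (Commute.conj_iff U.z).2 (hc.2 _ h2)
    simpa [mul_assoc] using h3) 5 1 U.z_pow
  obtain ⟨k, hk0, hk⟩ := IsPGroup.card_center_eq_prime_pow (U.card_P U.i) (by norm_num)
  have hk3 : k ≤ 3 := (Nat.pow_dvd_pow_iff_le_right (show 1 < 59 by norm_num)).1
    (hk ▸ U.card_P U.i ▸ Subgroup.card_subgroup_dvd_card _)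
  have hle : (C ⊓ Subgroup.centralizer {U.z} : Subgroup G) ≤ U.Z :=
    inf_le_inf_right _ fun c hc => ((hmem c).1 hc).1
  have h2 := Subgroup.card_dvd_of_le hle
  rw [card_Z, Nat.dvd_prime (by norm_num)] at h2
  have h3 : Nat.card (C ⊓ Subgroup.centralizer {U.z} : Subgroup G) = 59 := by
    refine h2.resolve_left fun h2 => ?_
    rw [h2, hC, hk] at h1
    interval_cases k
    · exact absurd h1 (by decide)
    · exact card_center_ne_of_card_eq_prime_cube (U.card_P U.i) hk
    · exact absurd h1 (by decide)
  have h4 := Subgroup.eq_of_le_of_card_ge hle (by rw [h3, card_Z])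
  rw [← h4] at hx
  exact ((hmem x).1 hx.1).2 u hu

/-- Conjugation by an element of `H` on the Sylow subgroup. -/
def conjHom (h : U.H) : U.P U.i →* U.P U.i where
  toFun x := ⟨h * x * (h : G)⁻¹, U.conj_mem_P h.2 x.2⟩
  map_one' := Subtype.ext (by simp)
  map_mul' x y := Subtype.ext (by simp [mul_assoc])

theorem conj_mem_Z {h x : G} (hh : h ∈ U.H) (hx : x ∈ U.Z) : h * x * h⁻¹ ∈ U.Z := by
  rw [mem_Z] at hx ⊢
  refine ⟨U.conj_mem_P hh hx.1, ?_⟩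
  obtain ⟨n, hn⟩ := U.z_normal h⁻¹ (inv_mem hh)
  rw [inv_inv] at hn
  have h1 := (Commute.conj_iff h).2 (hx.2.pow_right n)
  rw [← hn] at h1
  simpa [mul_assoc] using h1

theorem mem_Z_of_conj {x c : G} (hx : x ∈ U.P U.i) (hc : c ∈ U.Z) (h : U.z * x * U.z⁻¹ = x * c) :
    x ∈ U.Z := by
  have h1 : ∀ n : ℕ, U.z ^ n * x * (U.z ^ n)⁻¹ = x * c ^ n := by
    intro n
    induction n with
    | zero => simp
    | succ n ih =>
      have e : U.z ^ (n + 1) * x * (U.z ^ (n + 1))⁻¹ =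
        (U.z ^ n * x * (U.z ^ n)⁻¹) * (U.z ^ n * c * (U.z ^ n)⁻¹) := by
        rw [conj_mul, ← h, pow_succ]; group
      have hc' : U.z ^ n * c * (U.z ^ n)⁻¹ = c :=
        mul_inv_eq_of_eq_mul ((U.mem_Z.1 hc).2.symm.pow_left n).eq
      rw [e, ih, hc', mul_assoc, ← pow_succ]
  have h2 := h1 5
  rw [z_pow, one_mul, inv_one, mul_one, left_eq_mul] at h2
  have h3 : c ^ 59 = 1 := by
    have := pow_card_eq_one' (x := (⟨c, hc⟩ : U.Z))
    rw [card_Z] at this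
    exact congrArg Subtype.val this
  have h4 : c = 1 := by
    rw [← orderOf_eq_one_iff, ← Nat.dvd_one]
    exact Nat.dvd_gcd (orderOf_dvd_of_pow_eq_one h2) (orderOf_dvd_of_pow_eq_one h3)
  rw [h4, mul_one, mul_inv_eq_iff_eq_mul] at h
  exact U.mem_Z.2 ⟨hx, h.symm⟩

theorem exists_pi : ∃ π : G → F59, (∀ x ∈ U.P U.i, ∀ y ∈ U.P U.i, π (x * y) = π x + π y) ∧
    (∀ a, ∃ x ∈ U.P U.i, π x = a) ∧ (∀ x ∈ U.P U.i, π x = 0 ↔ x ∈ U.Z) ∧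
    ∀ h ∈ U.H, ∃ a : F59, a ≠ 0 ∧
      ((Commute h U.z ∧ ∀ x ∈ U.P U.i, π (h * x * h⁻¹) = a * π x) ∨
      (h * U.z * h⁻¹ = U.z⁻¹ ∧ ∀ x ∈ U.P U.i, π (h * x * h⁻¹) = a * star (π x))) := by
  have f5 : Fact (Nat.Prime 5) := ⟨by norm_num⟩
  set N : Subgroup (U.P U.i) := U.Z.subgroupOf (U.P U.i) with hN
  have hNn : N.Normal := ⟨fun n hn g => by
    have : g * n * g⁻¹ = n := mul_inv_eq_of_eq_mul
      (Subtype.ext (U.commute_of_mem_Z hn g.2).symm : g * n = n * g)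
    rw [this]; exact hn⟩
  have hNc : Nat.card N = 59 := by
    rw [← U.card_Z]
    exact Nat.card_congr (Subgroup.subgroupOfEquivOfLe inf_le_left).toEquiv
  have hV : Nat.card (U.P U.i ⧸ N) = 59 ^ 2 := by
    have h1 := Subgroup.card_mul_index N
    rw [hNc, U.card_P, pow_succ 59 2, mul_comm] at h1
    exact Nat.eq_of_mul_eq_mul_right (by norm_num) h1
  let : CommGroup (U.P U.i ⧸ N) := IsPGroup.commGroupOfCardEqPrimeSq hV
  have hpow : ∀ v : U.P U.i ⧸ N, v ^ 59 = 1 := by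
    set D := (((powMonoidHom 59 : U.P U.i ⧸ N →* U.P U.i ⧸ N).ker).comap
      (QuotientGroup.mk' N)).map (U.P U.i).subtype with hD
    have hmem : ∀ x, x ∈ D ↔ x ∈ U.P U.i ∧ x ^ 59 ∈ U.Z := by
      intro x
      have key : ∀ x : U.P U.i, x ∈ ((powMonoidHom 59 : U.P U.i ⧸ N →* U.P U.i ⧸ N).ker).comap
          (QuotientGroup.mk' N) ↔ (x : G) ^ 59 ∈ U.Z := fun x => by
        rw [Subgroup.mem_comap, MonoidHom.mem_ker, powMonoidHom_apply, ← map_pow,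
          QuotientGroup.mk'_apply, QuotientGroup.eq_one_iff]
        rfl
      constructor
      · rintro ⟨y, hy, rfl⟩
        exact ⟨y.2, (key y).1 hy⟩
      · rintro ⟨h1, h2⟩
        exact ⟨⟨x, h1⟩, (key _).2 h2, rfl⟩
    have hDP : D ≤ U.P U.i := fun x hx => ((hmem x).1 hx).1
    have h1 := card_modEq_card_inf_centralizer D U.z (fun x hx => by
      rw [hmem] at hx ⊢
      rw [conj_pow]
      exact ⟨U.conj_mem_P U.z_mem hx.1, U.conj_mem_Z U.z_mem hx.2⟩) 5 1 U.z_pow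
    have h2 : (D ⊓ Subgroup.centralizer {U.z} : Subgroup G) = U.Z := by
      refine le_antisymm (inf_le_inf_right _ hDP) (le_inf (fun x hx => ?_) inf_le_right)
      exact (hmem x).2 ⟨hx.1, pow_mem hx 59⟩
    rw [h2, card_Z] at h1
    obtain ⟨k, hk3, hk⟩ := (Nat.dvd_prime_pow fact_prime_59.out).1
      (U.card_P U.i ▸ Subgroup.card_dvd_of_le hDP)
    rw [hk] at h1
    have hDne : D ≠ U.Z := by
      intro e
      obtain ⟨v, hv⟩ := exists_prime_orderOf_dvd_card' (G := U.P U.i ⧸ N) 59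
        (by rw [hV]; norm_num)
      obtain ⟨x, rfl⟩ := QuotientGroup.mk_surjective v
      have h3 : (x : G) ∈ D := by
        refine (hmem x).2 ⟨x.2, ?_⟩
        have h4 := pow_orderOf_eq_one (x : U.P U.i ⧸ N)
        rw [hv, ← QuotientGroup.mk_pow, QuotientGroup.eq_one_iff] at h4
        exact h4
      rw [e] at h3
      rw [(QuotientGroup.eq_one_iff x).2 h3, orderOf_one] at hv
      omega
    have hD3 : D = U.P U.i := by
      interval_cases k
      · exact absurd h1 (by decide)
      · exact absurd (Subgroup.eq_of_le_of_card_ge (h2 ▸ inf_le_left : U.Z ≤ D)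
          (by rw [hk, card_Z]; norm_num)).symm hDne
      · exact absurd h1 (by decide)
      · exact Subgroup.eq_of_le_of_card_ge hDP (by rw [hk, U.card_P])
    intro v
    obtain ⟨x, rfl⟩ := QuotientGroup.mk_surjective v
    rw [← QuotientGroup.mk_pow, QuotientGroup.eq_one_iff]
    have hx : (x : G) ∈ D := by rw [hD3]; exact x.2
    exact ((hmem x).1 hx).2
  let : Module (ZMod 59) (Additive (U.P U.i ⧸ N)) := AddCommGroup.zmodModule fun v => hpow v
  have hcomap : ∀ h, N ≤ N.comap (U.conjHom h) := fun h x hx => U.conj_mem_Z h.2 hx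
  let T0 : U.H → Module.End (ZMod 59) (Additive (U.P U.i ⧸ N)) := fun h =>
    AddMonoidHom.toZModLinearMap 59 (MonoidHom.toAdditive (QuotientGroup.map N N (U.conjHom h)
      (hcomap h)))
  have hT0 : ∀ h (x : U.P U.i), T0 h (Additive.ofMul (x : U.P U.i ⧸ N)) =
    Additive.ofMul ((U.conjHom h x : U.P U.i) : U.P U.i ⧸ N) := fun h x => rfl
  have hind : ∀ v : Additive (U.P U.i ⧸ N), ∃ x : U.P U.i, v = Additive.ofMul (x : U.P U.i ⧸ N) :=
    fun v => by
      obtain ⟨x, hx⟩ := QuotientGroup.mk_surjective v.toMul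
      exact ⟨x, by rw [hx]; rfl⟩
  let T : U.H →* Module.End (ZMod 59) (Additive (U.P U.i ⧸ N)) :=
    { toFun := T0
      map_one' := LinearMap.ext fun v => by
        obtain ⟨x, rfl⟩ := hind v
        rw [hT0]
        have : U.conjHom 1 x = x := Subtype.ext (by simp [conjHom])
        rw [this]; rfl
      map_mul' := fun g h => LinearMap.ext fun v => by
        obtain ⟨x, rfl⟩ := hind v
        rw [Module.End.mul_apply, hT0, hT0, hT0]
        have : U.conjHom (g * h) x = U.conjHom g (U.conjHom h x) :=
          Subtype.ext (by simp [conjHom, mul_assoc])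
        rw [this] }
  have hT : ∀ h (x : U.P U.i), T h (Additive.ofMul (x : U.P U.i ⧸ N)) =
    Additive.ofMul ((U.conjHom h x : U.P U.i) : U.P U.i ⧸ N) := hT0
  obtain ⟨φ, hφ⟩ := exists_equiv_F59 (V := Additive (U.P U.i ⧸ N)) hV T ⟨U.z, U.z_mem⟩ (Subtype.ext U.z_pow) (fun v hv => by
    obtain ⟨x, rfl⟩ := hind v
    rw [hT] at hv
    have h1 := QuotientGroup.eq.1 (Additive.ofMul.injective hv).symm
    have h2 : (x : G)⁻¹ * (U.z * x * U.z⁻¹) ∈ U.Z := h1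
    have h3 := U.mem_Z_of_conj x.2 h2 (by group)
    exact congrArg Additive.ofMul ((QuotientGroup.eq_one_iff x).2 h3)) (fun h => by
    obtain ⟨n, hn⟩ := U.z_normal h h.2
    exact ⟨n, Subtype.ext hn⟩)
  classical
  let π : G → F59 := fun g => if hg : g ∈ U.P U.i then
    φ (Additive.ofMul ((⟨g, hg⟩ : U.P U.i) : U.P U.i ⧸ N)) else 0
  have hπ : ∀ x : U.P U.i, π x = φ (Additive.ofMul (x : U.P U.i ⧸ N)) := fun x => dif_pos x.2
  refine ⟨π, fun x hx y hy => ?_, fun a => ?_, fun x hx => ?_, fun h hh => ?_⟩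
  · rw [hπ ⟨x, hx⟩, hπ ⟨y, hy⟩, ← map_add]
    exact hπ (⟨x, hx⟩ * ⟨y, hy⟩)
  · obtain ⟨v, rfl⟩ := φ.surjective a
    obtain ⟨x, rfl⟩ := hind v
    exact ⟨x, x.2, hπ x⟩
  · rw [hπ ⟨x, hx⟩, map_eq_zero_iff φ φ.injective]
    exact QuotientGroup.eq_one_iff (N := N) _
  · obtain ⟨a, ha, h1⟩ := hφ ⟨h, hh⟩
    refine ⟨a, ha, h1.imp (fun h1 => ⟨(congrArg Subtype.val h1.1 : h * U.z = U.z * h), fun x hx => ?_⟩)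
      fun h1 => ⟨congrArg Subtype.val h1.1, fun x hx => ?_⟩⟩
    · rw [hπ ⟨x, hx⟩, ← h1.2, hT]
      exact hπ (U.conjHom ⟨h, hh⟩ ⟨x, hx⟩)
    · rw [hπ ⟨x, hx⟩, ← h1.2, hT]
      exact hπ (U.conjHom ⟨h, hh⟩ ⟨x, hx⟩)

end UElt

/-- A `UElt` with a semilinear coordinate on the Sylow subgroup modulo `Z`. -/
structure UPi (G Ω : Type*) [Group G] [MulAction G Ω] [Finite G] [Finite Ω] extends UElt G Ω where
  π : G → F59
  lam : G → F59
  π_mul : ∀ x ∈ P i, ∀ y ∈ P i, π (x * y) = π x + π y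
  π_surj : ∀ a, ∃ x ∈ P i, π x = a
  π_eq_zero : ∀ x ∈ P i, π x = 0 ↔ x ∈ toUElt.Z
  lam_ne : ∀ h ∈ toUPair.H, lam h ≠ 0
  lin : ∀ h ∈ toUPair.H, (Commute h z ∧ ∀ x ∈ P i, π (h * x * h⁻¹) = lam h * π x) ∨
      (h * z * h⁻¹ = z⁻¹ ∧ ∀ x ∈ P i, π (h * x * h⁻¹) = lam h * star (π x))

theorem UElt.nonempty_uPi {G Ω : Type*} [Group G] [MulAction G Ω] [Finite G] [Finite Ω]
    (U : UElt G Ω) : Nonempty (UPi G Ω) := by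
  obtain ⟨π, h1, h2, h3, h4⟩ := U.exists_pi
  choose! lam h4 h5 using h4
  exact ⟨{ U with π := π, lam := lam, π_mul := h1, π_surj := h2, π_eq_zero := h3, lam_ne := h4,
                  lin := h5 }⟩

namespace UPi

variable {G Ω : Type*} [Group G] [MulAction G Ω] [Finite G] [Finite Ω] (U : UPi G Ω)

theorem π_one : U.π 1 = 0 := by
  have := U.π_mul 1 (one_mem _) 1 (one_mem _)
  rw [mul_one] at this
  exact left_eq_add.1 this

theorem π_inv {x : G} (hx : x ∈ U.P U.i) : U.π x⁻¹ = -U.π x := by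
  have := U.π_mul x⁻¹ (inv_mem hx) x hx
  rw [inv_mul_cancel, U.π_one] at this
  exact eq_neg_of_add_eq_zero_left this.symm

theorem inv_mul_mem_Z {x u : G} (hx : x ∈ U.P U.i) (hu : u ∈ U.P U.i) :
    x⁻¹ * u ∈ U.Z ↔ U.π x = U.π u := by
  rw [← U.π_eq_zero _ (mul_mem (inv_mem hx) hu), U.π_mul _ (inv_mem hx) _ hu, U.π_inv hx,
    neg_add_eq_zero]

theorem Z_le : U.Z ≤ U.P U.i := inf_le_left

theorem card_coset {x : G} (hx : x ∈ U.P U.i) :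
    Nat.card {u : G // u ∈ U.P U.i ∧ U.π u = U.π x} = 59 := by
  rw [← U.card_Z]
  refine Nat.card_congr
    ⟨fun u => ⟨x⁻¹ * u, (U.inv_mul_mem_Z hx u.2.1).2 u.2.2.symm⟩, fun v => ⟨x * v, ?_, ?_⟩,
      fun u => ?_, fun v => ?_⟩
  · exact mul_mem hx (U.Z_le v.2)
  · rw [U.π_mul _ hx _ (U.Z_le v.2), (U.π_eq_zero _ (U.Z_le v.2)).2 v.2, add_zero]
  · exact Subtype.ext (mul_inv_cancel_left x _)
  · exact Subtype.ext (inv_mul_cancel_left x _)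

/-- The action of `H` on the coordinate. -/
theorem π_conj_inj {h x u : G} (hh : h ∈ U.H) (hx : x ∈ U.P U.i) (hu : u ∈ U.P U.i) :
    U.π (h * x * h⁻¹) = U.π (h * u * h⁻¹) ↔ U.π x = U.π u := by
  rcases U.lin h hh with ⟨-, h1⟩ | ⟨-, h1⟩
  · rw [h1 _ hx, h1 _ hu, mul_right_inj' (U.lam_ne h hh)]
  · rw [h1 _ hx, h1 _ hu, mul_right_inj' (U.lam_ne h hh), star_inj]

theorem exists_commute_of_π_conj_eq {l : ℕ} [Fact l.Prime] (hl : ¬ 59 ≡ 0 [MOD l]) {h x : G}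
    (hh : h ∈ U.H) (h1 : h ^ l = 1) (hx : x ∈ U.P U.i) (hc : U.π (h * x * h⁻¹) = U.π x) :
    ∃ u ∈ U.P U.i, U.π u = U.π x ∧ Commute h u := by
  have hiff : ∀ u : G, h * u * h⁻¹ ∈ U.P U.i ∧ U.π (h * u * h⁻¹) = U.π x ↔
      u ∈ U.P U.i ∧ U.π u = U.π x := by
    intro u
    have h2 : h * u * h⁻¹ ∈ U.P U.i ↔ u ∈ U.P U.i :=
      conj_mem_iff_of_forall (fun x hx => U.conj_mem_P hh hx) u
    rw [h2]
    refine and_congr_right fun hu => ?_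
    rw [← hc, U.π_conj_inj hh hu hx, hc]
  let σ : Equiv.Perm {u : G // u ∈ U.P U.i ∧ U.π u = U.π x} :=
    Equiv.Perm.subtypePerm (MulAut.conj h).toEquiv hiff
  have hσ : ∀ (n : ℕ) u, ((σ ^ n) u : G) = h ^ n * u * (h ^ n)⁻¹ := by
    intro n
    induction n with
    | zero => intro u; simp
    | succ n ih =>
      intro u
      rw [pow_succ, Equiv.Perm.mul_apply, ih, pow_succ, mul_inv_rev]
      change _ * (h * u * h⁻¹) * _ = _
      group
  have h3 := card_modEq_card_fixed σ l 1 (by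
    ext1 u
    refine Subtype.ext ?_
    rw [hσ, pow_one, h1]; simp)
  rw [U.card_coset hx] at h3
  by_contra! hno
  have : IsEmpty {u // σ u = u} := ⟨fun u => hno u.1.1 u.1.2.1 u.1.2.2
    (mul_inv_eq_iff_eq_mul.1 (congrArg Subtype.val u.2 : h * u.1.1 * h⁻¹ = u.1.1))⟩
  rw [Nat.card_of_isEmpty] at h3
  exact hl h3

theorem eq_one_of_π_conj_eq {h : G} (hh : h ∈ U.H)
    (hc : ∀ x ∈ U.P U.i, U.π (h * x * h⁻¹) = U.π x) : h = 1 := by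
  by_contra hne
  have ho : orderOf h ≠ 1 := fun e => hne (orderOf_eq_one_iff.1 e)
  obtain ⟨l, hl, hld⟩ := Nat.exists_prime_and_dvd ho
  have : Fact l.Prime := ⟨hl⟩
  obtain ⟨n, hn⟩ := hld
  set g := h ^ n with hg
  have hgH : g ∈ U.H := pow_mem hh n
  have hn0 : n ≠ 0 := fun e => (orderOf_pos h).ne' (by rw [hn, e, mul_zero])
  have hgo : orderOf g = l := by
    rw [hg, orderOf_pow_of_dvd hn0 (Dvd.intro_left l hn.symm), hn,
      Nat.mul_div_cancel _ (Nat.pos_of_ne_zero hn0)]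
  have hgl : g ^ l = 1 := by rw [← hgo, pow_orderOf_eq_one]
  have hg1 : g ≠ 1 := fun e => hl.ne_one (by rw [← hgo, e, orderOf_one])
  have hcn : ∀ n : ℕ, ∀ x ∈ U.P U.i, U.π (h ^ n * x * (h ^ n)⁻¹) = U.π x := by
    intro n
    induction n with
    | zero => intro x hx; simp
    | succ n ih =>
      intro x hx
      rw [← hc x hx, ← ih _ (U.conj_mem_P hh hx), pow_succ]
      congr 1; group
  have hl3 : l = 2 ∨ l = 5 ∨ l = 29 := by
    have h1 : l ∣ 1160 := by
      rw [← U.card_H, ← hgo, ← Subgroup.orderOf_mk g hgH]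
      exact orderOf_dvd_natCard _
    have h2 : l ∈ Nat.primeFactors 1160 := by
      rw [Nat.mem_primeFactors]; exact ⟨hl, h1, by norm_num⟩
    have h3 : Nat.primeFactors 1160 = {2, 5, 29} := by
      rw [show 1160 = 2 ^ 3 * (5 * 29) by norm_num, Nat.primeFactors_mul (by norm_num) (by norm_num),
        Nat.primeFactors_prime_pow (by norm_num) (by norm_num),
        Nat.primeFactors_mul (by norm_num) (by norm_num),
        Nat.Prime.primeFactors (by norm_num), Nat.Prime.primeFactors (by norm_num)]
      rfl
    rw [h3] at h2
    simpa using h2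
  have hl59 : ¬ 59 ≡ 0 [MOD l] := by
    rcases hl3 with rfl | rfl | rfl <;> decide
  have hex : ∀ a : F59, ∃ u ∈ U.P U.i, U.π u = a ∧ Commute g u := by
    intro a
    obtain ⟨x, hx, rfl⟩ := U.π_surj a
    exact U.exists_commute_of_π_conj_eq hl59 hgH hgl hx (hcn n x hx)
  have hcard : 59 ^ 2 ≤ Nat.card (U.P U.i ⊓ Subgroup.centralizer {g} : Subgroup G) := by
    rw [← card_F59]
    refine Nat.card_le_card_of_surjective
      (fun u : (U.P U.i ⊓ Subgroup.centralizer {g} : Subgroup G) => U.π u) fun a => ?_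
    obtain ⟨u, hu, hua, huc⟩ := hex a
    exact ⟨⟨u, hu, Subgroup.mem_centralizer_singleton_iff.2 huc.symm.eq⟩, hua⟩
  obtain ⟨k, hk, hkc⟩ := U.exists_card_centralizer g
  rw [hkc] at hcard
  have hk2 : 2 ≤ k := (Nat.pow_le_pow_iff_right (by norm_num)).1 hcard
  have hk3 : k ≠ 3 := fun e => hg1 (U.eq_one_of_card_centralizer hgH (e ▸ hkc))
  obtain rfl : k = 2 := by omega
  rcases hl3 with rfl | rfl | rfl
  · rw [U.card_centralizer_of_involution hgH hgl hg1] at hkc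
    omega
  · have h5 := card_modEq_card_inf_centralizer (U.P U.i) g (fun x hx => U.conj_mem_P hgH hx) 5 1 hgl
    rw [hkc, U.card_P] at h5
    exact absurd h5 (by decide)
  · obtain ⟨u, hu, hua, huc⟩ := hex 1
    have h1 := U.order29 g hgo U.i u hu huc.symm
    rw [h1, U.π_one] at hua
    exact zero_ne_one hua

/-- The elements of `H` acting linearly. -/
def A : Subgroup G := U.H ⊓ Subgroup.centralizer {U.z}

theorem mem_A {h : G} : h ∈ U.A ↔ h ∈ U.H ∧ Commute h U.z :=
  and_congr_right fun _ => Subgroup.mem_centralizer_singleton_iff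

theorem A_le : U.A ≤ U.H := inf_le_left

theorem z_inv_ne : U.z⁻¹ ≠ U.z := by
  intro h
  have h1 : U.z ^ 2 = 1 := by rw [sq]; nth_rw 1 [← h]; rw [inv_mul_cancel]
  have := orderOf_dvd_of_pow_eq_one h1
  rw [U.orderOf_z] at this
  omega

theorem π_conj_of_mem_A {h : G} (hh : h ∈ U.A) {x : G} (hx : x ∈ U.P U.i) :
    U.π (h * x * h⁻¹) = U.lam h * U.π x := by
  rw [mem_A] at hh
  rcases U.lin h hh.1 with ⟨-, h1⟩ | ⟨h1, -⟩
  · exact h1 x hx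
  · exact absurd (h1.symm.trans (mul_inv_eq_of_eq_mul hh.2.eq)) U.z_inv_ne

theorem anti_of_not_mem_A {h : G} (hh : h ∈ U.H) (hA : h ∉ U.A) : h * U.z * h⁻¹ = U.z⁻¹ ∧
    ∀ x ∈ U.P U.i, U.π (h * x * h⁻¹) = U.lam h * star (U.π x) :=
  (U.lin h hh).resolve_left fun h1 => hA (U.mem_A.2 ⟨hh, h1.1⟩)

theorem mul_mem_A {g h : G} (hg : g ∈ U.H) (hgA : g ∉ U.A) (hh : h ∈ U.H) (hhA : h ∉ U.A) :
    g * h ∈ U.A := by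
  refine U.mem_A.2 ⟨mul_mem hg hh, ?_⟩
  have h1 := (U.anti_of_not_mem_A hg hgA).1
  have h2 := (U.anti_of_not_mem_A hh hhA).1
  have h3 : (g * h) * U.z * (g * h)⁻¹ = U.z := by
    calc (g * h) * U.z * (g * h)⁻¹ = g * (h * U.z * h⁻¹) * g⁻¹ := by group
      _ = (g * U.z * g⁻¹)⁻¹ := by rw [h2]; group
      _ = U.z := by rw [h1, inv_inv]
  exact mul_inv_eq_iff_eq_mul.1 h3

theorem lam_eq_of_forall {h : G} (hh : h ∈ U.A) {a : F59}
    (ha : ∀ x ∈ U.P U.i, U.π (h * x * h⁻¹) = a * U.π x) : U.lam h = a := by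
  obtain ⟨x, hx, hx1⟩ := U.π_surj 1
  have := U.π_conj_of_mem_A hh hx
  rw [ha x hx, hx1, mul_one, mul_one] at this
  exact this.symm

theorem lam_mul {g h : G} (hg : g ∈ U.A) (hh : h ∈ U.A) : U.lam (g * h) = U.lam g * U.lam h := by
  refine U.lam_eq_of_forall (mul_mem hg hh) fun x hx => ?_
  have : g * h * x * (g * h)⁻¹ = g * (h * x * h⁻¹) * g⁻¹ := by group
  rw [this, U.π_conj_of_mem_A hg (U.conj_mem_P (U.A_le hh) hx), U.π_conj_of_mem_A hh hx, mul_assoc]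

theorem lam_one : U.lam 1 = 1 := U.lam_eq_of_forall (one_mem _) fun x _ => by simp

theorem lam_inj {g h : G} (hg : g ∈ U.A) (hh : h ∈ U.A) (e : U.lam g = U.lam h) : g = h := by
  rw [← inv_mul_eq_one]
  have hm : g⁻¹ * h ∈ U.A := mul_mem (inv_mem hg) hh
  have h1 : U.lam (g⁻¹ * h) = 1 := by
    have := U.lam_mul hg hm
    rw [mul_inv_cancel_left, ← e] at this
    exact (mul_eq_left₀ (U.lam_ne g (U.A_le hg))).1 this.symm
  refine U.eq_one_of_π_conj_eq (U.A_le hm) fun x hx => ?_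
  rw [U.π_conj_of_mem_A hm hx, h1, one_mul]

/-- `lam` as a monoid homomorphism. -/
def lamHom : U.A →* F59 where
  toFun h := U.lam h
  map_one' := U.lam_one
  map_mul' g h := U.lam_mul g.2 h.2

theorem lamHom_injective : Function.Injective U.lamHom := fun g h e =>
  Subtype.ext (U.lam_inj g.2 h.2 e)

theorem lam_pow {h : G} (hh : h ∈ U.A) (n : ℕ) : U.lam (h ^ n) = U.lam h ^ n :=
  map_pow U.lamHom ⟨h, hh⟩ n

theorem commute_of_mem_A {g h : G} (hg : g ∈ U.A) (hh : h ∈ U.A) : Commute g h :=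
  U.lam_inj (mul_mem hg hh) (mul_mem hh hg) (by rw [U.lam_mul hg hh, U.lam_mul hh hg, mul_comm])

theorem isCyclic_A : IsCyclic U.A := isCyclic_of_subgroup_isDomain U.lamHom U.lamHom_injective

theorem card_A : U.A = U.H ∨ Nat.card U.A = 580 := by
  by_cases h : U.H ≤ U.A
  · exact .inl (le_antisymm U.A_le h)
  right
  obtain ⟨k, hk, hkA⟩ := SetLike.not_le_iff_exists.1 h
  have h2 : (U.A.subgroupOf U.H).index = 2 := by
    rw [Subgroup.index_eq_two_iff]
    refine ⟨⟨k, hk⟩, fun b => ?_⟩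
    have e1 : b * ⟨k, hk⟩ ∈ U.A.subgroupOf U.H ↔ (b : G) * k ∈ U.A := Iff.rfl
    have e2 : b ∈ U.A.subgroupOf U.H ↔ (b : G) ∈ U.A := Iff.rfl
    rw [e1, e2]
    by_cases hb : (b : G) ∈ U.A
    · exact .inr ⟨hb, fun h => hkA ((Subgroup.mul_mem_cancel_left _ hb).1 h)⟩
    · exact .inl ⟨U.mul_mem_A b.2 hb hk hkA, hb⟩
  have h3 := Subgroup.card_mul_index (U.A.subgroupOf U.H)
  rw [h2, U.card_H, Nat.card_congr (Subgroup.subgroupOfEquivOfLe U.A_le).toEquiv] at h3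
  omega

theorem exists_lam_sq_eq_neg_one : ∃ c ∈ U.A, U.lam c ^ 2 = -1 := by
  have hc := U.isCyclic_A
  have h4 : 4 ∣ Nat.card U.A := by
    rcases U.card_A with h | h
    · rw [h, U.card_H]; norm_num
    · rw [h]; norm_num
  obtain ⟨g, hg⟩ := IsCyclic.exists_ofOrder_eq_natCard (α := U.A)
  obtain ⟨m, hm⟩ := h4
  have hm0 : m ≠ 0 := fun e => (Nat.card_pos (α := U.A)).ne' (by rw [hm, e])
  have ho : orderOf (g ^ m) = 4 := by
    rw [orderOf_pow_of_dvd hm0 (by rw [hg, hm]; exact Dvd.intro_left 4 rfl), hg, hm,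
      Nat.mul_div_cancel _ (Nat.pos_of_ne_zero hm0)]
  refine ⟨(g ^ m : U.A), (g ^ m).2, ?_⟩
  have h1 : U.lamHom (g ^ m) ^ 4 = 1 := by rw [← map_pow, ← ho, pow_orderOf_eq_one, map_one]
  have h2 : U.lamHom (g ^ m) ^ 2 ≠ 1 := fun h => by
    rw [← map_pow, ← map_one U.lamHom] at h
    have := orderOf_dvd_of_pow_eq_one (U.lamHom_injective h)
    rw [ho] at this
    omega
  change U.lamHom (g ^ m) ^ 2 = -1
  have h3 : (U.lamHom (g ^ m) ^ 2 - 1) * (U.lamHom (g ^ m) ^ 2 + 1) = 0 := by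
    linear_combination h1
  exact eq_neg_of_add_eq_zero_left ((mul_eq_zero.1 h3).resolve_left (sub_ne_zero.2 h2))

end UPi

/-- A `UPi` with an element acting as a square root of `-1`. -/
structure UT (G Ω : Type*) [Group G] [MulAction G Ω] [Finite G] [Finite Ω] extends UPi G Ω where
  c : G
  c_mem : c ∈ toUPi.A
  lam_c : lam c ^ 2 = -1

theorem UPi.nonempty_uT {G Ω : Type*} [Group G] [MulAction G Ω] [Finite G] [Finite Ω]
    (U : UPi G Ω) : Nonempty (UT G Ω) := by
  obtain ⟨c, hc, h⟩ := U.exists_lam_sq_eq_neg_one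
  exact ⟨{ U with c := c, c_mem := hc, lam_c := h }⟩

namespace UT

variable {G Ω : Type*} [Group G] [MulAction G Ω] [Finite G] [Finite Ω] (U : UT G Ω)

/-- The involution of `H`. -/
def t : G := U.c ^ 2

theorem t_mem_A : U.t ∈ U.A := pow_mem U.c_mem 2

theorem t_mem_H : U.t ∈ U.H := U.A_le U.t_mem_A

theorem lam_t : U.lam U.t = -1 := by rw [t, U.lam_pow U.c_mem, U.lam_c]

theorem eq_one_or_eq_t {s : G} (hs : s ∈ U.A) (h2 : s ^ 2 = 1) : s = 1 ∨ s = U.t := by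
  have h3 : U.lam s ^ 2 = 1 := by rw [← U.lam_pow hs, h2, U.lam_one]
  rcases sq_eq_one_iff.1 h3 with h | h
  · exact .inl (U.lam_inj hs (one_mem _) (by rw [h, U.lam_one]))
  · exact .inr (U.lam_inj hs U.t_mem_A (by rw [h, U.lam_t]))

theorem t_sq : U.t ^ 2 = 1 := by
  refine U.lam_inj (pow_mem U.t_mem_A 2) (one_mem _) ?_
  rw [U.lam_pow U.t_mem_A, U.lam_t, U.lam_one]; norm_num

theorem t_inv : U.t⁻¹ = U.t := inv_eq_of_mul_eq_one_left (by rw [← sq, U.t_sq])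

theorem two_ne_zero : (2 : F59) ≠ 0 := by
  intro h
  have := congrArg QuadraticAlgebra.re h
  revert this
  decide

theorem t_ne_one : U.t ≠ 1 := by
  intro h
  have h1 := U.lam_t
  rw [h, U.lam_one] at h1
  exact two_ne_zero (by linear_combination h1)

theorem π_conj_t {x : G} (hx : x ∈ U.P U.i) : U.π (U.t * x * U.t⁻¹) = -U.π x := by
  rw [U.π_conj_of_mem_A U.t_mem_A hx, U.lam_t, neg_one_mul]

theorem mem_Z_of_commute_t {x : G} (hx : x ∈ U.P U.i) (h : Commute x U.t) : x ∈ U.Z := by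
  rw [← U.π_eq_zero x hx]
  have h1 := U.π_conj_t hx
  rw [mul_inv_eq_of_eq_mul h.symm.eq] at h1
  have : (2 : F59) * U.π x = 0 := by linear_combination h1
  exact (mul_eq_zero.1 this).resolve_left two_ne_zero

theorem centralizer_t_eq : U.P U.i ⊓ Subgroup.centralizer {U.t} = U.Z := by
  refine Subgroup.eq_of_le_of_card_ge (fun x hx => U.mem_Z_of_commute_t hx.1
    (Subgroup.mem_centralizer_singleton_iff.1 hx.2)) ?_
  rw [U.card_Z, U.card_centralizer_of_involution U.t_mem_H U.t_sq U.t_ne_one]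

theorem commute_t_of_mem_Z {x : G} (hx : x ∈ U.Z) : Commute x U.t := by
  rw [← U.centralizer_t_eq] at hx
  exact Subgroup.mem_centralizer_singleton_iff.1 hx.2

theorem conj_eq_t_of {s : G} (hs : s ∈ U.H) (hc : ∀ h ∈ U.H, Commute s h) (g : G)
    (hg : g * U.t * g⁻¹ = s) : s = U.t := by
  have h2 : s ^ 2 = 1 := by
    rw [← hg, conj_pow, U.t_sq]; simp
  refine (U.eq_one_or_eq_t (U.mem_A.2 ⟨hs, hc _ U.z_mem⟩) h2).resolve_left fun h => ?_
  rw [h, mul_inv_eq_one, mul_eq_left] at hg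
  exact U.t_ne_one hg

theorem conj_mem_A {h g : G} (hh : h ∈ U.H) (hg : g ∈ U.A) : h * g * h⁻¹ ∈ U.A := by
  rw [U.mem_A] at hg ⊢
  refine ⟨mul_mem (mul_mem hh hg.1) (inv_mem hh), ?_⟩
  have h1 : ∃ n : ℤ, h⁻¹ * U.z * h = U.z ^ n := by
    obtain ⟨n, hn⟩ := U.z_normal h⁻¹ (inv_mem hh)
    exact ⟨n, by rw [zpow_natCast, ← hn, inv_inv]⟩
  obtain ⟨n, hn⟩ := h1
  have h2 := hg.2.zpow_right n
  rw [← hn] at h2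
  have h3 := (Commute.conj_iff (a := g) (b := h⁻¹ * U.z * h) h).2 h2
  have e : h * (h⁻¹ * U.z * h) * h⁻¹ = U.z := by group
  rwa [e] at h3

theorem commute_t {h : G} (hh : h ∈ U.H) : Commute h U.t := by
  have h1 : h * U.t * h⁻¹ ∈ U.A := U.conj_mem_A hh U.t_mem_A
  have h2 : (h * U.t * h⁻¹) ^ 2 = 1 := by rw [conj_pow, U.t_sq]; simp
  refine mul_inv_eq_iff_eq_mul.1 ((U.eq_one_or_eq_t h1 h2).resolve_left fun h3 => ?_)
  rw [mul_inv_eq_one, mul_eq_left] at h3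
  exact U.t_ne_one h3

theorem commute_of_pow_eq_t {x : G} (hx : x ∈ U.H) (h : x ^ 2 = U.t) {u : G} (hu : u ∈ U.Z) :
    Commute x u := by
  have h1 := U.card_centralizer_of_pow_four hx (by rw [show 4 = 2 * 2 by norm_num, pow_mul, h, U.t_sq])
    (by rw [h, U.centralizer_t_eq, U.card_Z])
  have h2 : U.P U.i ⊓ Subgroup.centralizer {x} ≤ U.Z := by
    intro v hv
    refine U.mem_Z_of_commute_t hv.1 ?_
    rw [← h]
    exact Commute.pow_right (Subgroup.mem_centralizer_singleton_iff.1 hv.2) 2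
  have h3 : U.P U.i ⊓ Subgroup.centralizer {x} = U.Z := by
    refine Subgroup.eq_of_le_of_card_ge h2 ?_
    have h4 := Subgroup.card_dvd_of_le h2
    rw [U.card_Z, Nat.dvd_prime (by norm_num)] at h4
    rw [U.card_Z, h4.resolve_left h1]
  rw [← h3] at hu
  exact Commute.symm (Subgroup.mem_centralizer_singleton_iff.1 hu.2)

theorem conj_mem_H_of_swap {g h : G} (hi : g • U.i = U.o) (ho : g • U.o = U.i) (hh : h ∈ U.H) :
    g * h * g⁻¹ ∈ U.H := by
  have hi' : g⁻¹ • U.i = U.o := by rw [← ho, inv_smul_smul]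
  have ho' : g⁻¹ • U.o = U.i := by rw [← hi, inv_smul_smul]
  rw [U.mem_H] at hh ⊢
  simp only [mul_smul, hi', ho', hh.1, hh.2, hi, ho, and_self]

theorem commute_t_of_swap {g : G} (hi : g • U.i = U.o) (ho : g • U.o = U.i) : Commute g U.t := by
  refine mul_inv_eq_iff_eq_mul.1 (U.conj_eq_t_of (U.conj_mem_H_of_swap hi ho U.t_mem_H)
    (fun h hh => ?_) g rfl)
  have hi' : g⁻¹ • U.i = U.o := by rw [← ho, inv_smul_smul]
  have ho' : g⁻¹ • U.o = U.i := by rw [← hi, inv_smul_smul]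
  have h1 := U.commute_t (U.conj_mem_H_of_swap hi' ho' hh)
  have h3 := (Commute.conj_iff g).2 h1.symm
  rw [inv_inv] at h3
  have e : g * (g⁻¹ * h * g) * g⁻¹ = h := by group
  rwa [e] at h3

theorem t_i : U.t • U.i = U.i := (U.mem_H.1 U.t_mem_H).1

theorem t_o : U.t • U.o = U.o := (U.mem_H.1 U.t_mem_H).2

theorem card_fix_t : Nat.card {q : Ω // U.t • q = q} = 60 := by
  rw [U.card_fixed U.t_mem_H, U.centralizer_t_eq, U.card_Z]

theorem fix_smul {g : G} (hg : Commute g U.t) {q : Ω} (hq : U.t • q = q) : U.t • g • q = g • q := by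
  rw [← mul_smul, ← hg.eq, mul_smul, hq]

theorem exists_commute_smul_eq {p q r : Ω} (hp : U.t • p = p) (hq : U.t • q = q)
    (hr : U.t • r = r) (hqp : q ≠ p) (hrp : r ≠ p) : ∃ x ∈ U.P p, Commute x U.t ∧ x • q = r := by
  obtain ⟨x, hx, hxq⟩ := U.exists_mem_smul_eq hqp hrp
  refine ⟨x, hx, ?_, hxq⟩
  have h1 : U.t * x * U.t⁻¹ = x := by
    refine U.eq_of_smul_eq hqp (U.conj_mem_of_smul_eq hp hx) hx ?_
    have hq' : U.t⁻¹ • q = q := by rw [U.t_inv, hq]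
    rw [mul_smul, mul_smul, hq', hxq, hr]
  exact (mul_inv_eq_iff_eq_mul.1 h1 : U.t * x = x * U.t).symm

/-- The subgroup generated by the elements of the root groups centralizing `t`. -/
def L : Subgroup G := Subgroup.closure {x | Commute x U.t ∧ ∃ p, x ∈ U.P p}

theorem commute_t_of_mem_L {l : G} (hl : l ∈ U.L) : Commute l U.t := by
  have : U.L ≤ Subgroup.centralizer {U.t} := by
    rw [L, Subgroup.closure_le]
    exact fun x hx => Subgroup.mem_centralizer_singleton_iff.2 hx.1
  exact Subgroup.mem_centralizer_singleton_iff.1 (this hl)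

theorem exists_fix_ne_ne (p q : Ω) : ∃ r, U.t • r = r ∧ r ≠ p ∧ r ≠ q := by
  by_contra! h
  classical
  have h1 : Set.ncard {r : Ω | U.t • r = r} ≤ Set.ncard {p, q} := by
    refine Set.ncard_le_ncard (fun r hr => ?_) (Set.toFinite _)
    by_cases hp : r = p
    · exact .inl hp
    · exact .inr (h r hr hp)
  have h2 := U.card_fix_t
  have h3 := Set.ncard_insert_le p {q}
  rw [Set.ncard_singleton] at h3
  have h4 : Set.ncard {r : Ω | U.t • r = r} = 60 := h2
  omega

theorem exists_mem_L {p q : Ω} (hp : U.t • p = p) (hq : U.t • q = q) (hpq : p ≠ q) :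
    ∃ l ∈ U.L, l • U.i = p ∧ l • U.o = q := by
  obtain ⟨r, hr, h1, h2⟩ := U.exists_fix_ne_ne U.i p
  obtain ⟨x, hx, hxt, hxp⟩ := U.exists_commute_smul_eq hr U.t_i hp h1.symm h2.symm
  have h3 : x • U.o ≠ p := fun h => U.ne (smul_left_cancel x (h.trans hxp.symm))
  obtain ⟨u, hu, hut, huq⟩ := U.exists_commute_smul_eq hp (U.fix_smul hxt U.t_o) hq h3 hpq.symm
  refine ⟨u * x, mul_mem (Subgroup.subset_closure ⟨hut, p, hu⟩)
    (Subgroup.subset_closure ⟨hxt, r, hx⟩), ?_, ?_⟩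
  · rw [mul_smul, hxp, U.fix p u hu]
  · rw [mul_smul, huq]

theorem exists_mul_of_commute {m : G} (hm : Commute m U.t) :
    ∃ l ∈ U.L, ∃ h ∈ U.H, m = l * h := by
  obtain ⟨l, hl, h1, h2⟩ := U.exists_mem_L (U.fix_smul hm U.t_i) (U.fix_smul hm U.t_o)
    (fun h => U.ne (smul_left_cancel m h.symm))
  refine ⟨l, hl, l⁻¹ * m, U.mem_H.2 ⟨?_, ?_⟩, by group⟩
  · rw [mul_smul, ← h1, inv_smul_smul]
  · rw [mul_smul, ← h2, inv_smul_smul]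

theorem smul_eq_of_commute_Z {h : G} (hh : h ∈ U.H) (hc : ∀ u ∈ U.Z, Commute h u) {q : Ω}
    (hq : U.t • q = q) : h • q = q := by
  by_cases hqi : q = U.i
  · rw [hqi]; exact (U.mem_H.1 hh).1
  obtain ⟨x, hx, hxt, rfl⟩ := U.exists_commute_smul_eq U.t_i U.t_o hq U.ne hqi
  exact (U.smul_smul_o_eq_iff hh hx).2 (hc x (U.mem_Z_of_commute_t hx hxt))

theorem commute_of_mem_L {k l : G} (hk : k ∈ U.H) (hc : ∀ u ∈ U.Z, Commute k u) (hl : l ∈ U.L) :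
    Commute k l := by
  have : U.L ≤ Subgroup.centralizer {k} := by
    rw [L, Subgroup.closure_le]
    rintro x ⟨hxt, p, hx⟩
    refine Subgroup.mem_centralizer_singleton_iff.2 ?_
    by_cases hp : U.t • p = p
    · obtain ⟨r, hr, h1, -⟩ := U.exists_fix_ne_ne p p
      have hkp := U.smul_eq_of_commute_Z hk hc hp
      have hkr := U.smul_eq_of_commute_Z hk hc hr
      have hkx := U.smul_eq_of_commute_Z hk hc (U.fix_smul hxt hr)
      have hkr' : k⁻¹ • r = r := by rw [inv_smul_eq_iff, hkr]
      have h2 : k * x * k⁻¹ = x := by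
        refine U.eq_of_smul_eq h1 (U.conj_mem_of_smul_eq hkp hx) hx ?_
        rw [mul_smul, mul_smul, hkr', hkx]
      exact (mul_inv_eq_iff_eq_mul.1 h2).symm
    · have h1 : x = 1 := by
        refine U.free p (U.t • p) hp x hx ?_
        refine U.fix _ x ?_
        have := (U.conj_mem_iff U.t p x).2 hx
        rwa [mul_inv_eq_of_eq_mul hxt.symm.eq] at this
      rw [h1, one_mul, mul_one]
  exact (Subgroup.mem_centralizer_singleton_iff.1 (this hl) : l * k = k * l).symm

/-- The class of `t`. -/
def I : Set G := {s | ∃ g, g * U.t * g⁻¹ = s}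

theorem t_mem_I : U.t ∈ U.I := ⟨1, by simp⟩

theorem conj_mem_I {s : G} (hs : s ∈ U.I) (g : G) : g * s * g⁻¹ ∈ U.I := by
  obtain ⟨k, rfl⟩ := hs
  exact ⟨g * k, by group⟩

theorem sq_of_mem_I {s : G} (hs : s ∈ U.I) : s ^ 2 = 1 := by
  obtain ⟨k, rfl⟩ := hs
  rw [conj_pow, U.t_sq]; simp

theorem inv_of_mem_I {s : G} (hs : s ∈ U.I) : s⁻¹ = s :=
  inv_eq_of_mul_eq_one_left (by rw [← sq, U.sq_of_mem_I hs])

theorem eq_t_of_mem_I {s : G} (hs : s ∈ U.I) (hi : s • U.i = U.i) (ho : s • U.o = U.o) :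
    s = U.t := by
  obtain ⟨g, rfl⟩ := hs
  have key : ∀ q : Ω, (g * U.t * g⁻¹) • q = q → U.t • g⁻¹ • q = g⁻¹ • q := by
    intro q hq
    rw [mul_smul, mul_smul] at hq
    rw [eq_inv_smul_iff, hq]
  obtain ⟨l, hl, h1, h2⟩ := U.exists_mem_L (key _ hi) (key _ ho)
    (fun h => U.ne (smul_left_cancel _ h.symm))
  have h3 : g * l ∈ U.H := U.mem_H.2
    ⟨by rw [mul_smul, h1, smul_inv_smul], by rw [mul_smul, h2, smul_inv_smul]⟩
  have h4 := mul_inv_eq_of_eq_mul (U.commute_t h3).eq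
  have h5 := mul_inv_eq_of_eq_mul (U.commute_t_of_mem_L hl).eq
  have e : g * l * U.t * (g * l)⁻¹ = g * (l * U.t * l⁻¹) * g⁻¹ := by group
  rw [← h5, ← e, h4, h5]

theorem eq_of_mem_I {s s' : G} (hs : s ∈ U.I) (hs' : s' ∈ U.I) {p q : Ω} (hpq : p ≠ q)
    (h1 : s • p = p) (h2 : s • q = q) (h3 : s' • p = p) (h4 : s' • q = q) : s = s' := by
  obtain ⟨g, rfl, rfl⟩ := U.exists_smul_eq_smul_eq (p := U.i) (q := U.o) U.ne.symm hpq
  have key : ∀ r ∈ U.I, r • g • U.i = g • U.i → r • g • U.o = g • U.o → g⁻¹ * r * g⁻¹⁻¹ = U.t := by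
    intro r hr hi ho
    refine U.eq_t_of_mem_I (U.conj_mem_I hr g⁻¹) ?_ ?_
    · rw [inv_inv, mul_smul, mul_smul, hi, inv_smul_smul]
    · rw [inv_inv, mul_smul, mul_smul, ho, inv_smul_smul]
  have := (key s hs h1 h2).trans (key s' hs' h3 h4).symm
  simpa using this

theorem card_fix_of_mem_I {s : G} (hs : s ∈ U.I) : Nat.card {q : Ω // s • q = q} = 60 := by
  obtain ⟨g, rfl⟩ := hs
  rw [← U.card_fix_t]
  refine (Nat.card_congr ((MulAction.toPerm g).subtypeEquiv fun q => ?_)).symm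
  rw [MulAction.toPerm_apply, mul_smul, mul_smul, inv_smul_smul, smul_left_cancel_iff]

/-- The permutation induced on the fixed points of `s` by an element commuting with `s`. -/
def fixPerm (g s : G) (h : Commute g s) : Equiv.Perm {q : Ω // s • q = q} :=
  (MulAction.toPerm g).subtypePerm fun q => by
    rw [MulAction.toPerm_apply, ← mul_smul, ← h.eq, mul_smul, smul_left_cancel_iff]

theorem fixPerm_apply (g s : G) (h : Commute g s) (q : {q : Ω // s • q = q}) :
    (fixPerm g s h q : Ω) = g • (q : Ω) := rfl

theorem fixPerm_mul (g g' s : G) (h : Commute g s) (h' : Commute g' s) :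
    fixPerm g s h * fixPerm (Ω := Ω) g' s h' = fixPerm (g * g') s (h.mul_left h') := by
  ext q
  exact (mul_smul g g' (q : Ω)).symm

theorem fixPerm_pow (g s : G) (h : Commute g s) (n : ℕ) :
    fixPerm (Ω := Ω) g s h ^ n = fixPerm (g ^ n) s (h.pow_left n) := by
  induction n with
  | zero => ext q; simp [fixPerm_apply]
  | succ n ih => ext q; rw [pow_succ, ih, fixPerm_mul, fixPerm_apply, fixPerm_apply, pow_succ]

theorem fixPerm_eq_one (s : G) {g : G} (h : Commute g s) (hg : g = 1) :
    fixPerm (Ω := Ω) g s h = 1 := by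
  ext q; simp [fixPerm_apply, hg]

theorem disjoint_fix {s s' : G} (hs : s ∈ U.I) (hs' : s' ∈ U.I) (hc : Commute s s') (hne : s ≠ s')
    {p : Ω} (h1 : s • p = p) (h2 : s' • p = p) : False := by
  have h3 := card_modEq_card_fixed (fixPerm (Ω := Ω) s' s hc.symm) 2 1 (by
    rw [fixPerm_pow]; exact fixPerm_eq_one _ _ (U.sq_of_mem_I hs'))
  rw [U.card_fix_of_mem_I hs] at h3
  have h4 : Nat.card {q // fixPerm (Ω := Ω) s' s hc.symm q = q} ≤ 1 := by
    rw [Finite.card_le_one_iff_subsingleton]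
    have : ∀ q : {q // fixPerm (Ω := Ω) s' s hc.symm q = q}, (q.1.1 : Ω) = p := by
      intro q
      by_contra hq
      exact hne (U.eq_of_mem_I hs hs' hq q.1.2 h1 (congrArg Subtype.val q.2) h2)
    exact ⟨fun a b => Subtype.ext (Subtype.ext ((this a).trans (this b).symm))⟩
  have h5 : 0 < Nat.card {q // fixPerm (Ω := Ω) s' s hc.symm q = q} :=
    @Nat.card_pos _ ⟨⟨⟨p, h1⟩, Subtype.ext h2⟩⟩ _
  have h6 : Nat.card {q // fixPerm (Ω := Ω) s' s hc.symm q = q} = 1 := by omega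
  rw [h6] at h3
  exact absurd h3 (by decide)

open Classical in
/-- The sign of the permutation induced on the fixed points of `t`. -/
noncomputable def sgn (g : G) (h : Commute g U.t) : ℤˣ :=
  letI := Fintype.ofFinite {q : Ω // U.t • q = q}
  Equiv.Perm.sign (fixPerm (Ω := Ω) g U.t h)

theorem sgn_mul {g g' : G} (h : Commute g U.t) (h' : Commute g' U.t) :
    U.sgn (g * g') (h.mul_left h') = U.sgn g h * U.sgn g' h' := by
  rw [sgn, ← fixPerm_mul, map_mul]; rfl

theorem sgn_pow {g : G} (h : Commute g U.t) (n : ℕ) :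
    U.sgn (g ^ n) (h.pow_left n) = U.sgn g h ^ n := by
  rw [sgn, ← fixPerm_pow, map_pow]; rfl

theorem sgn_one {g : G} (h : Commute g U.t) (hg : g = 1) : U.sgn g h = 1 := by
  rw [sgn, fixPerm_eq_one _ _ hg, map_one]

theorem sgn_congr {g g' : G} (h : Commute g U.t) (e : g = g') : U.sgn g h = U.sgn g' (e ▸ h) := by
  subst e; rfl

theorem sgn_of_pow_odd {g : G} (h : Commute g U.t) {n : ℕ} (hn : Odd n) (hg : g ^ n = 1) :
    U.sgn g h = 1 := by
  have h1 := U.sgn_pow h n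
  rw [U.sgn_one _ hg] at h1
  rcases Int.units_eq_one_or (U.sgn g h) with h2 | h2
  · exact h2
  · rw [h2, hn.neg_one_pow] at h1
    exact absurd h1 (by decide)

theorem sgn_of_mem_L {l : G} (hl : l ∈ U.L) : U.sgn l (U.commute_t_of_mem_L hl) = 1 := by
  refine Subgroup.closure_induction (p := fun l _ => ∀ h : Commute l U.t, U.sgn l h = 1)
    ?_ ?_ ?_ ?_ hl _
  · rintro x ⟨-, p, hx⟩ h
    refine U.sgn_of_pow_odd h (n := 59 ^ 3) (by decide) ?_
    rw [← U.card_P p]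
    have := pow_card_eq_one' (G := U.P p) (x := ⟨x, hx⟩)
    exact congrArg Subtype.val this
  · exact fun h => U.sgn_one h rfl
  · intro x y hx hy ihx ihy h
    have hx' := U.commute_t_of_mem_L hx
    have hy' := U.commute_t_of_mem_L hy
    rw [U.sgn_mul hx' hy', ihx hx', ihy hy', one_mul]
  · intro x hx ih h
    have hx' := U.commute_t_of_mem_L hx
    have h1 := U.sgn_mul h hx'
    rw [ih hx', mul_one, U.sgn_one _ (inv_mul_cancel x)] at h1
    exact h1.symm

theorem sgn_involution {s : G} (hs : s ∈ U.I) (h : Commute s U.t) (hne : s ≠ U.t) :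
    U.sgn s h = 1 := by
  classical
  let _ := Fintype.ofFinite {q : Ω // U.t • q = q}
  obtain ⟨a, ha, hs2⟩ := sign_of_pow_two (fixPerm (Ω := Ω) s U.t h) (by
    rw [fixPerm_pow]; exact fixPerm_eq_one _ _ (U.sq_of_mem_I hs))
  have : IsEmpty {q // fixPerm (Ω := Ω) s U.t h q = q} :=
    ⟨fun q => U.disjoint_fix hs U.t_mem_I h hne (congrArg Subtype.val q.2) q.1.2⟩
  have h0 := Nat.card_of_isEmpty (α := {q // fixPerm (Ω := Ω) s U.t h q = q})
  rw [h0, U.card_fix_t] at ha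
  obtain rfl : a = 30 := by omega
  rw [sgn, ← show (-1 : ℤˣ) ^ 30 = 1 by decide, ← hs2]

theorem sgn_of_sq_mem_I {x : G} (hs : x ^ 2 ∈ U.I) (h : Commute x U.t) (hne : x ^ 2 ≠ U.t) :
    U.sgn x h = -1 := by
  classical
  let _ := Fintype.ofFinite {q : Ω // U.t • q = q}
  obtain ⟨a, b, ha, hb, hs2⟩ := sign_of_pow_four (fixPerm (Ω := Ω) x U.t h) (by
    rw [fixPerm_pow]; exact fixPerm_eq_one _ _
      (by rw [show 4 = 2 * 2 by norm_num, pow_mul, U.sq_of_mem_I hs]))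
  have : IsEmpty {q // (fixPerm (Ω := Ω) x U.t h ^ 2) q = q} := by
    refine ⟨fun q => U.disjoint_fix hs U.t_mem_I (h.pow_left 2) hne (p := q.1.1) ?_ q.1.2⟩
    have := congrArg Subtype.val q.2
    rwa [DFunLike.congr_fun (fixPerm_pow (Ω := Ω) x U.t h 2) q.1] at this
  have h0 := Nat.card_of_isEmpty (α := {q // (fixPerm (Ω := Ω) x U.t h ^ 2) q = q})
  rw [h0] at ha hb
  rw [U.card_fix_t] at hb
  obtain rfl : a = 0 := by omega
  obtain rfl : b = 15 := by omega
  rw [sgn, ← show (-1 : ℤˣ) ^ (0 + 15) = -1 by decide, ← hs2]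

theorem exists_swap : ∃ w ∈ U.I, w • U.i = U.o ∧ w • U.o = U.i := by
  have : ∃ q : Ω, U.t • q ≠ q := by
    by_contra! h
    exact U.t_ne_one (U.faithful _ h)
  obtain ⟨q, hq⟩ := this
  obtain ⟨g, h1, h2⟩ := U.exists_smul_eq_smul_eq (p := q) (q := U.t • q) (p' := U.i) (q' := U.o)
    hq.symm U.ne.symm
  have e : U.t • U.t • q = q := by rw [← mul_smul, ← sq, U.t_sq, one_smul]
  refine ⟨g * U.t * g⁻¹, ⟨g, rfl⟩, ?_, ?_⟩
  · rw [← h1, mul_smul, mul_smul, inv_smul_smul, h2]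
  · rw [← h2, mul_smul, mul_smul, inv_smul_smul, e, h1]

end UT

/-- A `UT` with an involution interchanging the two base points and a coordinate on `Z`. -/
structure UW (G Ω : Type*) [Group G] [MulAction G Ω] [Finite G] [Finite Ω] extends UT G Ω where
  w : G
  w_mem : w ∈ toUT.I
  w_i : w • i = o
  w_o : w • o = i
  ζ : G → ZMod 59
  z₁ : G
  z₁_mem : z₁ ∈ toUElt.Z
  ζ_z₁ : ζ z₁ = 1
  ζ_mul : ∀ u ∈ toUElt.Z, ∀ v ∈ toUElt.Z, ζ (u * v) = ζ u + ζ v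
  ζ_inj : ∀ u ∈ toUElt.Z, ∀ v ∈ toUElt.Z, ζ u = ζ v → u = v

theorem UT.nonempty_uW {G Ω : Type*} [Group G] [MulAction G Ω] [Finite G] [Finite Ω]
    (U : UT G Ω) : Nonempty (UW G Ω) := by
  classical
  obtain ⟨w, hw, h1, h2⟩ := U.exists_swap
  have e : U.Z ≃* Multiplicative (ZMod 59) := mulEquivOfPrimeCardEq (p := 59) U.card_Z (by simp)
  exact ⟨{ U with
    w := w, w_mem := hw, w_i := h1, w_o := h2
    ζ := fun g => if hg : g ∈ U.Z then (e ⟨g, hg⟩).toAdd else 0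
    z₁ := e.symm (Multiplicative.ofAdd 1)
    z₁_mem := (e.symm (Multiplicative.ofAdd 1)).2
    ζ_z₁ := by simp
    ζ_mul := fun u hu v hv => by
      rw [dif_pos (mul_mem hu hv), dif_pos hu, dif_pos hv, ← toAdd_mul, ← map_mul]; rfl
    ζ_inj := fun u hu v hv huv => by
      rw [dif_pos hu, dif_pos hv] at huv
      exact congrArg Subtype.val (e.injective (Multiplicative.toAdd.injective huv)) }⟩

namespace UW

variable {G Ω : Type*} [Group G] [MulAction G Ω] [Finite G] [Finite Ω] (U : UW G Ω)

theorem commute_w_t : Commute U.w U.t := U.commute_t_of_swap U.w_i U.w_o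

theorem w_ne_t : U.w ≠ U.t := fun h => U.ne (by rw [← U.w_i, h, U.t_i])

theorem w_sq : U.w ^ 2 = 1 := U.sq_of_mem_I U.w_mem

theorem w_inv : U.w⁻¹ = U.w := U.inv_of_mem_I U.w_mem

theorem ζ_one : U.ζ 1 = 0 := by
  have := U.ζ_mul 1 (one_mem _) 1 (one_mem _)
  rw [mul_one] at this
  exact left_eq_add.1 this

theorem ζ_pow {u : G} (hu : u ∈ U.Z) (n : ℕ) : U.ζ (u ^ n) = n * U.ζ u := by
  induction n with
  | zero => simp [U.ζ_one]
  | succ n ih => rw [pow_succ, U.ζ_mul _ (pow_mem hu n) _ hu, ih]; push_cast; ring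

theorem ζ_inv {u : G} (hu : u ∈ U.Z) : U.ζ u⁻¹ = -U.ζ u := by
  have := U.ζ_mul u⁻¹ (inv_mem hu) u hu
  rw [inv_mul_cancel, U.ζ_one] at this
  exact eq_neg_of_add_eq_zero_left this.symm

theorem eq_z₁_pow {u : G} (hu : u ∈ U.Z) : u = U.z₁ ^ (U.ζ u).val := by
  refine U.ζ_inj _ hu _ (pow_mem U.z₁_mem _) ?_
  rw [U.ζ_pow U.z₁_mem, U.ζ_z₁, ZMod.natCast_zmod_val, mul_one]

/-- The scalar by which an element of `H` acts on `Z`. -/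
def χ (h : G) : ZMod 59 := U.ζ (h * U.z₁ * h⁻¹)

theorem ζ_conj {h u : G} (hh : h ∈ U.H) (hu : u ∈ U.Z) : U.ζ (h * u * h⁻¹) = U.χ h * U.ζ u := by
  nth_rw 1 [U.eq_z₁_pow hu]
  rw [← conj_pow, U.ζ_pow (U.conj_mem_Z hh U.z₁_mem), ZMod.natCast_zmod_val, χ, mul_comm]

theorem χ_mul {g h : G} (hg : g ∈ U.H) (hh : h ∈ U.H) : U.χ (g * h) = U.χ g * U.χ h := by
  change U.ζ (g * h * U.z₁ * (g * h)⁻¹) = _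
  rw [← mul_one (U.χ h), ← U.ζ_z₁, ← U.ζ_conj hh U.z₁_mem,
    ← U.ζ_conj hg (U.conj_mem_Z hh U.z₁_mem)]
  congr 1; group

theorem χ_one : U.χ 1 = 1 := by simp [χ, U.ζ_z₁]

theorem χ_pow {h : G} (hh : h ∈ U.H) (n : ℕ) : U.χ (h ^ n) = U.χ h ^ n := by
  induction n with
  | zero => simp [U.χ_one]
  | succ n ih => rw [pow_succ, U.χ_mul (pow_mem hh n) hh, ih, pow_succ]

theorem χ_ne_zero {h : G} (hh : h ∈ U.H) : U.χ h ≠ 0 := fun e => by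
  have := U.χ_mul (inv_mem hh) hh
  rw [e, mul_zero, inv_mul_cancel, U.χ_one] at this
  exact one_ne_zero this

theorem commute_iff_of_ne_one {h u : G} (hh : h ∈ U.H) (hu : u ∈ U.Z) (h1 : u ≠ 1) :
    Commute h u ↔ U.χ h = 1 := by
  have h0 : U.ζ u ≠ 0 := fun e => h1 (U.ζ_inj u hu 1 (one_mem _) (by rw [e, U.ζ_one]))
  rw [← mul_eq_right₀ h0, ← U.ζ_conj hh hu]
  refine ⟨fun h => by rw [mul_inv_eq_of_eq_mul h.eq], fun h => ?_⟩
  exact mul_inv_eq_iff_eq_mul.1 (U.ζ_inj _ (U.conj_mem_Z hh hu) _ hu h)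

theorem commute_Z {h : G} (hh : h ∈ U.H) (h1 : U.χ h = 1) {u : G} (hu : u ∈ U.Z) :
    Commute h u := by
  by_cases hu1 : u = 1
  · rw [hu1]; exact Commute.one_right h
  · exact (U.commute_iff_of_ne_one hh hu hu1).2 h1

theorem z₁_ne_one : U.z₁ ≠ 1 := fun h => by
  have := U.ζ_z₁
  rw [h, U.ζ_one] at this
  exact zero_ne_one this

theorem χ_eq_one {h : G} (hh : h ∈ U.H) (h1 : ∀ u ∈ U.Z, Commute h u) : U.χ h = 1 :=
  (U.commute_iff_of_ne_one hh U.z₁_mem U.z₁_ne_one).1 (h1 _ U.z₁_mem)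

theorem χ_of_sq_eq_t {h : G} (hh : h ∈ U.H) (h1 : h ^ 2 = U.t) : U.χ h = 1 :=
  U.χ_eq_one hh fun _ hu => U.commute_of_pow_eq_t hh h1 hu

theorem χ_t : U.χ U.t = 1 := U.χ_eq_one U.t_mem_H fun _ hu => (U.commute_t_of_mem_Z hu).symm

theorem c_mem_H : U.c ∈ U.H := U.A_le U.c_mem

theorem χ_c : U.χ U.c = 1 := U.χ_of_sq_eq_t U.c_mem_H rfl

theorem χ_y_ne_one : U.χ U.y ≠ 1 := fun h => U.z₁_ne_one
  (U.order29 U.y U.orderOf_y U.i _ (U.Z_le U.z₁_mem) (U.commute_Z U.y_mem h U.z₁_mem).symm)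

theorem isPrimitiveRoot_χ_y : IsPrimitiveRoot (U.χ U.y) 29 := by
  have : Fact (Nat.Prime 29) := ⟨by norm_num⟩
  rw [← orderOf_eq_prime (p := 29) (by rw [← U.χ_pow U.y_mem, U.y_pow, U.χ_one]) U.χ_y_ne_one]
  exact IsPrimitiveRoot.orderOf _

theorem commute_L {k l : G} (hk : k ∈ U.H) (h1 : U.χ k = 1) (hl : l ∈ U.L) : Commute k l :=
  U.commute_of_mem_L hk (fun _ hu => U.commute_Z hk h1 hu) hl

theorem conj_of_mul {l h k : G} (hl : l ∈ U.L) (hk : k ∈ U.H) (h1 : U.χ k = 1) (hh : h ∈ U.H) :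
    (l * h) * k * (l * h)⁻¹ = h * k * h⁻¹ := by
  have h2 : U.χ (h * k * h⁻¹) = 1 := by
    rw [U.χ_mul (mul_mem hh hk) (inv_mem hh), U.χ_mul hh hk, h1, mul_one,
      ← U.χ_mul hh (inv_mem hh), mul_inv_cancel, U.χ_one]
  have h3 := U.commute_L (mul_mem (mul_mem hh hk) (inv_mem hh)) h2 hl
  calc _ = l * (h * k * h⁻¹) * l⁻¹ := by group
    _ = _ := mul_inv_eq_of_eq_mul h3.symm.eq

theorem sgn_of_χ_eq_one {k : G} (hk : k ∈ U.H) (h1 : U.χ k = 1) :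
    U.sgn k (U.commute_t hk) = 1 := by
  have : UT.fixPerm (Ω := Ω) k U.t (U.commute_t hk) = 1 := by
    ext q
    exact U.smul_eq_of_commute_Z hk (fun _ hu => U.commute_Z hk h1 hu) q.2
  rw [UT.sgn, this, map_one]

theorem sgn_of_χ_ne_one {k : G} (hk : k ∈ U.H) (h2 : k ^ 2 = 1) (h1 : U.χ k ≠ 1) :
    U.sgn k (U.commute_t hk) = -1 := by
  classical
  let _ := Fintype.ofFinite {q : Ω // U.t • q = q}
  obtain ⟨a, ha, hs⟩ := sign_of_pow_two (UT.fixPerm (Ω := Ω) k U.t (U.commute_t hk)) (by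
    rw [UT.fixPerm_pow]; exact UT.fixPerm_eq_one _ _ h2)
  have hc : Nat.card {q // UT.fixPerm (Ω := Ω) k U.t (U.commute_t hk) q = q} = 2 := by
    have e : ∀ q : Ω, U.t • q = q → k • q = q → q = U.i ∨ q = U.o := by
      intro q hq hkq
      by_contra! hne
      obtain ⟨x, hx, hxt, rfl⟩ := U.exists_commute_smul_eq U.t_i U.t_o hq U.ne hne.1
      refine h1 ((U.commute_iff_of_ne_one hk (U.mem_Z_of_commute_t hx hxt) ?_).1
        ((U.smul_smul_o_eq_iff hk hx).1 hkq))
      rintro rfl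
      exact hne.2 (one_smul _ _)
    rw [Nat.card_eq_two_iff]
    refine ⟨⟨⟨U.i, U.t_i⟩, Subtype.ext (U.mem_H.1 hk).1⟩,
      ⟨⟨U.o, U.t_o⟩, Subtype.ext (U.mem_H.1 hk).2⟩, ?_, ?_⟩
    · intro h
      exact U.ne (congrArg (fun q => q.1.1) h).symm
    · rw [Set.eq_univ_iff_forall]
      intro q
      rcases e q.1.1 q.1.2 (congrArg Subtype.val q.2) with h | h
      · exact .inl (Subtype.ext (Subtype.ext h))
      · exact .inr (Subtype.ext (Subtype.ext h))
  rw [hc, U.card_fix_t] at ha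
  obtain rfl : a = 29 := by omega
  rw [UT.sgn, ← show (-1 : ℤˣ) ^ 29 = -1 by decide, ← hs]

theorem zmod59_pow_card {a : ZMod 59} (ha : a ≠ 0) : a ^ 58 = 1 := ZMod.pow_card_sub_one_eq_one ha

/-! ### All elements of `H` act linearly -/

theorem pow_mem_H_of_not_mem_A {k : G} (hk : k ∈ U.H) (hA : k ∉ U.A) : k ^ 29 ∉ U.A := by
  intro h
  have h2 : k ^ 2 ∈ U.A := by rw [sq]; exact U.mul_mem_A hk hA hk hA
  apply hA
  have h3 := mul_mem h (inv_mem (pow_mem h2 14))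
  rwa [← pow_mul, show 29 = 1 + 2 * 14 by norm_num, pow_add, mul_inv_cancel_right, pow_one] at h3

theorem lam_mul_self {k : G} (hk : k ∈ U.H) (hA : k ∉ U.A) :
    U.lam (k ^ 2) = U.lam k * star (U.lam k) := by
  have h2 : k ^ 2 ∈ U.A := by rw [sq]; exact U.mul_mem_A hk hA hk hA
  refine U.lam_eq_of_forall h2 fun x hx => ?_
  have e : k ^ 2 * x * (k ^ 2)⁻¹ = k * (k * x * k⁻¹) * k⁻¹ := by rw [sq]; group
  rw [e, (U.anti_of_not_mem_A hk hA).2 _ (U.conj_mem_P hk hx), (U.anti_of_not_mem_A hk hA).2 _ hx,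
    star_mul', star_star, mul_assoc]

theorem pow_sq_of_not_mem_A {k : G} (hk : k ∈ U.H) (hA : k ∉ U.A) :
    (k ^ 29) ^ 2 = 1 ∨ (k ^ 29) ^ 2 = U.t := by
  have h2 : k ^ 2 ∈ U.A := by rw [sq]; exact U.mul_mem_A hk hA hk hA
  have h3 : (k ^ 29) ^ 2 ∈ U.A := by rw [← pow_mul, mul_comm, pow_mul]; exact pow_mem h2 29
  refine U.eq_one_or_eq_t h3 (U.lam_inj (pow_mem h3 2) (one_mem _) ?_)
  have e : ((k ^ 29) ^ 2) ^ 2 = (k ^ 2) ^ 58 := by rw [← pow_mul, ← pow_mul, ← pow_mul]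
  have h0 : QuadraticAlgebra.norm (U.lam k) ≠ 0 := fun e =>
    U.lam_ne k hk (QuadraticAlgebra.norm_eq_zero_iff_eq_zero.1 e)
  rw [e, U.lam_pow h2, U.lam_mul_self hk hA, ← QuadraticAlgebra.algebraMap_norm_eq_mul_star,
    ← map_pow, zmod59_pow_card h0, map_one, U.lam_one]

theorem χ_of_anti_involution {k : G} (hk : k ∈ U.H) (hA : k ∉ U.A) (h2 : k ^ 2 = 1) :
    U.χ k ≠ 1 := by
  intro hχ
  have hk1 : k ≠ 1 := fun e => hA (e ▸ one_mem _)
  have hμ : U.lam k * star (U.lam k) = 1 := by rw [← U.lam_mul_self hk hA, h2, U.lam_one]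
  have hex : ∃ a : F59, a ≠ 0 ∧ U.lam k * star a = a := by
    by_cases h : U.lam k = -1
    · refine ⟨⟨0, 1⟩, by decide, ?_⟩
      rw [h]; decide
    · refine ⟨1 + U.lam k, fun e => h (eq_neg_of_add_eq_zero_right e), ?_⟩
      rw [star_add, star_one, mul_add, hμ, mul_one, add_comm]
  obtain ⟨a, ha, hka⟩ := hex
  obtain ⟨x, hx, rfl⟩ := U.π_surj a
  have : Fact (Nat.Prime 2) := ⟨Nat.prime_two⟩
  obtain ⟨u, hu, hua, huc⟩ := U.exists_commute_of_π_conj_eq (l := 2) (by decide) hk h2 hx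
    (by rw [(U.anti_of_not_mem_A hk hA).2 _ hx, hka])
  have h3 : U.P U.i ⊓ Subgroup.centralizer {k} = U.Z := by
    refine (Subgroup.eq_of_le_of_card_ge (fun v hv => Subgroup.mem_inf.2 ⟨U.Z_le hv,
      Subgroup.mem_centralizer_singleton_iff.2 (U.commute_Z hk hχ hv).symm⟩) ?_).symm
    rw [U.card_centralizer_of_involution hk h2 hk1, U.card_Z]
  have h4 : u ∈ U.Z := by
    rw [← h3]; exact ⟨hu, Subgroup.mem_centralizer_singleton_iff.2 huc.symm⟩
  rw [← U.π_eq_zero u hu, hua] at h4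
  exact ha h4

theorem χ_pow_of_mem_A (hA : Nat.card U.A = 580) {x : G} (hx : x ∈ U.A) : U.χ x ^ 29 = 1 := by
  have h0 : ((x ^ 29) ^ 5) ^ 4 = 1 := by
    rw [← pow_mul, ← pow_mul, show 29 * 5 * 4 = 580 by norm_num, ← hA]
    exact congrArg Subtype.val (pow_card_eq_one' (G := U.A) (x := ⟨x, hx⟩))
  have hm : (x ^ 29) ^ 5 ∈ U.A := pow_mem (pow_mem hx _) _
  have h1 : U.χ ((x ^ 29) ^ 5) = 1 := by
    rcases U.eq_one_or_eq_t (pow_mem hm 2) (by rw [← pow_mul, h0]) with h | h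
    · rcases U.eq_one_or_eq_t hm h with h | h
      · rw [h, U.χ_one]
      · rw [h, U.χ_t]
    · exact U.χ_of_sq_eq_t (U.A_le hm) h
  rw [U.χ_pow (pow_mem (U.A_le hx) _), U.χ_pow (U.A_le hx)] at h1
  exact zmod59_eq_one_of_pow_five _ h1

theorem sgn_of_χ_pow {x : G} (hx : x ∈ U.H) (h : U.χ x ^ 29 = 1) :
    U.sgn x (U.commute_t hx) = 1 := by
  have h1 := U.sgn_pow (U.commute_t hx) 29
  rw [U.sgn_of_χ_eq_one (pow_mem hx 29) (by rw [U.χ_pow hx, h])] at h1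
  rcases Int.units_eq_one_or (U.sgn x (U.commute_t hx)) with h2 | h2
  · exact h2
  · rw [h2] at h1; exact absurd h1 (by decide)

theorem exists_conj_t_eq_w : ∃ g, g * U.t * g⁻¹ = U.w := U.w_mem

/-- An element squaring to `t` and commuting with `w` is conjugate to one commuting with `t` and
acting on its fixed points as an odd permutation. -/
theorem sgn_conj {x g : G} (hg : g * U.t * g⁻¹ = U.w) (hx : x ^ 2 = U.t) (hc : Commute x U.w) :
    ∃ h : Commute (g⁻¹ * x * g) U.t, U.sgn (g⁻¹ * x * g) h = -1 := by
  have hw : g⁻¹ * U.w * g = U.t := by rw [← hg]; group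
  have h1 : Commute (g⁻¹ * x * g) U.t := by
    rw [← hw]
    have := (Commute.conj_iff g⁻¹).2 hc
    rwa [inv_inv] at this
  have h2 : (g⁻¹ * x * g) ^ 2 = g⁻¹ * U.t * g⁻¹⁻¹ := by
    rw [← hx, sq, sq]; group
  refine ⟨h1, U.sgn_of_sq_mem_I ?_ h1 ?_⟩
  · rw [h2]; exact U.conj_mem_I U.t_mem_I _
  · rw [h2]
    intro e
    apply U.w_ne_t
    rw [← hg]
    nth_rw 1 [← e]
    group

theorem sgn_of_mul {l h : G} (hl : l ∈ U.L) (hh : h ∈ U.H) (hc : Commute (l * h) U.t) :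
    U.sgn (l * h) hc = U.sgn h (U.commute_t hh) := by
  rw [U.sgn_mul (U.commute_t_of_mem_L hl) (U.commute_t hh), U.sgn_of_mem_L hl, one_mul]

theorem c_conj_of_not_mem_A {h : G} (hh : h ∈ U.H) (hA : h ∉ U.A) : h * U.c * h⁻¹ = U.c⁻¹ := by
  have h1 : h * U.c * h⁻¹ ∈ U.A := U.conj_mem_A hh U.c_mem
  have h2 : U.lam (h * U.c * h⁻¹) ^ 2 = -1 := by
    rw [← U.lam_pow h1, conj_pow, ← UT.t, mul_inv_eq_of_eq_mul (U.commute_t hh).eq, U.lam_t]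
  have h3 : U.lam (h * U.c * h⁻¹) ^ 2 = U.lam U.c ^ 2 := by rw [h2, U.lam_c]
  rcases sq_eq_sq_iff_eq_or_eq_neg.1 h3 with h4 | h4
  · exfalso
    have h5 := U.lam_inj h1 U.c_mem h4
    have h6 : h * U.c = U.c * h := mul_inv_eq_iff_eq_mul.1 h5
    obtain ⟨x, hx, hx1⟩ := U.π_surj 1
    have e : h * (U.c * x * U.c⁻¹) * h⁻¹ = U.c * (h * x * h⁻¹) * U.c⁻¹ := by
      have : h * (U.c * x * U.c⁻¹) * h⁻¹ = (h * U.c) * x * (h * U.c)⁻¹ := by group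
      rw [this, h6]; group
    have h7 := congrArg U.π e
    rw [(U.anti_of_not_mem_A hh hA).2 _ (U.conj_mem_P U.c_mem_H hx), U.π_conj_of_mem_A U.c_mem hx,
      U.π_conj_of_mem_A U.c_mem (U.conj_mem_P hh hx), (U.anti_of_not_mem_A hh hA).2 _ hx, hx1,
      mul_one, star_one, mul_one, mul_comm, mul_left_inj' (U.lam_ne h hh)] at h7
    have h8 := U.lam_c
    revert h7 h8
    generalize U.lam U.c = a
    intro h7 h8
    have h9 : -a.im = a.im := congrArg QuadraticAlgebra.im h7
    have h10 := congrArg QuadraticAlgebra.re h8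
    have h11 : a.im = 0 := by
      have h12 : (2 : ZMod 59) * a.im = 0 := by linear_combination -h9
      exact (mul_eq_zero.1 h12).resolve_left (by decide)
    rw [sq, QuadraticAlgebra.re_mul, h11, mul_zero, add_zero] at h10
    revert h10
    generalize a.re = b
    revert b
    decide
  · refine U.lam_inj h1 (inv_mem U.c_mem) ?_
    have : U.c⁻¹ = U.t * U.c := by
      rw [inv_eq_iff_mul_eq_one, ← U.t_sq, UT.t]; group
    rw [h4, this, U.lam_mul U.t_mem_A U.c_mem, U.lam_t, neg_one_mul]

theorem eq_of_anti_t {k₀ : G} (hcard : Nat.card U.A = 580) (hk₀ : k₀ ∈ U.H) (hA : k₀ ∉ U.A)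
    (ht : (k₀ ^ 29) ^ 2 = U.t) : False := by
  have hkH : k₀ ^ 29 ∈ U.H := pow_mem hk₀ 29
  have hχ : ∀ h ∈ U.H, U.χ h ^ 29 = 1 := by
    intro h hh
    by_cases hhA : h ∈ U.A
    · exact U.χ_pow_of_mem_A hcard hhA
    · have h1 : h * k₀ ∈ U.A := U.mul_mem_A hh hhA hk₀ hA
      have h2 := U.χ_pow_of_mem_A hcard h1
      rwa [U.χ_mul hh hk₀, mul_pow, ← U.χ_pow hk₀ 29, U.χ_of_sq_eq_t hkH ht, mul_one] at h2
  have heven : ∀ m, ∀ hm : Commute m U.t, U.sgn m hm = 1 := by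
    intro m hm
    obtain ⟨l, hl, h, hh, rfl⟩ := U.exists_mul_of_commute hm
    rw [U.sgn_of_mul hl hh, U.sgn_of_χ_pow hh (hχ h hh)]
  obtain ⟨g, hg⟩ := U.exists_conj_t_eq_w
  have hno : ∀ x : G, x ^ 2 = U.t → ¬ Commute x U.w := by
    intro x hx hc
    obtain ⟨h1, h2⟩ := U.sgn_conj hg hx hc
    rw [heven] at h2
    exact absurd h2 (by decide)
  have hyK : ∀ k ∈ U.H, U.χ k = 1 → Commute U.y k := by
    intro k hk hk1
    obtain ⟨n, hn⟩ := U.y_normal k hk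
    have h1 : U.χ U.y ^ n = U.χ U.y ^ 1 := by
      rw [← U.χ_pow U.y_mem, ← hn, U.χ_mul (mul_mem hk U.y_mem) (inv_mem hk), U.χ_mul hk U.y_mem,
        mul_right_comm, ← U.χ_mul hk (inv_mem hk), mul_inv_cancel, U.χ_one, one_mul, pow_one]
    have h2 : U.y ^ n = U.y := by
      rcases n with _ | n
      · rw [pow_zero, pow_one] at h1
        exact absurd h1.symm U.χ_y_ne_one
      · rw [pow_succ, pow_one, mul_eq_right₀ (U.χ_ne_zero U.y_mem),
          U.isPrimitiveRoot_χ_y.pow_eq_one_iff_dvd] at h1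
        obtain ⟨m, rfl⟩ := h1
        rw [pow_succ, pow_mul, U.y_pow, one_pow, one_mul]
    rw [h2] at hn
    exact (mul_inv_eq_iff_eq_mul.1 hn : k * U.y = U.y * k).symm
  obtain ⟨l, hl, h, hh, hw⟩ := U.exists_mul_of_commute U.commute_w_t
  obtain ⟨j, -, hj⟩ := U.isPrimitiveRoot_χ_y.eq_pow_of_pow_eq_one (hχ h hh)
  have hyj : U.y ^ j ∈ U.H := pow_mem U.y_mem j
  have hk'H : h * (U.y ^ j)⁻¹ ∈ U.H := mul_mem hh (inv_mem hyj)
  have hconj : ∀ k ∈ U.H, U.χ k = 1 → Commute k h → Commute k U.w := by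
    intro k hk hk1 hkh
    have := U.conj_of_mul hl hk hk1 hh
    rw [← hw, mul_inv_eq_of_eq_mul hkh.symm.eq] at this
    exact (mul_inv_eq_iff_eq_mul.1 this : U.w * k = k * U.w).symm
  have hdec : ∀ k ∈ U.H, U.χ k = 1 → Commute k (h * (U.y ^ j)⁻¹) → Commute k U.w := by
    intro k hk hk1 hkh
    refine hconj k hk hk1 ?_
    have := hkh.mul_right ((hyK k hk hk1).symm.pow_right j)
    rwa [inv_mul_cancel_right] at this
  by_cases hk'A : h * (U.y ^ j)⁻¹ ∈ U.A
  · exact hno U.c rfl (hdec _ U.c_mem_H U.χ_c (U.commute_of_mem_A U.c_mem hk'A))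
  · have h1 : U.χ (h * (U.y ^ j)⁻¹) = 1 := by
      have h2 := U.χ_mul hk'H hyj
      rw [inv_mul_cancel_right, U.χ_pow U.y_mem, hj] at h2
      exact (mul_eq_right₀ (U.χ_ne_zero hh)).1 h2.symm
    have h3 : U.χ ((h * (U.y ^ j)⁻¹) ^ 29) = 1 := by rw [U.χ_pow hk'H, h1, one_pow]
    rcases U.pow_sq_of_not_mem_A hk'H hk'A with h2 | h2
    · exact U.χ_of_anti_involution (pow_mem hk'H 29) (U.pow_mem_H_of_not_mem_A hk'H hk'A) h2 h3
    · exact hno _ h2 (hdec _ (pow_mem hk'H 29) h3 ((Commute.refl _).pow_left 29))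

theorem false_of_anti_involution (hcard : Nat.card U.A = 580)
    (hall : ∀ k ∈ U.H, k ∉ U.A → (k ^ 29) ^ 2 = 1) : False := by
  have hodd : ∀ k, ∀ hk : k ∈ U.H, k ∉ U.A → U.sgn k (U.commute_t hk) = -1 := by
    intro k hk hA
    have h1 := U.sgn_of_χ_ne_one (pow_mem hk 29) (hall k hk hA) (U.χ_of_anti_involution
      (pow_mem hk 29) (U.pow_mem_H_of_not_mem_A hk hA) (hall k hk hA))
    rw [U.sgn_pow (U.commute_t hk) 29] at h1
    rcases Int.units_eq_one_or (U.sgn k (U.commute_t hk)) with h2 | h2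
    · rw [h2] at h1; exact absurd h1 (by decide)
    · exact h2
  have hinv : ∀ x, ∀ hx : Commute x U.t, U.sgn x hx = -1 → x * U.c * x⁻¹ = U.c⁻¹ := by
    intro x hx h1
    obtain ⟨l, hl, h, hh, rfl⟩ := U.exists_mul_of_commute hx
    rw [U.sgn_of_mul hl hh] at h1
    rw [U.conj_of_mul hl U.c_mem_H U.χ_c hh]
    refine U.c_conj_of_not_mem_A hh fun hA => ?_
    rw [U.sgn_of_χ_pow hh (U.χ_pow_of_mem_A hcard hA)] at h1
    exact absurd h1 (by decide)
  obtain ⟨g, hg⟩ := U.exists_conj_t_eq_w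
  have hcw : Commute U.c U.w := by
    obtain ⟨l, hl, h, hh, hw⟩ := U.exists_mul_of_commute U.commute_w_t
    have hhA : h ∈ U.A := by
      by_contra hA
      have h1 := hodd h hh hA
      rw [← U.sgn_of_mul hl hh (hw ▸ U.commute_w_t), ← U.sgn_congr U.commute_w_t hw,
        U.sgn_involution U.w_mem _ U.w_ne_t] at h1
      exact absurd h1 (by decide)
    have h2 := U.conj_of_mul hl U.c_mem_H U.χ_c hh
    rw [← hw, mul_inv_eq_of_eq_mul (U.commute_of_mem_A hhA U.c_mem).eq] at h2
    exact (mul_inv_eq_iff_eq_mul.1 h2 : U.w * U.c = U.c * U.w).symm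
  obtain ⟨h1, h2⟩ := U.sgn_conj hg rfl hcw
  have h3 := hinv _ h1 h2
  set c₁ := g * U.c * g⁻¹ with hc₁
  have h4 : U.c * c₁ * U.c⁻¹ = c₁⁻¹ := by
    have e : U.c * c₁ * U.c⁻¹ = g * ((g⁻¹ * U.c * g) * U.c * (g⁻¹ * U.c * g)⁻¹) * g⁻¹ := by
      rw [hc₁]; group
    rw [e, h3, hc₁]; group
  have h5 : c₁ ^ 2 = U.w := by rw [hc₁, conj_pow, ← UT.t, hg]
  have h6 : Commute c₁ U.t := by
    have e : U.t * c₁ * U.t⁻¹ = U.c * (U.c * c₁ * U.c⁻¹) * U.c⁻¹ := by rw [UT.t, sq]; group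
    have e2 : U.c * c₁⁻¹ * U.c⁻¹ = (U.c * c₁ * U.c⁻¹)⁻¹ := by group
    rw [h4, e2, h4, inv_inv] at e
    exact (mul_inv_eq_iff_eq_mul.1 e : U.t * c₁ = c₁ * U.t).symm
  have h7 := hinv c₁ h6 (U.sgn_of_sq_mem_I (h5 ▸ U.w_mem) h6 (h5 ▸ U.w_ne_t))
  apply U.w_ne_t
  calc U.w = (c₁ ^ 2)⁻¹ := by rw [h5, U.w_inv]
    _ = (U.c * c₁ * U.c⁻¹) * c₁⁻¹ := by rw [h4]; group
    _ = U.c * (c₁ * U.c * c₁⁻¹)⁻¹ := by group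
    _ = U.t := by rw [h7, UT.t, sq, inv_inv]

theorem A_eq_H : U.A = U.H := by
  refine U.card_A.resolve_right fun hcard => ?_
  by_cases h : ∃ k ∈ U.H, k ∉ U.A ∧ (k ^ 29) ^ 2 = U.t
  · obtain ⟨k, hk, hA, h⟩ := h
    exact U.eq_of_anti_t hcard hk hA h
  · push Not at h
    exact U.false_of_anti_involution hcard fun k hk hA =>
      (U.pow_sq_of_not_mem_A hk hA).resolve_right (h k hk hA)

end UW

namespace UW

variable {G Ω : Type*} [Group G] [MulAction G Ω] [Finite G] [Finite Ω] (U : UW G Ω)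

theorem mem_A_of_mem_H {h : G} (hh : h ∈ U.H) : h ∈ U.A := U.A_eq_H ▸ hh

theorem commute_H {g h : G} (hg : g ∈ U.H) (hh : h ∈ U.H) : Commute g h :=
  U.commute_of_mem_A (U.mem_A_of_mem_H hg) (U.mem_A_of_mem_H hh)

theorem pow_card_H {h : G} (hh : h ∈ U.H) : h ^ 1160 = 1 := by
  rw [← U.card_H]
  exact congrArg Subtype.val (pow_card_eq_one' (G := U.H) (x := ⟨h, hh⟩))

theorem exists_lam_eq {a : F59} (ha : a ^ 1160 = 1) : ∃ h ∈ U.H, U.lam h = a := by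
  have hinj : Function.Injective (fun h : U.H => (⟨U.lam h, by
      rw [← U.lam_pow (U.mem_A_of_mem_H h.2), U.pow_card_H h.2, U.lam_one]⟩ :
      {a : F59 // a ^ 1160 = 1})) := fun g h e =>
    Subtype.ext (U.lam_inj (U.mem_A_of_mem_H g.2) (U.mem_A_of_mem_H h.2) (congrArg Subtype.val e))
  have hle : Nat.card {a : F59 // a ^ 1160 = 1} ≤ Nat.card U.H := by
    rw [U.card_H]
    have h1 : {a : F59 | a ^ 1160 = 1} ⊆ (Polynomial.nthRootsFinset 1160 (1 : F59) : Set F59) := by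
      intro a ha
      exact (Polynomial.mem_nthRootsFinset (by norm_num) _).2 ha
    have h2 := Set.ncard_le_ncard h1 (Finset.finite_toSet _)
    rw [Set.ncard_coe_finset] at h2
    refine h2.trans (?_)
    unfold Polynomial.nthRootsFinset
    exact (@Multiset.toFinset_card_le _ (Classical.decEq _) _).trans (Polynomial.card_nthRoots 1160 1)
  obtain ⟨h, hh⟩ := (hinj.bijective_of_nat_card_le hle).2 ⟨a, ha⟩
  exact ⟨h, h.2, congrArg Subtype.val hh⟩

theorem commute_of_commute_t {m k : G} (hm : Commute m U.t) (hk : k ∈ U.H) (hχ : U.χ k = 1) :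
    Commute m k := by
  obtain ⟨l, hl, h, hh, rfl⟩ := U.exists_mul_of_commute hm
  have := U.conj_of_mul hl hk hχ hh
  rw [mul_inv_eq_of_eq_mul (U.commute_H hh hk).eq] at this
  exact mul_inv_eq_iff_eq_mul.1 this

theorem conj_w_mem_H {h : G} (hh : h ∈ U.H) : U.w * h * U.w⁻¹ ∈ U.H :=
  U.conj_mem_H_of_swap U.w_i U.w_o hh

theorem smul_eq_of_order29 {h : G} (hh : h ∈ U.H) (ho : orderOf h = 29) {q : Ω} (hq : h • q = q) :
    q = U.i ∨ q = U.o := by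
  by_contra! hne
  obtain ⟨x, hx, rfl⟩ := U.exists_mem_smul_eq U.ne hne.1
  have h1 := U.order29 h ho U.i x hx ((U.smul_smul_o_eq_iff hh hx).1 hq).symm
  exact hne.2 (by rw [h1, one_smul])

theorem eq_one_of_commute_w {h : G} (hh : h ∈ U.H) (h29 : h ^ 29 = 1) (hc : Commute h U.w) :
    h = 1 := by
  by_contra h1
  have : Fact (Nat.Prime 29) := ⟨by norm_num⟩
  have ho := orderOf_eq_prime h29 h1
  have h3 := card_modEq_card_fixed (UT.fixPerm (Ω := Ω) h U.w hc) 29 1 (by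
    rw [UT.fixPerm_pow]; exact UT.fixPerm_eq_one _ _ h29)
  rw [U.card_fix_of_mem_I U.w_mem] at h3
  have : IsEmpty {q // UT.fixPerm (Ω := Ω) h U.w hc q = q} := by
    refine ⟨fun q => ?_⟩
    rcases U.smul_eq_of_order29 hh ho (congrArg Subtype.val q.2) with e | e
    · have := q.1.2
      rw [show (q.1.1 : Ω) = U.i from e, U.w_i] at this
      exact U.ne this
    · have := q.1.2
      rw [show (q.1.1 : Ω) = U.o from e, U.w_o] at this
      exact U.ne this.symm
  rw [Nat.card_of_isEmpty] at h3
  exact absurd h3 (by decide)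

theorem eq_one_or_t {s : G} (hs : s ∈ U.H) (h2 : s ^ 2 = 1) : s = 1 ∨ s = U.t :=
  U.eq_one_or_eq_t (U.mem_A_of_mem_H hs) h2

theorem not_commute_w {e : G} (h4 : e ^ 4 = U.t) : ¬ Commute e U.w := by
  intro hc
  obtain ⟨g, hg⟩ := U.exists_conj_t_eq_w
  obtain ⟨h1, h2⟩ := U.sgn_conj hg (x := e ^ 2) (by rw [← pow_mul, h4]) (hc.pow_left 2)
  have hw : g⁻¹ * U.w * g = U.t := by rw [← hg]; group
  have h3 : Commute (g⁻¹ * e * g) U.t := by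
    rw [← hw]
    have := (Commute.conj_iff g⁻¹).2 hc
    rwa [inv_inv] at this
  have e1 : g⁻¹ * e ^ 2 * g = (g⁻¹ * e * g) ^ 2 := by rw [sq, sq]; group
  rw [U.sgn_congr h1 e1, U.sgn_pow h3 2, Int.units_sq] at h2
  exact absurd h2 (by decide)

/-- The action of `w` on the torus. -/
theorem conj_w {h : G} (hh : h ∈ U.H) : U.w * h * U.w⁻¹ = (h ^ 59)⁻¹ := by
  rw [← mul_eq_one_iff_eq_inv]
  set f := U.w * h * U.w⁻¹ * h ^ 59 with hf
  have hwH := U.conj_w_mem_H hh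
  have hfp : ∀ n, f ^ n = U.w * h ^ n * U.w⁻¹ * (h ^ n) ^ 59 := by
    intro n
    rw [hf, (U.commute_H hwH (pow_mem hh 59)).mul_pow, conj_pow, ← pow_mul, mul_comm 59, pow_mul]
  have h1160 := U.pow_card_H hh
  have hK : ∀ k ∈ U.H, U.χ k = 1 → U.w * k * U.w⁻¹ = k := fun k hk hχ =>
    mul_inv_eq_of_eq_mul (U.commute_of_commute_t U.commute_w_t hk hχ).eq
  have h232 : f ^ 232 = 1 := by
    have hm := pow_mem hh 232
    have h5 : (h ^ 232) ^ 5 = 1 := by rw [← pow_mul, h1160]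
    have hχ : U.χ (h ^ 232) = 1 :=
      zmod59_eq_one_of_pow_five _ (by rw [← U.χ_pow hm, h5, U.χ_one])
    rw [hfp, hK _ hm hχ, ← pow_succ', show 59 + 1 = 5 * 12 by norm_num, pow_mul, h5, one_pow]
  have h40 : f ^ 40 = 1 := by
    have hm := pow_mem hh 40
    have h29 : (h ^ 40) ^ 29 = 1 := by rw [← pow_mul, h1160]
    have hm' := U.conj_w_mem_H hm
    have h1 : h ^ 40 * (U.w * h ^ 40 * U.w⁻¹) = 1 := by
      refine U.eq_one_of_commute_w (mul_mem hm hm') ?_ ?_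
      · rw [(U.commute_H hm hm').mul_pow, conj_pow, h29]; simp
      · have e : U.w * (h ^ 40 * (U.w * h ^ 40 * U.w⁻¹)) * U.w⁻¹ =
            h ^ 40 * (U.w * h ^ 40 * U.w⁻¹) := by
          rw [(U.commute_H hm hm').eq]
          have hw2 : U.w * U.w = 1 := by rw [← sq, U.w_sq]
          calc _ = (U.w * U.w) * h ^ 40 * (U.w * U.w)⁻¹ * (U.w * h ^ 40 * U.w⁻¹) := by group
            _ = _ := by rw [hw2, inv_one, one_mul, mul_one, (U.commute_H hm hm').eq]
        exact (mul_inv_eq_iff_eq_mul.1 e).symm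
    rw [hfp, ← inv_eq_of_mul_eq_one_right h1, show 59 = 1 + 29 * 2 by norm_num, pow_add, pow_mul,
      h29]
    simp
  have h145 : f ^ 145 = 1 := by
    have hm := pow_mem hh 145
    have h8 : (h ^ 145) ^ 8 = 1 := by rw [← pow_mul, h1160]
    have key : U.w * h ^ 145 * U.w⁻¹ = h ^ 145 ∨
        U.w * h ^ 145 * U.w⁻¹ = h ^ 145 * U.t ∧ (h ^ 145) ^ 4 = U.t := by
      generalize h ^ 145 = e at hm h8
      rcases U.eq_one_or_t (pow_mem hm 4) (by rw [← pow_mul, h8]) with h4 | h4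
      · left
        refine hK e hm ?_
        rcases U.eq_one_or_t (pow_mem hm 2) (by rw [← pow_mul, h4]) with h2 | h2
        · rcases U.eq_one_or_t hm h2 with h1 | h1
          · rw [h1, U.χ_one]
          · rw [h1, U.χ_t]
        · exact U.χ_of_sq_eq_t hm h2
      · right
        refine ⟨?_, h4⟩
        have hχ : U.χ (e ^ 2) = 1 := U.χ_of_sq_eq_t (pow_mem hm 2) (by rw [← pow_mul, h4])
        have hm' := U.conj_w_mem_H hm
        have h1 : (e⁻¹ * (U.w * e * U.w⁻¹)) ^ 2 = 1 := by
          rw [(U.commute_H (inv_mem hm) hm').mul_pow, conj_pow, hK _ (pow_mem hm 2) hχ, inv_pow,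
            inv_mul_cancel]
        rcases U.eq_one_or_t (mul_mem (inv_mem hm) hm') h1 with h | h
        · exfalso
          rw [inv_mul_eq_one] at h
          exact U.not_commute_w h4 (mul_inv_eq_iff_eq_mul.1 h.symm).symm
        · rw [← h, mul_inv_cancel_left]
    rw [hfp]
    rcases key with hk | ⟨hk, h4⟩
    · have h4 : (h ^ 145) ^ 4 = 1 := by
        rcases U.eq_one_or_t (pow_mem hm 4) (by rw [← pow_mul, h8]) with h4 | h4
        · exact h4
        · exact absurd (mul_inv_eq_iff_eq_mul.1 hk).symm (U.not_commute_w h4)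
      rw [hk, ← pow_succ', show 59 + 1 = 4 * 15 by norm_num, pow_mul, h4, one_pow]
    · rw [hk, ← h4, ← pow_succ', ← pow_add, show 4 + 1 + 59 = 8 * 8 by norm_num, pow_mul, h8, one_pow]
  have h1 : orderOf f ∣ Nat.gcd (Nat.gcd 232 145) 40 :=
    Nat.dvd_gcd (Nat.dvd_gcd (orderOf_dvd_of_pow_eq_one h232) (orderOf_dvd_of_pow_eq_one h145))
      (orderOf_dvd_of_pow_eq_one h40)
  rw [show Nat.gcd (Nat.gcd 232 145) 40 = 1 by decide, Nat.dvd_one, orderOf_eq_one_iff] at h1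
  exact h1

end UW

/-- The norm form of `F59`. -/
def nrm (a : F59) : ZMod 59 := a.re * a.re + a.im * a.im

/-- The symplectic form on `F59`. -/
def sym (a b : F59) : ZMod 59 := a.re * b.im - a.im * b.re

namespace UW

variable {G Ω : Type*} [Group G] [MulAction G Ω] [Finite G] [Finite Ω] (U : UW G Ω)

theorem eq_one_of_mem_Z_of_sq {u : G} (hu : u ∈ U.Z) (h : u * u = 1) : u = 1 := by
  refine U.ζ_inj u hu 1 (one_mem _) ?_
  have h1 := U.ζ_mul u hu u hu
  rw [h, U.ζ_one] at h1
  rw [U.ζ_one]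
  have key : ∀ x : ZMod 59, 0 = x + x → x = 0 := by decide
  exact key _ h1

theorem exists_X (a : F59) :
    ∃ x ∈ U.P U.i, U.π x = a ∧ U.t * x * U.t⁻¹ = x⁻¹ := by
  obtain ⟨u, hu, rfl⟩ := U.π_surj a
  have hu' := U.conj_mem_P U.t_mem_H hu
  obtain ⟨e, he⟩ : ∃ e, e = u * (U.t * u * U.t⁻¹) := ⟨_, rfl⟩
  have heZ : e ∈ U.Z := by
    have := (U.inv_mul_mem_Z (inv_mem hu) hu').2 (by rw [U.π_inv hu, U.π_conj_t hu])
    rwa [inv_inv, ← he] at this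
  have he1 : U.t * u * U.t⁻¹ = u⁻¹ * e := by rw [he]; group
  have hv := pow_mem heZ 29
  have h59 : e ^ 59 = 1 := by
    rw [← U.card_Z]
    exact congrArg Subtype.val (pow_card_eq_one' (G := U.Z) (x := ⟨e, heZ⟩))
  refine ⟨u * e ^ 29, mul_mem hu (U.Z_le hv), ?_, ?_⟩
  · rw [U.π_mul _ hu _ (U.Z_le hv), (U.π_eq_zero _ (U.Z_le hv)).2 hv, add_zero]
  · have h1 : U.t * (u * e ^ 29) * U.t⁻¹ = (U.t * u * U.t⁻¹) * (U.t * e ^ 29 * U.t⁻¹) := by group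
    have h2 : U.t * e ^ 29 * U.t⁻¹ = e ^ 29 :=
      mul_inv_eq_of_eq_mul (U.commute_t_of_mem_Z hv).symm.eq
    rw [h1, h2, he1, mul_assoc, ← pow_succ', mul_inv_rev,
      ((U.commute_of_mem_Z hv hu).inv_left.inv_right).eq]
    congr 1
    rw [eq_inv_iff_mul_eq_one, ← pow_add, h59]

theorem eq_of_inverted {x y : G} (hx : x ∈ U.P U.i) (hy : y ∈ U.P U.i) (h : U.π x = U.π y)
    (hxt : U.t * x * U.t⁻¹ = x⁻¹) (hyt : U.t * y * U.t⁻¹ = y⁻¹) : x = y := by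
  have hZ := (U.inv_mul_mem_Z hx hy).2 h
  obtain ⟨e, he⟩ : ∃ e, e = x⁻¹ * y := ⟨_, rfl⟩
  rw [← he] at hZ
  obtain rfl : y = x * e := by rw [he]; group
  have h1 : U.t * (x * e) * U.t⁻¹ = (U.t * x * U.t⁻¹) * (U.t * e * U.t⁻¹) := by group
  rw [h1, hxt, mul_inv_eq_of_eq_mul (U.commute_t_of_mem_Z hZ).symm.eq, mul_inv_rev,
    ← ((U.commute_of_mem_Z hZ hx).inv_left.inv_right).eq.symm, mul_left_cancel_iff] at hyt
  rw [U.eq_one_of_mem_Z_of_sq hZ (by nth_rw 1 [hyt]; exact inv_mul_cancel e), mul_one]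

/-- The element of `P i` over `a` that `t` inverts. -/
noncomputable def X (a : F59) : G := (U.exists_X a).choose

theorem X_mem (a : F59) : U.X a ∈ U.P U.i := (U.exists_X a).choose_spec.1

theorem π_X (a : F59) : U.π (U.X a) = a := (U.exists_X a).choose_spec.2.1

theorem t_X (a : F59) : U.t * U.X a * U.t⁻¹ = (U.X a)⁻¹ := (U.exists_X a).choose_spec.2.2

theorem X_neg (a : F59) : U.X (-a) = (U.X a)⁻¹ := by
  refine U.eq_of_inverted (U.X_mem _) (inv_mem (U.X_mem _)) ?_ (U.t_X _) ?_
  · rw [U.π_inv (U.X_mem _), U.π_X, U.π_X]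
  · rw [← conj_inv, U.t_X]

theorem X_conj {h : G} (hh : h ∈ U.H) (a : F59) : h * U.X a * h⁻¹ = U.X (U.lam h * a) := by
  refine U.eq_of_inverted (U.conj_mem_P hh (U.X_mem _)) (U.X_mem _) ?_ ?_ (U.t_X _)
  · rw [U.π_conj_of_mem_A (U.mem_A_of_mem_H hh) (U.X_mem _), U.π_X, U.π_X]
  · have hc := (U.commute_t hh).eq
    have hc' := (U.commute_t hh).inv_inv.eq
    calc _ = (U.t * h) * U.X a * (h⁻¹ * U.t⁻¹) := by group
      _ = h * (U.t * U.X a * U.t⁻¹) * h⁻¹ := by rw [← hc, hc']; group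
      _ = _ := by rw [U.t_X]; group

/-- The central element with coordinate `b`. -/
def zb (b : ZMod 59) : G := U.z₁ ^ b.val

theorem zb_mem (b : ZMod 59) : U.zb b ∈ U.Z := pow_mem U.z₁_mem _

theorem zb_mem_P (b : ZMod 59) : U.zb b ∈ U.P U.i := U.Z_le (U.zb_mem b)

theorem ζ_zb (b : ZMod 59) : U.ζ (U.zb b) = b := by
  rw [zb, U.ζ_pow U.z₁_mem, U.ζ_z₁, mul_one, ZMod.natCast_zmod_val]

theorem zb_add (b c : ZMod 59) : U.zb (b + c) = U.zb b * U.zb c :=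
  U.ζ_inj _ (U.zb_mem _) _ (mul_mem (U.zb_mem _) (U.zb_mem _)) (by
    rw [U.ζ_mul _ (U.zb_mem _) _ (U.zb_mem _), ζ_zb, ζ_zb, ζ_zb])

theorem zb_neg (b : ZMod 59) : U.zb (-b) = (U.zb b)⁻¹ :=
  U.ζ_inj _ (U.zb_mem _) _ (inv_mem (U.zb_mem _)) (by
    rw [U.ζ_inv (U.zb_mem _), ζ_zb, ζ_zb])

theorem zb_zero : U.zb 0 = 1 := by simp [zb]

theorem zb_conj {h : G} (hh : h ∈ U.H) (b : ZMod 59) : h * U.zb b * h⁻¹ = U.zb (U.χ h * b) :=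
  U.ζ_inj _ (U.conj_mem_Z hh (U.zb_mem _)) _ (U.zb_mem _) (by
    rw [U.ζ_conj hh (U.zb_mem _), ζ_zb, ζ_zb])

theorem zb_comm (b : ZMod 59) {u : G} (hu : u ∈ U.P U.i) : U.zb b * u = u * U.zb b :=
  (U.commute_of_mem_Z (U.zb_mem b) hu).eq

/-- The cocycle of the extension `P i`. -/
noncomputable def B (a b : F59) : ZMod 59 := U.ζ ((U.X (a + b))⁻¹ * (U.X a * U.X b))

theorem X_mul (a b : F59) : U.X a * U.X b = U.X (a + b) * U.zb (U.B a b) := by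
  have hZ : (U.X (a + b))⁻¹ * (U.X a * U.X b) ∈ U.Z :=
    (U.inv_mul_mem_Z (U.X_mem _) (mul_mem (U.X_mem _) (U.X_mem _))).2 (by
      rw [U.π_mul _ (U.X_mem _) _ (U.X_mem _), π_X, π_X, π_X])
  rw [← inv_mul_eq_iff_eq_mul]
  exact U.ζ_inj _ hZ _ (U.zb_mem _) (U.ζ_zb _).symm

theorem X_mul_zb_inj {a : F59} {b c : ZMod 59} (h : U.X a * U.zb b = U.X a * U.zb c) : b = c := by
  rw [← U.ζ_zb b, mul_left_cancel h, U.ζ_zb]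

theorem B_antisymm (a b : F59) : U.B b a = -U.B a b := by
  refine U.X_mul_zb_inj (a := b + a) ?_
  have h1 : (U.X a)⁻¹ * (U.X b)⁻¹ = (U.X (a + b))⁻¹ * U.zb (U.B a b) := by
    have h2 : U.t * U.zb (U.B a b) * U.t⁻¹ = U.zb (U.B a b) :=
      mul_inv_eq_of_eq_mul (U.commute_t_of_mem_Z (U.zb_mem _)).symm.eq
    have := congrArg (fun g => U.t * g * U.t⁻¹) (U.X_mul a b)
    calc _ = U.t * (U.X a * U.X b) * U.t⁻¹ := by rw [← U.t_X, ← U.t_X]; group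
      _ = U.t * U.X (a + b) * U.t⁻¹ * (U.t * U.zb (U.B a b) * U.t⁻¹) := by rw [this]; group
      _ = _ := by rw [h2, U.t_X]
  have h3 := congrArg (·⁻¹) h1
  simp only [mul_inv_rev, inv_inv] at h3
  rw [← U.X_mul, h3, ← U.zb_neg, U.zb_comm _ (U.X_mem _), add_comm]

theorem B_cocycle (a b c : F59) : U.B (a + b) c + U.B a b = U.B a (b + c) + U.B b c := by
  refine U.X_mul_zb_inj (a := a + b + c) ?_
  rw [U.zb_add, U.zb_add, ← mul_assoc, ← mul_assoc, ← U.X_mul, add_assoc, ← U.X_mul, mul_assoc,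
    mul_assoc, ← U.zb_comm _ (U.X_mem _), ← mul_assoc, ← U.X_mul, ← U.X_mul, mul_assoc]

theorem B_add_right (a b c : F59) : U.B a (b + c) = U.B a b + U.B a c := by
  have h1 := U.B_cocycle a b c
  have h2 := U.B_cocycle b c a
  have h3 := U.B_cocycle c a b
  rw [U.B_antisymm c (a + b)] at h1
  rw [U.B_antisymm a (b + c)] at h2
  rw [U.B_antisymm b (c + a)] at h3
  rw [U.B_antisymm c a]
  have key : (2 : ZMod 59) ≠ 0 := by decide
  refine mul_left_cancel₀ key ?_
  linear_combination h3 - h1 - h2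

theorem B_smul_right (a b : F59) (c : ZMod 59) : U.B a (c • b) = c * U.B a b :=
  ZMod.map_smul (AddMonoidHom.mk' (U.B a) (U.B_add_right a)) c b

theorem B_eq (a b : F59) : U.B a b = U.B 1 ⟨0, 1⟩ * sym a b := by
  have hdec : ∀ b : F59, b = b.re • (1 : F59) + b.im • (⟨0, 1⟩ : F59) := fun b => by
    have h1 : (1 : F59).re = 1 := rfl
    have h2 : (1 : F59).im = 0 := rfl
    ext <;> simp [h1, h2]
  have hself : ∀ a, U.B a a = 0 := fun a => by
    have key : ∀ x : ZMod 59, x = -x → x = 0 := by decide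
    exact key _ (U.B_antisymm a a)
  have hl : ∀ a d : F59, U.B a d = a.re * U.B 1 d + a.im * U.B ⟨0, 1⟩ d := fun a d => by
    rw [U.B_antisymm d a]
    nth_rw 1 [hdec a]
    rw [U.B_add_right, U.B_smul_right, U.B_smul_right, U.B_antisymm 1 d, U.B_antisymm ⟨0, 1⟩ d]
    ring
  nth_rw 1 [hdec b]
  rw [U.B_add_right, U.B_smul_right, U.B_smul_right, hl a 1, hl a ⟨0, 1⟩, hself, hself,
    U.B_antisymm 1 ⟨0, 1⟩, sym]
  ring

theorem eq_zb_of_fix_t {q : Ω} (hq : U.t • q = q) (hi : q ≠ U.i) : ∃ b, q = U.zb b • U.o := by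
  obtain ⟨x, hx, rfl⟩ := U.exists_mem_smul_eq U.ne hi
  have hZ := U.mem_Z_of_commute_t hx ((U.smul_smul_o_eq_iff U.t_mem_H hx).1 hq).symm
  exact ⟨U.ζ x, by rw [U.ζ_inj x hZ _ (U.zb_mem _) (U.ζ_zb _).symm, U.ζ_zb]⟩

theorem P_smul_i {x : G} (hx : x ∈ U.P U.i) : x • U.i = U.i := U.fix _ _ hx

theorem eq_one_of_P_smul {x : G} (hx : x ∈ U.P U.i) {q : Ω} (hq : q ≠ U.i) (h : x • q = q) :
    x = 1 := U.free _ _ hq _ hx h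

theorem lam_z_ne : U.lam U.z ≠ 1 ∧ U.lam U.z ≠ -1 := by
  have h5 : U.lam U.z ^ 5 = 1 := by
    rw [← U.lam_pow (U.mem_A_of_mem_H U.z_mem), ← U.orderOf_z, pow_orderOf_eq_one, U.lam_one]
  refine ⟨fun h => ?_, fun h => ?_⟩
  · have h1 := U.lam_inj (U.mem_A_of_mem_H U.z_mem) (one_mem _) (by rw [h, U.lam_one])
    have := U.orderOf_z
    rw [h1, orderOf_one] at this
    norm_num at this
  · rw [h] at h5
    exact absurd h5 (by decide)

theorem χ_z : U.χ U.z = 1 :=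
  U.χ_eq_one U.z_mem fun _ hu => (U.mem_Z.1 hu).2.symm

theorem X_eq_one {a : F59} (h : U.X a = 1) : a = 0 := by rw [← U.π_X a, h, U.π_one]

/-- An involution fixing `o` and a second point in the orbit `X a • o`. -/
theorem exists_involution {a : F59} (ha : U.X a * U.X a ≠ 1) :
    ∃ s ∈ U.I, s • U.o = U.o ∧ s • (U.X a * U.X a) • U.o = (U.X a * U.X a) • U.o ∧
      ∃ b, s • U.i = (U.X a * U.zb b) • U.o := by
  have hX := U.X_mem a
  obtain ⟨r, hr⟩ : ∃ r, r = U.X a * U.t * (U.X a)⁻¹ := ⟨_, rfl⟩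
  have hr' : r = U.X a * U.X a * U.t := by
    have h1 : (U.X a)⁻¹⁻¹ = U.t * (U.X a)⁻¹ * U.t⁻¹ := by rw [← conj_inv, U.t_X]
    rw [inv_inv] at h1
    calc r = U.X a * (U.t * (U.X a)⁻¹ * U.t⁻¹) * U.t := by rw [hr]; group
      _ = _ := by rw [← h1]
  have hrI : r ∈ U.I := hr ▸ U.conj_mem_I U.t_mem_I _
  obtain ⟨q, hq⟩ : ∃ q, q = (U.X a * U.X a) • U.o := ⟨_, rfl⟩
  have hqo : q ≠ U.o := fun h => ha (U.eq_one_of_P_smul (mul_mem hX hX) U.ne (hq ▸ h))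
  have hri : r • U.i = U.i := by
    rw [hr', mul_smul, U.t_i, U.P_smul_i (mul_mem hX hX)]
  have hro : r • U.o = q := by rw [hr', mul_smul, U.t_o, hq]
  have hrq : r • q = U.o := by rw [← hro, ← mul_smul, ← sq, U.sq_of_mem_I hrI, one_smul]
  obtain ⟨g, hg1, hg2⟩ := U.exists_smul_eq_smul_eq U.ne.symm hqo.symm
  obtain ⟨s, hs⟩ : ∃ s, s = g * U.t * g⁻¹ := ⟨_, rfl⟩
  have hsI : s ∈ U.I := hs ▸ U.conj_mem_I U.t_mem_I _
  have hso : s • U.o = U.o := by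
    rw [hs, ← hg1, ← mul_smul, inv_mul_cancel_right, mul_smul, U.t_i]
  have hsq : s • q = q := by
    rw [hs, ← hg2, ← mul_smul, inv_mul_cancel_right, mul_smul, U.t_o]
  have hrinv := U.inv_of_mem_I hrI
  have hcomm : Commute r s := mul_inv_eq_iff_eq_mul.1 <|
    U.eq_of_mem_I (U.conj_mem_I hsI r) hsI hqo.symm
      (by rw [hrinv, mul_smul, mul_smul, hro, hsq, hrq])
      (by rw [hrinv, mul_smul, mul_smul, hrq, hso, hro]) hso hsq
  have hne : s ≠ r := fun h => hqo (by rw [← hro, ← h, hso])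
  have hsi : s • U.i ≠ U.i := fun h => U.disjoint_fix hsI hrI hcomm.symm hne h hri
  have hfix : U.t • (U.X a)⁻¹ • s • U.i = (U.X a)⁻¹ • s • U.i := by
    have h1 : r • s • U.i = s • U.i := by rw [← mul_smul, hcomm.eq, mul_smul, hri]
    rw [hr, mul_smul, mul_smul] at h1
    nth_rw 2 [← h1]
    rw [inv_smul_smul]
  have hne' : (U.X a)⁻¹ • s • U.i ≠ U.i := fun h => hsi (by
    rw [inv_smul_eq_iff, U.P_smul_i hX] at h
    exact h)
  obtain ⟨b, hb⟩ := U.eq_zb_of_fix_t hfix hne'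
  exact ⟨s, hsI, hso, hq ▸ hsq, b, by rw [mul_smul, ← hb, smul_inv_smul]⟩

theorem B_ne_zero : U.B 1 ⟨0, 1⟩ ≠ 0 := by
  intro hk
  have hadd : ∀ a b, U.X a * U.X b = U.X (a + b) := fun a b => by
    rw [U.X_mul, U.B_eq, hk, zero_mul, U.zb_zero, mul_one]
  obtain ⟨s, hs, hso, hsq, b, hb⟩ := U.exists_involution (a := 1) (by
    rw [hadd]
    exact fun h => absurd (U.X_eq_one h) (by decide))
  obtain ⟨u, hu⟩ : ∃ u, u = U.X 1 * U.zb b := ⟨_, rfl⟩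
  rw [← hu] at hb
  have huP : u ∈ U.P U.i := hu ▸ mul_mem (U.X_mem _) (U.zb_mem_P _)
  obtain ⟨s₀, hs₀⟩ : ∃ s₀, s₀ = u⁻¹ * s * u := ⟨_, rfl⟩
  have hs₀I : s₀ ∈ U.I := by
    have := U.conj_mem_I hs u⁻¹
    rwa [inv_inv, ← hs₀] at this
  have h0i : s₀ • U.i = U.o := by
    rw [hs₀, mul_smul, mul_smul, U.P_smul_i huP, hb, inv_smul_smul]
  have h0o : s₀ • U.o = U.i := by
    rw [← h0i, ← mul_smul, ← sq, U.sq_of_mem_I hs₀I, one_smul]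
  have hc0 := U.commute_of_commute_t (U.commute_t_of_swap h0i h0o) U.z_mem U.χ_z
  have hcz : Commute (U.zb b) U.z := (U.mem_Z.1 (U.zb_mem b)).2
  obtain ⟨s₁, hs₁⟩ : ∃ s₁, s₁ = U.zb b * s₀ * (U.zb b)⁻¹ := ⟨_, rfl⟩
  have hs₁' : s₁ = (U.X 1)⁻¹ * s * U.X 1 := by
    rw [hs₁, hs₀, hu]
    group
  have hs₁I : s₁ ∈ U.I := hs₁ ▸ U.conj_mem_I hs₀I _
  have hc1 : Commute U.z s₁ := hs₁ ▸ ((hcz.mul_left hc0).mul_left hcz.inv_left).symm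
  have hfp : s₁ • U.X 1 • U.o = U.X 1 • U.o := by
    rw [hs₁', mul_smul, mul_smul, ← mul_smul (U.X 1) (U.X 1), hsq, ← mul_smul,
      inv_mul_cancel_left]
  have hfm : s₁ • U.X (-1) • U.o = U.X (-1) • U.o := by
    rw [hs₁', U.X_neg, ← mul_smul, mul_inv_cancel_right, mul_smul, hso]
  have hz : ∀ a, s₁ • U.X a • U.o = U.X a • U.o →
      s₁ • U.X (U.lam U.z * a) • U.o = U.X (U.lam U.z * a) • U.o := by
    intro a ha
    have hzo : U.z⁻¹ • U.o = U.o := inv_smul_eq_iff.2 (U.mem_H.1 U.z_mem).2.symm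
    rw [← U.X_conj U.z_mem, mul_smul, mul_smul, hzo, ← mul_smul, ← hc1.eq, mul_smul, ha]
  set μ := U.lam U.z
  have e1 : U.X 1 * s₁ * (U.X 1)⁻¹ = U.X μ * s₁ * (U.X μ)⁻¹ := by
    have h1 := hz 1 hfp
    have h2 := hz (-1) hfm
    rw [mul_one] at h1
    rw [mul_neg, mul_one] at h2
    have hne : U.o ≠ U.X (1 + μ) • U.o := fun h =>
      U.lam_z_ne.2 (by
        have := U.X_eq_one (U.eq_one_of_P_smul (U.X_mem _) U.ne h.symm)
        exact (neg_eq_of_add_eq_zero_right this).symm)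
    refine U.eq_of_mem_I (U.conj_mem_I hs₁I _) (U.conj_mem_I hs₁I _) hne ?_ ?_ ?_ ?_
    · rw [← U.X_neg, mul_smul, mul_smul, hfm, ← mul_smul, U.X_neg, mul_inv_cancel, one_smul]
    · rw [← hadd, mul_smul, mul_smul, mul_smul, inv_smul_smul, h1]
    · rw [← U.X_neg, mul_smul, mul_smul, h2, ← mul_smul, U.X_neg, mul_inv_cancel, one_smul]
    · rw [add_comm, ← hadd, mul_smul, mul_smul, mul_smul, inv_smul_smul, hfp]
  have e2 : U.X (-μ + 1) * s₁ = s₁ * U.X (-μ + 1) := by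
    rw [← hadd, U.X_neg]
    have := congrArg (fun g => (U.X μ)⁻¹ * g * U.X 1) e1
    simp only [mul_assoc, inv_mul_cancel, mul_one, inv_mul_cancel_left] at this ⊢
    exact this
  have h1i : s₁ • U.i ≠ U.i := by
    have h2 : (U.zb b)⁻¹ • U.i = U.i := U.P_smul_i (inv_mem (U.zb_mem_P b))
    rw [hs₁, mul_smul, mul_smul, h2, h0i]
    exact U.smul_o_ne (U.zb_mem_P b)
  have h3 := U.X_eq_one (U.eq_one_of_P_smul (U.X_mem (-μ + 1)) h1i (by
    rw [← mul_smul, e2, mul_smul, U.P_smul_i (U.X_mem _)]))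
  exact U.lam_z_ne.1 (by rw [neg_add_eq_zero] at h3; exact h3)

end UW

/-- Coordinates `al a b` on the Sylow subgroup `P i`. -/
structure UC (G Ω : Type*) [Group G] [MulAction G Ω] [Finite G] [Finite Ω] extends UW G Ω where
  al : F59 → ZMod 59 → G
  al_mem : ∀ a b, al a b ∈ P i
  al_surj : ∀ x ∈ P i, ∃ a b, x = al a b
  al_inj : ∀ a b a' b', al a b = al a' b' → a = a' ∧ b = b'
  al_mul : ∀ a b a' b', al a b * al a' b' = al (a + a') (b + b' + 2 * sym a a')
  al_conj : ∀ h ∈ toUPair.H, ∀ a b, h * al a b * h⁻¹ = al (lam h * a) (nrm (lam h) * b)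
  mem_Z_al : ∀ b, al 0 b ∈ toUElt.Z

theorem UW.χ_eq_nrm {G Ω : Type*} [Group G] [MulAction G Ω] [Finite G] [Finite Ω]
    (U : UW G Ω) {h : G} (hh : h ∈ U.H) : U.χ h = nrm (U.lam h) := by
  have h1 : ∀ a b, U.B (U.lam h * a) (U.lam h * b) = U.χ h * U.B a b := fun a b => by
    refine U.X_mul_zb_inj (a := U.lam h * a + U.lam h * b) ?_
    rw [← U.X_mul, ← U.X_conj hh, ← U.X_conj hh, ← mul_add, ← U.X_conj hh, ← U.zb_conj hh]
    calc _ = h * (U.X a * U.X b) * h⁻¹ := by group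
      _ = _ := by rw [U.X_mul]; group
  have h2 := h1 1 ⟨0, 1⟩
  rw [U.B_eq (U.lam h * 1)] at h2
  have h3 : sym (U.lam h * 1) (U.lam h * ⟨0, 1⟩) = nrm (U.lam h) := by
    simp [sym, nrm]
  rw [h3, mul_comm] at h2
  exact (mul_right_cancel₀ U.B_ne_zero h2).symm

theorem UW.nonempty_uC {G Ω : Type*} [Group G] [MulAction G Ω] [Finite G] [Finite Ω]
    (U : UW G Ω) : Nonempty (UC G Ω) := by
  obtain ⟨k, hk⟩ : ∃ k, k = U.B 1 ⟨0, 1⟩ := ⟨_, rfl⟩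
  have hk0 : k ≠ 0 := hk ▸ U.B_ne_zero
  have hk2 : k / 2 ≠ 0 := div_ne_zero hk0 (by decide)
  have h2 : (2 : ZMod 59) ≠ 0 := by decide
  refine ⟨{ U with
    al := fun a b => U.X a * U.zb (k / 2 * b)
    al_mem := fun a b => mul_mem (U.X_mem _) (U.zb_mem_P _)
    al_surj := fun x hx => ?_
    al_inj := fun a b a' b' h => ?_
    al_mul := fun a b a' b' => ?_
    al_conj := fun h hh a b => ?_
    mem_Z_al := fun b => ?_ }⟩
  · have hZ := (U.inv_mul_mem_Z (U.X_mem (U.π x)) hx).2 (U.π_X _)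
    refine ⟨U.π x, (k / 2)⁻¹ * U.ζ ((U.X (U.π x))⁻¹ * x), ?_⟩
    rw [mul_inv_cancel_left₀ hk2, ← inv_mul_eq_iff_eq_mul]
    exact U.ζ_inj _ hZ _ (U.zb_mem _) (U.ζ_zb _).symm
  · have h1 := congrArg U.π h
    simp only [U.π_mul _ (U.X_mem _) _ (U.zb_mem_P _), U.π_X,
      (U.π_eq_zero _ (U.zb_mem_P _)).2 (U.zb_mem _), add_zero] at h1
    subst h1
    exact ⟨rfl, mul_left_cancel₀ hk2 (U.X_mul_zb_inj h)⟩
  · have h3 : U.X a * U.zb (k / 2 * b) * (U.X a' * U.zb (k / 2 * b')) =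
        U.X a * U.X a' * (U.zb (k / 2 * b) * U.zb (k / 2 * b')) := by
      rw [mul_assoc, ← mul_assoc (U.zb _), U.zb_comm _ (U.X_mem a')]
      group
    rw [h3, U.X_mul, mul_assoc, ← U.zb_add, ← U.zb_add, U.B_eq, ← hk]
    congr 2
    field_simp
    ring
  · have h3 : h * (U.X a * U.zb (k / 2 * b)) * h⁻¹ =
      (h * U.X a * h⁻¹) * (h * U.zb (k / 2 * b) * h⁻¹) := by group
    rw [h3, U.X_conj hh, U.zb_conj hh, U.χ_eq_nrm hh]
    congr 2
    ring
  · have h0 : U.X 0 = 1 := by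
      refine U.eq_of_inverted (U.X_mem _) (one_mem _) ?_ (U.t_X _) (by simp)
      rw [U.π_X, U.π_one]
    rw [h0, one_mul]
    exact U.zb_mem _

theorem nrm_mul (a b : F59) : nrm (a * b) = nrm a * nrm b := by
  simp only [nrm, QuadraticAlgebra.re_mul, QuadraticAlgebra.im_mul]
  ring

theorem nrm_ne_zero {a : F59} (ha : a ≠ 0) : nrm a ≠ 0 := by
  intro h
  have key : ∀ x y : ZMod 59, x * x + y * y = 0 → x = 0 ∧ y = 0 := by decide +kernel
  obtain ⟨h1, h2⟩ := key _ _ h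
  exact ha (QuadraticAlgebra.ext h1 h2)

theorem F59_pow_card {a : F59} (ha : a ≠ 0) : a ^ 3480 = 1 := by
  have : Fintype F59 := Fintype.ofFinite _
  have h := FiniteField.pow_card_sub_one_eq_one a ha
  rwa [← Nat.card_eq_fintype_card, card_F59] at h

theorem cube_pow {a : F59} (ha : a ≠ 0) : (a * a * a) ^ 1160 = 1 := by
  rw [← F59_pow_card ha]
  ring

namespace Rigid

/-- A non-cube in `F59`. -/
def g : F59 := ⟨1, 2⟩

def slopes : List ℕ :=
  [0, 1, 4, 8, 15, 18, 22, 23, 24, 27, 32, 35, 36, 37, 41, 44, 51, 55, 58]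

def quot₀ : List (ℕ × ℕ) := [(3, 11), (11, 56), (51, 19), (12, 35), (19, 8), (46, 43)]

def quot₁ : List (ℕ × ℕ) :=
  [(45, 51), (51, 14), (48, 32), (12, 36), (32, 11), (29, 3), (56, 29)]

def value (r : ℕ) (q : ℕ × ℕ) (s : ℕ) : ℕ :=
  (s * (r * r * (q.1 * q.1 + q.2 * q.2) + 57 * (r * q.1) + 1) + 57 * (r * q.2)) % 59

def maskFold {α : Type} (f : α → ℕ) : List α → ℕ
  | [] => 0
  | x :: l => f x ||| maskFold f l

theorem testBit_maskFold {α : Type} (f : α → ℕ) (n : ℕ) (l : List α)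
    (h : (maskFold f l).testBit n = true) : ∃ x ∈ l, (f x).testBit n = true := by
  induction l with
  | nil => simp [maskFold] at h
  | cons x l ih =>
    rw [maskFold, Nat.testBit_or, Bool.or_eq_true] at h
    rcases h with h | h
    · exact ⟨x, by simp, h⟩
    · obtain ⟨y, hy, h⟩ := ih h
      exact ⟨y, by simp [hy], h⟩

def mask (l : List (ℕ × ℕ)) (r : ℕ) : ℕ :=
  maskFold (fun q => maskFold (fun s => 2 ^ value r q s) slopes) l

theorem exists_value {l : List (ℕ × ℕ)} {r n : ℕ} (h : (mask l r).testBit n = true) :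
    ∃ q ∈ l, ∃ s ∈ slopes, value r q s = n := by
  obtain ⟨q, hq, h⟩ := testBit_maskFold _ _ _ h
  obtain ⟨s, hs, h⟩ := testBit_maskFold _ _ _ h
  rw [Nat.testBit_two_pow, decide_eq_true_eq] at h
  exact ⟨q, hq, s, hs, h⟩

def check (l : List (ℕ × ℕ)) (c r : ℕ) : Bool :=
  Nat.beq (mask l r ||| mask l (59 - r) |||
    (if Nat.beq (c * (r * r) % 59) 1 || Nat.beq (c * (r * r) % 59) 58 then 1 else 0)) (2 ^ 59 - 1)

theorem check_quot₀ : ∀ r ∈ List.range 29, check quot₀ 12 (r + 1) = true := by decide +kernel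

theorem check_quot₁ : ∀ r ∈ List.range 29, check quot₁ 24 (r + 1) = true := by decide +kernel

theorem cube_roots :
    (∀ q ∈ quot₀, 12 = nrm ⟨q.1, q.2⟩ ∧
      ∃ v ∈ [(3, 46), (10, 45), (5, 34), (1, 0), (15, 37), (14, 49)],
        g * ⟨q.1, q.2⟩ = (⟨v.1, v.2⟩ : F59) * ⟨v.1, v.2⟩ * ⟨v.1, v.2⟩) ∧
    ∀ q ∈ quot₁, 24 = nrm ⟨q.1, q.2⟩ ∧
      ∃ v ∈ [(3, 18), (22, 47), (7, 15), (11, 34), (28, 32), (22, 12), (12, 37)],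
        g * ⟨q.1, q.2⟩ = (⟨v.1, v.2⟩ : F59) * ⟨v.1, v.2⟩ * ⟨v.1, v.2⟩ := by
  decide +kernel

theorem slope_roots : ∀ s ∈ slopes,
    ∃ k ∈ [(30, 24), (0, 1), (22, 44), (3, 46), (5, 34), (34, 5), (14, 10), (15, 37), (23, 48),
      (10, 45), (10, 14), (23, 11), (15, 22), (14, 49), (34, 54), (5, 25), (3, 13), (22, 15),
      (0, 58)],
      (⟨k.1, k.2⟩ : F59) * ⟨k.1, k.2⟩ * ⟨k.1, k.2⟩ * ⟨-1, s⟩ = ⟨1, s⟩ := by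
  decide +kernel

theorem g_pow : g ^ 1160 = ⟨29, 35⟩ := by decide +kernel

theorem g_ne_zero : g ≠ 0 := by decide

theorem exists_witness_of_check {l : List (ℕ × ℕ)} {c : ℕ} {r : ZMod 59} {ε : ZMod 59}
    (hc : ∀ r ∈ List.range 29, check l c (r + 1) = true) (hr : r ≠ 0)
    (hε : (c : ZMod 59) * (r * r) = 1 ∨ (c : ZMod 59) * (r * r) = -1 → ε ≠ 0) :
    ∃ q ∈ l, ∃ s ∈ slopes, ∃ r' : ZMod 59, (r' = r ∨ r' = -r) ∧
      (s : ZMod 59) * (r * r * (q.1 * q.1 + q.2 * q.2) - 2 * (r' * q.1) + 1) - 2 * (r' * q.2) = ε := by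
  obtain ⟨m, hm, hmr⟩ : ∃ m ∈ List.range 29, r = ((m + 1 : ℕ) : ZMod 59) ∨
      -r = ((m + 1 : ℕ) : ZMod 59) := by
    clear hε
    revert r
    decide +kernel
  have h1 := Nat.eq_of_beq_eq_true (hc m hm)
  have hrr : r * r = ((m + 1 : ℕ) : ZMod 59) * ((m + 1 : ℕ) : ZMod 59) := by
    rcases hmr with h | h
    · rw [← h]
    · rw [← h, neg_mul_neg]
  have hrr' : (c : ZMod 59) * (r * r) = ((c * ((m + 1) * (m + 1)) % 59 : ℕ) : ZMod 59) := by
    rw [ZMod.natCast_mod, hrr]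
    push_cast
    ring
  have hval : ε.val < 59 := ZMod.val_lt ε
  have h2 : (2 ^ 59 - 1).testBit ε.val = true := by
    rw [Nat.testBit_two_pow_sub_one]
    simpa using hval
  rw [← h1, Nat.testBit_or, Nat.testBit_or, Bool.or_eq_true, Bool.or_eq_true] at h2
  have hfin : ∀ r₀ : ℕ, ((r₀ : ZMod 59) = r ∨ (r₀ : ZMod 59) = -r) →
      (mask l r₀).testBit ε.val = true → ∃ q ∈ l, ∃ s ∈ slopes, ∃ r' : ZMod 59,
      (r' = r ∨ r' = -r) ∧ (s : ZMod 59) * (r * r * (q.1 * q.1 + q.2 * q.2) - 2 * (r' * q.1) + 1) -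
        2 * (r' * q.2) = ε := by
    intro r₀ hr₀ h
    obtain ⟨q, hq, s, hs, h⟩ := exists_value h
    refine ⟨q, hq, s, hs, r₀, hr₀, ?_⟩
    have h3 := congrArg (Nat.cast : ℕ → ZMod 59) h
    rw [value, ZMod.natCast_mod, ZMod.natCast_zmod_val] at h3
    push_cast at h3
    have e57 : (57 : ZMod 59) = -2 := by decide
    rw [e57] at h3
    have h4 : r * r = (r₀ : ZMod 59) * r₀ := by
      rcases hr₀ with h | h <;> rw [h]
      rw [neg_mul_neg]
    rw [← h3, h4]
    ring
  rcases h2 with (h2 | h2) | h2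
  · refine hfin _ ?_ h2
    rcases hmr with h | h
    · exact .inl h.symm
    · exact .inr h.symm
  · refine hfin _ ?_ h2
    have h59 : ((59 - (m + 1) : ℕ) : ZMod 59) = -((m + 1 : ℕ) : ZMod 59) := by
      have : m < 29 := List.mem_range.1 hm
      rw [Nat.cast_sub (by omega), sub_eq_neg_self.2 (by rfl)]
    rw [h59]
    rcases hmr with h | h
    · exact .inr (by rw [← h])
    · exact .inl (by rw [← h, neg_neg])
  · exfalso
    split_ifs at h2 with h
    · rw [Bool.or_eq_true] at h
      have h3 : ε ≠ 0 := by
        refine hε ?_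
        rw [hrr']
        rcases h with h | h
        · left; rw [Nat.eq_of_beq_eq_true h, Nat.cast_one]
        · right; rw [Nat.eq_of_beq_eq_true h]; rfl
      rw [Nat.testBit_one_eq_true_iff_self_eq_zero] at h2
      exact h3 ((ZMod.val_eq_zero ε).1 h2)
    · simp at h2

theorem exists_witness {ρ ε : ZMod 59} (hρ : ρ ≠ 0) (hε : ρ = 1 ∨ ρ = -1 → ε ≠ 0) :
    ∃ q : F59, ∃ s : ZMod 59, nrm q = ρ ∧ (g * q) ^ 1160 = 1 ∧
      (∃ h : F59, h ^ 1160 = 1 ∧ h * ⟨-1, s⟩ = ⟨1, s⟩) ∧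
      ε + 2 * q.im = s * nrm (q - 1) := by
  have hs : ∀ s ∈ slopes, ∃ h : F59, h ^ 1160 = 1 ∧ h * ⟨-1, s⟩ = ⟨1, s⟩ := by
    intro s hs
    obtain ⟨k, -, hk⟩ := slope_roots s hs
    refine ⟨_, cube_pow ?_, hk⟩
    intro h
    rw [h] at hk
    simp only [mul_zero, zero_mul] at hk
    exact zero_ne_one (congrArg QuadraticAlgebra.re hk)
  have hreal : ∀ r : ZMod 59, r ≠ 0 → (⟨r, 0⟩ : F59) ^ 1160 = 1 := by
    intro r hr
    have h1 : (⟨r, 0⟩ : F59) = algebraMap (ZMod 59) F59 r := rfl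
    rw [h1, ← map_pow, show 1160 = 58 * 20 by norm_num, pow_mul, ZMod.pow_card_sub_one_eq_one hr,
      one_pow, map_one]
  have main : ∀ (l : List (ℕ × ℕ)) (c : ℕ) (r : ZMod 59),
      (∀ r ∈ List.range 29, check l c (r + 1) = true) → r ≠ 0 →
      (∀ q ∈ l, (c : ZMod 59) = nrm ⟨q.1, q.2⟩ ∧ ∃ v : F59, v ≠ 0 ∧ g * ⟨q.1, q.2⟩ = v * v * v) →
      ρ = c * (r * r) → ∃ q : F59, ∃ s : ZMod 59, nrm q = ρ ∧ (g * q) ^ 1160 = 1 ∧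
      (∃ h : F59, h ^ 1160 = 1 ∧ h * ⟨-1, s⟩ = ⟨1, s⟩) ∧ ε + 2 * q.im = s * nrm (q - 1) := by
    intro l c r hc hr hl hρr
    obtain ⟨q, hq, s, hs', r', hr', e⟩ := exists_witness_of_check hc hr (hρr ▸ hε)
    obtain ⟨h1, v, hv, h2⟩ := hl q hq
    have hrr : r' * r' = r * r := by rcases hr' with h | h <;> rw [h]; rw [neg_mul_neg]
    have hr0 : r' ≠ 0 := by
      rintro rfl
      rw [zero_mul] at hrr
      exact hr (mul_self_eq_zero.1 hrr.symm)
    refine ⟨⟨r' * q.1, r' * q.2⟩, s, ?_, ?_, hs s hs', ?_⟩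
    · rw [hρr, h1, ← hrr]
      simp only [nrm]
      ring
    · have h3 : (⟨r' * q.1, r' * q.2⟩ : F59) = ⟨r', 0⟩ * ⟨q.1, q.2⟩ := by
        ext <;> simp
      rw [h3, mul_left_comm, h2, mul_pow, hreal _ hr0, cube_pow hv, one_mul]
    · have h4 : nrm (⟨r' * q.1, r' * q.2⟩ - 1) =
          (r' * q.1 - 1) * (r' * q.1 - 1) + (r' * q.2 - 0) * (r' * q.2 - 0) := rfl
      rw [h4, ← e, ← hrr]
      ring
  have hsq : ∀ ρ : ZMod 59, ρ ≠ 0 → ∃ r : ZMod 59, r ≠ 0 ∧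
      (ρ = (12 : ℕ) * (r * r) ∨ ρ = (24 : ℕ) * (r * r)) := by decide +kernel
  have hv : ∀ (v : ZMod 59 × ZMod 59) (q : ℕ × ℕ), nrm ⟨q.1, q.2⟩ ≠ 0 →
      g * ⟨q.1, q.2⟩ = (⟨v.1, v.2⟩ : F59) * ⟨v.1, v.2⟩ * ⟨v.1, v.2⟩ → (⟨v.1, v.2⟩ : F59) ≠ 0 := by
    intro v q hq e h
    rw [h, mul_zero] at e
    rcases mul_eq_zero.1 e with h1 | h1
    · exact g_ne_zero h1
    · rw [h1] at hq
      exact hq (by decide)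
  obtain ⟨r, hr, h | h⟩ := hsq ρ hρ
  · refine main quot₀ 12 r check_quot₀ hr (fun q hq => ?_) h
    obtain ⟨h1, v, -, h2⟩ := cube_roots.1 q hq
    exact ⟨h1, _, hv v q (h1 ▸ by decide) h2, h2⟩
  · refine main quot₁ 24 r check_quot₁ hr (fun q hq => ?_) h
    obtain ⟨h1, v, -, h2⟩ := cube_roots.2 q hq
    exact ⟨h1, _, hv v q (h1 ▸ by decide) h2, h2⟩

end Rigid

theorem sym_mul (c a b : F59) : sym (c * a) (c * b) = nrm c * sym a b := by
  simp only [nrm, sym, QuadraticAlgebra.re_mul, QuadraticAlgebra.im_mul]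
  ring

theorem nrm_one : nrm 1 = 1 := by decide

theorem sym_one (q : F59) : sym q 1 = -q.im := by
  have h1 : (1 : F59).re = 1 := rfl
  have h2 : (1 : F59).im = 0 := rfl
  simp [sym, h1, h2]

namespace Rigid

theorem nrm_g : nrm g = 5 := by decide

theorem ne_zero_of_pow {h : F59} (hh : h ^ 1160 = 1) : h ≠ 0 := by
  rintro rfl
  rw [zero_pow (by norm_num)] at hh
  exact zero_ne_one hh

theorem g_pow_ne_one : g ^ 1160 ≠ 1 := by
  rw [g_pow]
  decide

theorem exists_cube_mul {a : F59} (ha : a ≠ 0) :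
    ∃ h : F59, h ^ 1160 = 1 ∧ (a = h ∨ a = h * g ∨ a = h * (g * g)) := by
  have h3 : (a ^ 1160) ^ 3 = 1 := by rw [← pow_mul, F59_pow_card ha]
  have e1 : (⟨29, 35⟩ : F59) + ⟨29, 35⟩ * ⟨29, 35⟩ = -1 := by decide
  have e3 : (⟨29, 35⟩ : F59) * (⟨29, 35⟩ * ⟨29, 35⟩) = 1 := by decide
  have hg := g_pow
  generalize (⟨29, 35⟩ : F59) = ω at e1 e3 hg
  have h4 : (a ^ 1160 - 1) * ((a ^ 1160 - ω) * (a ^ 1160 - ω * ω)) = 0 := by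
    generalize a ^ 1160 = x at h3
    linear_combination h3 - (x ^ 2 - x) * e1 + (x - 1) * e3
  have hg0 := g_ne_zero
  rcases mul_eq_zero.1 h4 with h | h
  · exact ⟨a, sub_eq_zero.1 h, .inl rfl⟩
  rcases mul_eq_zero.1 h with h | h
  · refine ⟨a / g, ?_, .inr (.inl (div_mul_cancel₀ _ hg0).symm)⟩
    rw [div_pow, sub_eq_zero.1 h, hg, div_self]
    rw [← hg]
    exact pow_ne_zero _ hg0
  · refine ⟨a / (g * g), ?_, .inr (.inr (div_mul_cancel₀ _ (mul_ne_zero hg0 hg0)).symm)⟩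
    rw [div_pow, sub_eq_zero.1 h, mul_pow, hg, div_self]
    rw [← hg]
    exact mul_ne_zero (pow_ne_zero _ hg0) (pow_ne_zero _ hg0)

/-- The constraints satisfied by the coordinates of the involutions that fix `o`. -/
structure Data (lam z : F59 → ZMod 59) : Prop where
  lam_ne : ∀ a ≠ 0, lam a ≠ 0
  lam_mul : ∀ h a, h ^ 1160 = 1 → a ≠ 0 → lam (h * a) = nrm h * lam a
  z_mul : ∀ h a, h ^ 1160 = 1 → a ≠ 0 → z (h * a) = nrm h * z a
  collision : ∀ a a' d d', a ≠ 0 → a' ≠ 0 → d ≠ 0 → d' ≠ 0 → a - a' = d - d' → a ≠ a' →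
    lam a = lam a' → lam d = lam d' →
    z a - z a' - 2 * sym a a' = z d - z d' - 2 * sym d d' → a = d

namespace Data

variable {lam z : F59 → ZMod 59}

theorem lam_g_mul (D : Data lam z) {a : F59} (ha : a ≠ 0) :
    (lam (g * a) = 5 * lam a ∨ lam (g * a) = -(5 * lam a)) ∧
      z (g * a) * lam a = lam (g * a) * z a := by
  have h5 : (5 : ZMod 59) ≠ 0 := by decide
  have hga := mul_ne_zero g_ne_zero ha
  have hla := D.lam_ne a ha
  have hna := nrm_ne_zero ha
  obtain ⟨ρ, hρ⟩ : ∃ ρ, ρ = lam (g * a) / (5 * lam a) := ⟨_, rfl⟩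
  have hρ0 : ρ ≠ 0 := by
    rw [hρ]
    exact div_ne_zero (D.lam_ne _ hga) (mul_ne_zero h5 hla)
  have hρ' : lam (g * a) = 5 * ρ * lam a := by
    rw [hρ]
    field_simp
  obtain ⟨ε, hε⟩ : ∃ ε, ε = (5 * ρ * z a - z (g * a)) / (5 * nrm a) := ⟨_, rfl⟩
  have hε' : 5 * nrm a * ε = 5 * ρ * z a - z (g * a) := by
    rw [hε]
    field_simp
  by_cases hc : (ρ = 1 ∨ ρ = -1) ∧ ε = 0
  · obtain ⟨h1, h2⟩ := hc
    rw [h2, mul_zero] at hε'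
    refine ⟨?_, ?_⟩
    · rw [hρ']
      rcases h1 with rfl | rfl
      · left; ring
      · right; ring
    · rw [hρ']
      linear_combination lam a * hε'
  · exfalso
    obtain ⟨q, s, hq, hgq, ⟨h, hh, hs⟩, e⟩ := exists_witness (ε := ε) hρ0 (fun h1 h2 => hc ⟨h1, h2⟩)
    have hq1 : q - 1 ≠ 0 := fun h1 => g_pow_ne_one (by
      rw [sub_eq_zero.1 h1, mul_one] at hgq
      exact hgq)
    have hgq0 : g * q * a ≠ 0 := mul_ne_zero (ne_zero_of_pow hgq) ha
    obtain ⟨c, hcdef⟩ : ∃ c : F59, c = ⟨30, 0⟩ * ((q - 1) * (g * a)) := ⟨_, rfl⟩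
    have hc0 : c ≠ 0 := hcdef ▸ mul_ne_zero (by decide) (mul_ne_zero hq1 hga)
    have hs1 : (⟨1, -s⟩ : F59) ≠ 0 := fun h1 => one_ne_zero (congrArg QuadraticAlgebra.re h1)
    have hs2 : (⟨-1, -s⟩ : F59) = h * ⟨1, -s⟩ := by
      have e1 : (⟨1, -s⟩ : F59) = -⟨-1, s⟩ := by ext <;> simp
      have e2 : (⟨-1, -s⟩ : F59) = -⟨1, s⟩ := by ext <;> simp
      rw [e1, e2, ← hs, mul_neg]
    have hd : c * ⟨1, -s⟩ ≠ 0 := mul_ne_zero hc0 hs1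
    have hd' : c * ⟨-1, -s⟩ = h * (c * ⟨1, -s⟩) := by rw [hs2, mul_left_comm]
    have hnh : nrm h = 1 := by
      have h1 := congrArg nrm hs2
      have h2 : nrm (⟨-1, -s⟩ : F59) = nrm ⟨1, -s⟩ := by simp only [nrm]; ring
      rw [nrm_mul, h2] at h1
      exact (mul_eq_right₀ (nrm_ne_zero hs1)).1 h1.symm
    have hdd : c * ⟨1, -s⟩ - c * ⟨-1, -s⟩ = (q - 1) * (g * a) := by
      have e1 : (⟨1, -s⟩ : F59) - ⟨-1, -s⟩ = ⟨2, 0⟩ := by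
        ext
        · rw [QuadraticAlgebra.re_sub]; norm_num
        · rw [QuadraticAlgebra.im_sub]; simp
      have e2 : (⟨30, 0⟩ : F59) * ⟨2, 0⟩ = 1 := by decide
      rw [← mul_sub, e1, hcdef, mul_right_comm, e2, one_mul]
    have key := D.collision (g * q * a) (g * a) (c * ⟨1, -s⟩) (c * ⟨-1, -s⟩) hgq0 hga hd
      (hd' ▸ mul_ne_zero (ne_zero_of_pow hh) hd) (by rw [hdd]; ring)
      (fun h1 => hq1 (by
        have h2 : (q - 1) * (g * a) = 0 := by linear_combination h1
        exact (mul_eq_zero.1 h2).resolve_right hga))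
      (by rw [D.lam_mul _ _ hgq ha, nrm_mul, nrm_g, hq, hρ'])
      (by rw [hd', D.lam_mul _ _ hh hd, hnh, one_mul])
      (by
        have e1 : sym (g * q * a) (g * a) = -(5 * nrm a * q.im) := by
          rw [show g * q * a = g * a * q by ring]
          nth_rw 2 [← mul_one (g * a)]
          rw [sym_mul, sym_one, nrm_mul, nrm_g, mul_neg]
        have e2 : sym (c * ⟨1, -s⟩) (c * ⟨-1, -s⟩) = 5 * nrm a * nrm (q - 1) * (-2 * s) * 15 := by
          have e3 : nrm c = 15 * (nrm (q - 1) * (5 * nrm a)) := by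
            rw [hcdef, nrm_mul, nrm_mul, nrm_mul, nrm_g]
            congr 1
          rw [sym_mul, e3]
          simp only [sym]
          ring
        rw [e1, e2, D.z_mul _ _ hgq ha, nrm_mul, nrm_g, hq, hd', D.z_mul _ _ hh hd, hnh]
        have e60 : (60 : ZMod 59) = 1 := by decide
        linear_combination 5 * nrm a * e - hε' - 5 * nrm a * nrm (q - 1) * s * e60)
    have h2 : g * a = h * (g * q * a) := by
      rw [key, ← hd']
      linear_combination hdd + key
    have h3 : h * q = 1 := by
      have h4 : g * a * (h * q) = g * a * 1 := by linear_combination -h2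
      exact mul_left_cancel₀ hga h4
    have h4 : q ^ 1160 = 1 := by
      have := congrArg (· ^ 1160) h3
      simpa only [mul_pow, hh, one_mul, one_pow] using this
    rw [mul_pow, h4, mul_one] at hgq
    exact g_pow_ne_one hgq

theorem lam_cube_mul (D : Data lam z) {k a b : F59} (hk : k ≠ 0) (ha : a ≠ 0)
    {n : ZMod 59}
    (h : b = k * k * k * a) (hn : nrm (k * k * k) = n) : lam b = n * lam a := by
  rw [h, ← hn, D.lam_mul _ _ (cube_pow hk) ha]

theorem false_of_collision (D : Data lam z) {e : ZMod 59} (he : ∀ a ≠ 0, z a = e * lam a)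
    {a d : F59} (ha : a ≠ 0) (ha' : a - 1 ≠ 0) (hd : d ≠ 0) (hd' : d - 1 ≠ 0) (had : a ≠ d)
    (him : a.im = d.im) (h1 : lam a = lam (a - 1)) (h2 : lam d = lam (d - 1)) : False := by
  refine had (D.collision a (a - 1) d (d - 1) ha ha' hd hd' (by ring) ?_ h1 h2 ?_)
  · intro h
    have h3 : (1 : F59) = 0 := by linear_combination h
    exact one_ne_zero h3
  · have hs : ∀ a : F59, sym a (a - 1) = a.im := fun a => by
      have h1 : (a - 1).re = a.re - 1 := rfl
      have h2 : (a - 1).im = a.im - 0 := rfl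
      rw [sym, h1, h2]
      ring
    rw [hs, hs, him, he _ ha, he _ ha', he _ hd, he _ hd', h1, h2]
    ring

theorem exists_eq (D : Data lam z) (h1 : lam 1 = 1) :
    ∃ e, ∀ a ≠ 0, lam a = nrm a ∧ z a = e * nrm a := by
  have hg0 := g_ne_zero
  have hgg0 := mul_ne_zero hg0 hg0
  have he1 := D.lam_g_mul (one_ne_zero (α := F59))
  have he2 := D.lam_g_mul hg0
  rw [mul_one, h1, mul_one, mul_one] at he1
  have he : ∀ a ≠ 0, z a = z 1 * lam a := by
    intro a ha
    obtain ⟨h, hh, e⟩ := exists_cube_mul ha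
    rcases e with rfl | rfl | rfl
    · rw [← mul_one a, D.lam_mul _ _ hh one_ne_zero, D.z_mul _ _ hh one_ne_zero, h1]
      ring
    · rw [D.lam_mul _ _ hh hg0, D.z_mul _ _ hh hg0, he1.2]
      ring
    · rw [D.lam_mul _ _ hh hgg0, D.z_mul _ _ hh hgg0]
      have h3 : z (g * g) = lam (g * g) * z 1 := by
        refine mul_right_cancel₀ (D.lam_ne _ hg0) ?_
        rw [he2.2, he1.2]
        ring
      rw [h3]
      ring
  have hlam : lam g = 5 ∧ lam (g * g) = 25 := by
    have k1 : lam ⟨56, 28⟩ = 27 * lam (g * g) :=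
      D.lam_cube_mul (k := ⟨12, 6⟩) (by decide) hgg0 (by decide) (by decide)
    have k2 : lam (⟨56, 28⟩ - 1) = 42 * lam g :=
      D.lam_cube_mul (k := ⟨14, 21⟩) (by decide) hg0 (by decide) (by decide)
    have k3 : lam ⟨4, 28⟩ = 32 * lam (g * g) :=
      D.lam_cube_mul (k := ⟨21, 21⟩) (by decide) hgg0 (by decide) (by decide)
    have k4 : lam (⟨4, 28⟩ - 1) = 17 * lam g :=
      D.lam_cube_mul (k := ⟨0, 37⟩) (by decide) hg0 (by decide) (by decide)
    have k5 : lam ⟨30, 3⟩ = 52 * lam g :=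
      D.lam_cube_mul (k := ⟨1, 42⟩) (by decide) hg0 (by decide) (by decide)
    have k6 : lam (⟨30, 3⟩ - 1) = 34 * lam (g * g) :=
      D.lam_cube_mul (k := ⟨7, 42⟩) (by decide) hgg0 (by decide) (by decide)
    have k7 : lam ⟨5, 3⟩ = 34 * lam 1 :=
      D.lam_cube_mul (k := ⟨29, 21⟩) (by decide) one_ne_zero (by decide) (by decide)
    have k8 : lam (⟨5, 3⟩ - 1) = 1 * lam (g * g) :=
      D.lam_cube_mul (k := ⟨0, 1⟩) (by decide) hgg0 (by decide) (by decide)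
    have c1 := D.false_of_collision he (a := ⟨56, 28⟩) (d := ⟨4, 28⟩) (by decide) (by decide)
      (by decide) (by decide) (by decide) rfl
    have c2 := D.false_of_collision he (a := ⟨30, 3⟩) (d := ⟨5, 3⟩) (by decide) (by decide)
      (by decide) (by decide) (by decide) rfl
    rw [k1, k2, k3, k4] at c1
    rw [k5, k6, k7, k8, h1] at c2
    have he2 := he2.1
    rcases he1.1 with e | e <;> rw [e] at c1 c2 he2 ⊢ <;> rcases he2 with e' | e' <;>
      rw [e'] at c1 c2 ⊢
    · exact ⟨rfl, rfl⟩
    · exact (c1 (by decide) (by decide)).elim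
    · exact (c2 (by decide) (by decide)).elim
    · exact (c1 (by decide) (by decide)).elim
  have hN : ∀ a ≠ 0, lam a = nrm a := by
    intro a ha
    obtain ⟨h, hh, e⟩ := exists_cube_mul ha
    rcases e with rfl | rfl | rfl
    · nth_rw 1 [← mul_one a]
      rw [D.lam_mul _ _ hh one_ne_zero, h1, mul_one]
    · rw [D.lam_mul _ _ hh hg0, hlam.1, nrm_mul, nrm_g]
    · rw [D.lam_mul _ _ hh hgg0, hlam.2, nrm_mul, nrm_mul, nrm_g]
      norm_num
  exact ⟨z 1, fun a ha => ⟨hN a ha, by rw [he a ha, hN a ha]⟩⟩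

end Data

end Rigid

theorem sym_self (a : F59) : sym a a = 0 := by
  simp only [sym]
  ring

theorem sym_zero_left (a : F59) : sym 0 a = 0 := by simp [sym]

theorem sym_zero_right (a : F59) : sym a 0 = 0 := by simp [sym]

theorem sym_add_right (a b c : F59) : sym a (b + c) = sym a b + sym a c := by
  simp only [sym, QuadraticAlgebra.re_add, QuadraticAlgebra.im_add]
  ring

theorem sym_neg_right (a b : F59) : sym a (-b) = -sym a b := by
  simp only [sym, QuadraticAlgebra.re_neg, QuadraticAlgebra.im_neg]
  ring

theorem sym_neg_left (a b : F59) : sym (-a) b = -sym a b := by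
  simp only [sym, QuadraticAlgebra.re_neg, QuadraticAlgebra.im_neg]
  ring

theorem nrm_neg (a : F59) : nrm (-a) = nrm a := by
  simp only [nrm, QuadraticAlgebra.re_neg, QuadraticAlgebra.im_neg]
  ring

theorem mk_nrm (a : F59) : (⟨nrm a, 0⟩ : F59) = a * star a := by
  ext
  · simp only [nrm, QuadraticAlgebra.re_mul, QuadraticAlgebra.re_star, QuadraticAlgebra.im_star]
    ring
  · simp only [QuadraticAlgebra.im_mul, QuadraticAlgebra.re_star, QuadraticAlgebra.im_star]
    ring

theorem F59_two_ne : (2 : F59) ≠ 0 := by decide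

theorem F59_add_self_ne {a : F59} (ha : a ≠ 0) : a + a ≠ 0 := by
  rw [← two_mul]
  exact mul_ne_zero F59_two_ne ha

theorem F59_frob (a : F59) : a ^ 59 = star a := by
  have : CharP F59 59 := charP_of_injective_algebraMap (algebraMap (ZMod 59) F59).injective 59
  have h1 : a = ⟨a.re, 0⟩ + ⟨0, 1⟩ * ⟨a.im, 0⟩ := by ext <;> simp
  have h2 : ∀ r : ZMod 59, (⟨r, 0⟩ : F59) ^ 59 = ⟨r, 0⟩ := fun r => by
    have h3 : (⟨r, 0⟩ : F59) = algebraMap (ZMod 59) F59 r := rfl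
    rw [h3, ← map_pow, ZMod.pow_card]
  have h4 : (⟨0, 1⟩ : F59) ^ 59 = -⟨0, 1⟩ := by decide +kernel
  conv_lhs => rw [h1]
  rw [add_pow_char, mul_pow, h2, h2, h4]
  ext <;> simp

namespace UC

variable {G Ω : Type*} [Group G] [MulAction G Ω] [Finite G] [Finite Ω] (U : UC G Ω)

theorem al_zero : U.al 0 0 = 1 := by
  have h := U.al_mul 0 0 0 0
  rwa [sym_self, add_zero, add_zero, mul_zero, add_zero, mul_eq_left] at h

theorem al_inv (a : F59) (b : ZMod 59) : (U.al a b)⁻¹ = U.al (-a) (-b) := by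
  refine inv_eq_of_mul_eq_one_right ?_
  rw [U.al_mul, sym_neg_right, sym_self, add_neg_cancel, add_neg_cancel, neg_zero, mul_zero,
    add_zero, U.al_zero]

/-- The points other than `i`. -/
def pt (a : F59) (b : ZMod 59) : Ω := U.al a b • U.o

theorem al_smul_i (a : F59) (b : ZMod 59) : U.al a b • U.i = U.i := U.P_smul_i (U.al_mem a b)

theorem pt_zero : U.pt 0 0 = U.o := by rw [pt, U.al_zero, one_smul]

theorem pt_ne_i (a : F59) (b : ZMod 59) : U.pt a b ≠ U.i := U.smul_o_ne (U.al_mem a b)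

theorem exists_pt {q : Ω} (hq : q ≠ U.i) : ∃ a b, q = U.pt a b := by
  obtain ⟨x, hx, rfl⟩ := U.exists_mem_smul_eq U.ne hq
  obtain ⟨a, b, rfl⟩ := U.al_surj x hx
  exact ⟨a, b, rfl⟩

theorem pt_inj {a a' : F59} {b b' : ZMod 59} (h : U.pt a b = U.pt a' b') : a = a' ∧ b = b' :=
  U.al_inj _ _ _ _ (U.eq_of_smul_eq U.ne (U.al_mem _ _) (U.al_mem _ _) h)

theorem al_smul_pt (a a' : F59) (b b' : ZMod 59) :
    U.al a b • U.pt a' b' = U.pt (a + a') (b + b' + 2 * sym a a') := by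
  rw [pt, ← mul_smul, U.al_mul, pt]

theorem H_smul_pt {h : G} (hh : h ∈ U.H) (a : F59) (b : ZMod 59) :
    h • U.pt a b = U.pt (U.lam h * a) (nrm (U.lam h) * b) := by
  have h1 : h⁻¹ • U.o = U.o := (U.mem_H.1 (inv_mem hh)).2
  rw [pt, pt, ← U.al_conj h hh, mul_smul, mul_smul, h1]

theorem t_smul_pt (a : F59) (b : ZMod 59) : U.t • U.pt a b = U.pt (-a) b := by
  have h1 : nrm (-1) = 1 := by decide
  rw [U.H_smul_pt U.t_mem_H, U.lam_t, h1, neg_one_mul, one_mul]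

/-- The involution fixing `i` and the points over `a`. -/
def r (a : F59) : G := U.al a 0 * U.t * (U.al a 0)⁻¹

theorem r_mem (a : F59) : U.r a ∈ U.I := U.conj_mem_I U.t_mem_I _

theorem r_i (a : F59) : U.r a • U.i = U.i := by
  rw [r, U.al_inv, mul_smul, mul_smul, U.al_smul_i, U.t_i, U.al_smul_i]

theorem r_pt (a a' : F59) (b' : ZMod 59) :
    U.r a • U.pt a' b' = U.pt (a + a - a') (b' - 4 * sym a a') := by
  rw [r, U.al_inv, mul_smul, mul_smul, U.al_smul_pt, U.t_smul_pt, U.al_smul_pt]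
  simp only [sym_neg_left, sym_neg_right, sym_add_right, sym_self]
  congr 1
  all_goals ring

theorem r_pt_self (a : F59) (b : ZMod 59) : U.r a • U.pt a b = U.pt a b := by
  rw [r_pt, sym_self]
  congr 1 <;> ring

theorem r_o (a : F59) : U.r a • U.o = U.pt (a + a) 0 := by
  rw [← U.pt_zero, r_pt, sym_zero_right]
  congr 1 <;> ring

theorem r_pt_two (a : F59) : U.r a • U.pt (a + a) 0 = U.o := by
  rw [← U.r_o, ← mul_smul, ← sq, U.sq_of_mem_I (U.r_mem a), one_smul]

theorem r_inj {a a' : F59} (h : U.r a = U.r a') : a = a' := by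
  have h1 := (U.r_o a).symm.trans (h ▸ U.r_o a')
  have h2 := (U.pt_inj h1).1
  rw [← two_mul, ← two_mul] at h2
  exact mul_left_cancel₀ F59_two_ne h2

theorem eq_of_r_fix {a a' : F59} {b : ZMod 59} (h : U.r a • U.pt a' b = U.pt a' b) : a' = a := by
  rw [r_pt] at h
  refine mul_left_cancel₀ F59_two_ne ?_
  linear_combination -(U.pt_inj h).1

theorem exists_fix_ne {s : G} (hs : s ∈ U.I) (p : Ω) : ∃ q, q ≠ p ∧ s • q = q := by
  by_contra! h
  have h1 := U.card_fix_of_mem_I hs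
  have h2 : Nat.card {q : Ω // s • q = q} ≤ 1 := by
    rw [Finite.card_le_one_iff_subsingleton]
    have : ∀ q : {q : Ω // s • q = q}, q.1 = p := fun q => by
      by_contra hq
      exact h _ hq q.2
    exact ⟨fun q q' => Subtype.ext ((this q).trans (this q').symm)⟩
  omega

theorem eq_r_of_fix_i {s : G} (hs : s ∈ U.I) (hi : s • U.i = U.i) : ∃ a, s = U.r a := by
  obtain ⟨q, hq, hsq⟩ := U.exists_fix_ne hs U.i
  obtain ⟨a, b, rfl⟩ := U.exists_pt hq
  exact ⟨a, U.eq_of_mem_I hs (U.r_mem a) (U.pt_ne_i a b) hsq hi (U.r_pt_self a b) (U.r_i a)⟩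

theorem exists_s {a : F59} (ha : a ≠ 0) : ∃ s ∈ U.I, s • U.o = U.o ∧
    s • U.pt (a + a) 0 = U.pt (a + a) 0 ∧ ∃ z, s • U.i = U.pt a z := by
  have hqo : U.pt (a + a) 0 ≠ U.o := fun h => by
    rw [← U.pt_zero] at h
    exact F59_add_self_ne ha (U.pt_inj h).1
  obtain ⟨g, hg1, hg2⟩ := U.exists_smul_eq_smul_eq U.ne.symm hqo.symm
  obtain ⟨s, hs⟩ : ∃ s, s = g * U.t * g⁻¹ := ⟨_, rfl⟩
  have hsI : s ∈ U.I := hs ▸ U.conj_mem_I U.t_mem_I _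
  have hso : s • U.o = U.o := by
    rw [hs, ← hg1, ← mul_smul, inv_mul_cancel_right, mul_smul, U.t_i]
  have hsq : s • U.pt (a + a) 0 = U.pt (a + a) 0 := by
    rw [hs, ← hg2, ← mul_smul, inv_mul_cancel_right, mul_smul, U.t_o]
  have hrI := U.r_mem a
  have hrinv := U.inv_of_mem_I hrI
  have hcomm : Commute (U.r a) s := mul_inv_eq_iff_eq_mul.1 <|
    U.eq_of_mem_I (U.conj_mem_I hsI _) hsI hqo.symm
      (by rw [hrinv, mul_smul, mul_smul, r_o, hsq, r_pt_two])
      (by rw [hrinv, mul_smul, mul_smul, r_pt_two, hso, r_o]) hso hsq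
  have hne : s ≠ U.r a := fun h => hqo (by rw [← U.r_o, ← h, hso])
  have hsi : s • U.i ≠ U.i := fun h => U.disjoint_fix hsI hrI hcomm.symm hne h (U.r_i a)
  obtain ⟨a', b', h'⟩ := U.exists_pt hsi
  have h1 : U.r a • s • U.i = s • U.i := by rw [← mul_smul, hcomm.eq, mul_smul, U.r_i]
  rw [h'] at h1
  exact ⟨s, hsI, hso, hsq, b', by rw [h', U.eq_of_r_fix h1]⟩

theorem w_smul_smul (q : Ω) : U.w • U.w • q = q := by
  rw [← mul_smul, ← sq, U.w_sq, one_smul]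

theorem exists_eq_mul_w {s : G} (hs : s ∈ U.I) (hi : s • U.i = U.o) (ho : s • U.o = U.i) :
    ∃ r : ZMod 59, r ≠ 0 ∧ ∃ h ∈ U.H, U.lam h = ⟨r, 0⟩ ∧ s = h * U.w := by
  obtain ⟨h, hh⟩ : ∃ h, h = s * U.w := ⟨_, rfl⟩
  have hw : U.w * U.w = 1 := by rw [← sq, U.w_sq]
  have hs' : s = h * U.w := by rw [hh, mul_assoc, hw, mul_one]
  have hH : h ∈ U.H := U.mem_H.2 ⟨by rw [hh, mul_smul, U.w_i, ho], by rw [hh, mul_smul, U.w_o, hi]⟩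
  have h1 : h * (U.w * h * U.w⁻¹) = 1 := by
    have h2 := U.sq_of_mem_I hs
    rw [hs', sq] at h2
    rw [U.w_inv]
    simpa only [mul_assoc] using h2
  rw [U.conj_w hH, mul_inv_eq_one] at h1
  have hA := U.mem_A_of_mem_H hH
  have h3 : star (U.lam h) = U.lam h := by
    rw [← F59_frob, ← U.lam_pow hA, ← h1]
  have h4 : (U.lam h).im = 0 := by
    have h5 := congrArg QuadraticAlgebra.im h3
    rw [QuadraticAlgebra.im_star] at h5
    exact (by decide : ∀ x : ZMod 59, -x = x → x = 0) _ h5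
  have h6 : U.lam h = ⟨(U.lam h).re, 0⟩ := by
    ext
    · rfl
    · exact h4
  refine ⟨(U.lam h).re, fun h0 => U.lam_ne h hH ?_, h, hH, h6, hs'⟩
  rw [h6, h0]
  rfl

theorem pow_lam {h : G} (hh : h ∈ U.H) : U.lam h ^ 1160 = 1 := by
  have hA := U.mem_A_of_mem_H hh
  rw [← U.lam_pow hA, U.pow_card_H hh, U.lam_one]

end UC

/-- The involutions `s a` fixing `o`. -/
structure US (G Ω : Type*) [Group G] [MulAction G Ω] [Finite G] [Finite Ω] extends UC G Ω where
  s : F59 → G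
  zf : F59 → ZMod 59
  la : F59 → ZMod 59
  s_mem : ∀ a ≠ 0, s a ∈ toUT.I
  s_o : ∀ a ≠ 0, s a • o = o
  s_pt : ∀ a ≠ 0, s a • toUC.pt (a + a) 0 = toUC.pt (a + a) 0
  s_i : ∀ a ≠ 0, s a • i = toUC.pt a (zf a)
  la_ne : ∀ a ≠ 0, la a ≠ 0
  s_conj : ∀ a ≠ 0, ∃ h ∈ toUPair.H, lam h = ⟨la a, 0⟩ ∧
    (al a (zf a))⁻¹ * s a * al a (zf a) = h * w
  la_one : la 1 = 1

namespace UC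

variable {G Ω : Type*} [Group G] [MulAction G Ω] [Finite G] [Finite Ω] (U : UC G Ω)

theorem swap_of_s {s : G} {a : F59} {z : ZMod 59} (hs : s ∈ U.I)
    (hi : s • U.i = U.pt a z) : (U.al a z)⁻¹ * s * U.al a z ∈ U.I ∧
      ((U.al a z)⁻¹ * s * U.al a z) • U.i = U.o ∧ ((U.al a z)⁻¹ * s * U.al a z) • U.o = U.i := by
  have h1 := U.conj_mem_I hs (U.al a z)⁻¹
  rw [inv_inv] at h1
  have h2 : s • U.pt a z = U.i := by
    rw [← hi, ← mul_smul, ← sq, U.sq_of_mem_I hs, one_smul]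
  refine ⟨h1, ?_, ?_⟩
  · rw [mul_smul, mul_smul, U.al_smul_i, hi, pt, inv_smul_smul]
  · rw [mul_smul, mul_smul]
    change (U.al a z)⁻¹ • s • U.pt a z = _
    rw [h2, U.al_inv, U.al_smul_i]

theorem nonempty_uS (U : UC G Ω) : Nonempty (US G Ω) := by
  have hs : ∀ a : F59, ∃ s z, a ≠ 0 → s ∈ U.I ∧ s • U.o = U.o ∧
      s • U.pt (a + a) 0 = U.pt (a + a) 0 ∧ s • U.i = U.pt a z := fun a => by
    by_cases ha : a = 0
    · exact ⟨1, 0, fun h => absurd ha h⟩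
    · obtain ⟨s, h1, h2, h3, z, h4⟩ := U.exists_s ha
      exact ⟨s, z, fun _ => ⟨h1, h2, h3, h4⟩⟩
  choose s z hs using hs
  obtain ⟨k1, -, -, k4⟩ := hs 1 one_ne_zero
  obtain ⟨m1, m2, m3⟩ := U.swap_of_s k1 k4
  obtain ⟨V, hV⟩ : ∃ V : UC G Ω, V = { U with
      w := (U.al 1 (z 1))⁻¹ * s 1 * U.al 1 (z 1), w_mem := m1, w_i := m2, w_o := m3 } :=
    ⟨_, rfl⟩
  have hw : V.w = (V.al 1 (z 1))⁻¹ * s 1 * V.al 1 (z 1) := by rw [hV]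
  have hs' : ∀ a : F59, a ≠ 0 → s a ∈ V.I ∧ s a • V.o = V.o ∧
      s a • V.pt (a + a) 0 = V.pt (a + a) 0 ∧ s a • V.i = V.pt a (z a) := by
    rw [hV]
    exact hs
  have hl : ∀ a : F59, ∃ l : ZMod 59, a ≠ 0 → l ≠ 0 ∧ ∃ h ∈ V.H, V.lam h = ⟨l, 0⟩ ∧
      (V.al a (z a))⁻¹ * s a * V.al a (z a) = h * V.w := fun a => by
    by_cases ha : a = 0
    · exact ⟨1, fun h => absurd ha h⟩
    · obtain ⟨h1, -, -, h4⟩ := hs' a ha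
      obtain ⟨n1, n2, n3⟩ := V.swap_of_s h1 h4
      obtain ⟨l, hl, h⟩ := V.exists_eq_mul_w n1 n2 n3
      exact ⟨l, fun _ => ⟨hl, h⟩⟩
  choose l hl using hl
  refine ⟨{ V with
    s := s, zf := z, la := l, s_mem := fun a ha => (hs' a ha).1, s_o := fun a ha => (hs' a ha).2.1
    s_pt := fun a ha => (hs' a ha).2.2.1, s_i := fun a ha => (hs' a ha).2.2.2
    la_ne := fun a ha => (hl a ha).1, s_conj := fun a ha => (hl a ha).2, la_one := ?_ }⟩
  obtain ⟨-, h, hh, h1, h2⟩ := hl 1 one_ne_zero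
  rw [← hw, right_eq_mul] at h2
  rw [h2, V.lam_one] at h1
  exact (congrArg QuadraticAlgebra.re h1).symm

end UC

namespace US

variable {G Ω : Type*} [Group G] [MulAction G Ω] [Finite G] [Finite Ω] (U : US G Ω)

theorem eq_s {s : G} (hs : s ∈ U.I) (ho : s • U.o = U.o) {a : F59} (ha : a ≠ 0)
    (h : s • U.pt (a + a) 0 = U.pt (a + a) 0) : s = U.s a := by
  refine U.eq_of_mem_I hs (U.s_mem a ha) (p := U.o) (fun e => ?_) ho h (U.s_o a ha) (U.s_pt a ha)
  rw [← U.pt_zero] at e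
  exact F59_add_self_ne ha (U.pt_inj e).1.symm

theorem s_inj {a a' : F59} (ha : a ≠ 0) (ha' : a' ≠ 0) (h : U.s a = U.s a') : a = a' := by
  have h1 := U.s_i a ha
  rw [h, U.s_i a' ha'] at h1
  exact (U.pt_inj h1).1.symm

theorem s_H {h : G} (hh : h ∈ U.H) {a : F59} (ha : a ≠ 0) :
    h * U.s a * h⁻¹ = U.s (U.lam h * a) := by
  refine U.eq_s (U.conj_mem_I (U.s_mem a ha) h) ?_ (mul_ne_zero (U.lam_ne h hh) ha) ?_
  · rw [mul_smul, mul_smul, (U.mem_H.1 (inv_mem hh)).2, U.s_o a ha, (U.mem_H.1 hh).2]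
  · have h1 : U.pt (U.lam h * a + U.lam h * a) 0 = h • U.pt (a + a) 0 := by
      rw [U.H_smul_pt hh, mul_add, mul_zero]
    rw [h1, mul_smul, mul_smul, inv_smul_smul, U.s_pt a ha]

theorem zf_mul {h : G} (hh : h ∈ U.H) {a : F59} (ha : a ≠ 0) :
    U.zf (U.lam h * a) = nrm (U.lam h) * U.zf a := by
  have h1 := U.s_i _ (mul_ne_zero (U.lam_ne h hh) ha)
  rw [← U.s_H hh ha, mul_smul, mul_smul, (U.mem_H.1 (inv_mem hh)).1, U.s_i a ha,
    U.H_smul_pt hh] at h1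
  exact (U.pt_inj h1).2.symm

theorem w_mul {h : G} (hh : h ∈ U.H) : U.w * h = (h ^ 59)⁻¹ * U.w :=
  mul_inv_eq_iff_eq_mul.1 (U.conj_w hh)

theorem la_mul {h : G} (hh : h ∈ U.H) {a : F59} (ha : a ≠ 0) :
    U.la (U.lam h * a) = nrm (U.lam h) * U.la a := by
  obtain ⟨k, hk, h1, h2⟩ := U.s_conj a ha
  obtain ⟨k', hk', h1', h2'⟩ := U.s_conj _ (mul_ne_zero (U.lam_ne h hh) ha)
  rw [U.zf_mul hh ha, ← U.al_conj h hh, ← U.s_H hh ha] at h2'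
  have h3 : h * (k * U.w) * h⁻¹ = k' * U.w := by
    rw [← h2, ← h2']
    group
  have h4 := U.w_mul (inv_mem hh)
  rw [inv_pow, inv_inv] at h4
  have h5 : h * (k * U.w) * h⁻¹ = h * k * h ^ 59 * U.w := by
    calc _ = h * k * (U.w * h⁻¹) := by group
      _ = _ := by rw [h4]; group
  rw [h5] at h3
  have h6 := mul_right_cancel h3
  have hA := U.mem_A_of_mem_H hh
  have kA := U.mem_A_of_mem_H hk
  rw [← h6, U.lam_mul (mul_mem hA kA) (pow_mem hA _), U.lam_mul hA kA, U.lam_pow hA, h1,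
    F59_frob] at h1'
  have h7 : (⟨U.la (U.lam h * a), 0⟩ : F59) = ⟨nrm (U.lam h) * U.la a, 0⟩ := by
    have h8 : (⟨nrm (U.lam h) * U.la a, 0⟩ : F59) = ⟨nrm (U.lam h), 0⟩ * ⟨U.la a, 0⟩ := by
      ext <;> simp
    rw [h8, ← h1', mk_nrm]
    ring
  exact congrArg QuadraticAlgebra.re h7

theorem s_eq {a : F59} (ha : a ≠ 0) : ∃ h ∈ U.H, U.lam h = ⟨U.la a, 0⟩ ∧
    U.s a = U.al a (U.zf a) * (h * U.w) * (U.al a (U.zf a))⁻¹ := by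
  obtain ⟨h, hh, h1, h2⟩ := U.s_conj a ha
  refine ⟨h, hh, h1, ?_⟩
  rw [← h2]
  group

theorem al_mul_inv (a a' : F59) (b b' : ZMod 59) :
    U.al a b * (U.al a' b')⁻¹ = U.al (a - a') (b - b' - 2 * sym a a') := by
  rw [U.al_inv, U.al_mul, sym_neg_right]
  congr 1 <;> ring

theorem s_fix {a a' : F59} (ha : a ≠ 0) (ha' : a' ≠ 0) (h : U.la a = U.la a') :
    U.s a • U.pt (a - a') (U.zf a - U.zf a' - 2 * sym a a') =
      U.pt (a - a') (U.zf a - U.zf a' - 2 * sym a a') := by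
  obtain ⟨k, hk, h1, h2⟩ := U.s_eq ha
  obtain ⟨k', hk', h1', h2'⟩ := U.s_eq ha'
  rw [← h, ← h1] at h1'
  have h3 := U.lam_inj (U.mem_A_of_mem_H hk') (U.mem_A_of_mem_H hk) h1'
  subst h3
  have h4 := U.s_o a' ha'
  rw [h2', mul_smul, mul_smul] at h4
  rw [UC.pt, ← U.al_mul_inv, h2, mul_smul, mul_smul, mul_smul (U.al a _) _ U.o, inv_smul_smul,
    smul_left_cancel_iff, ← smul_left_cancel_iff (U.al a' (U.zf a')), h4, smul_inv_smul]

theorem data : Rigid.Data U.la U.zf where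
  lam_ne := U.la_ne
  lam_mul h a h1 ha := by
    obtain ⟨k, hk, rfl⟩ := U.exists_lam_eq h1
    exact U.la_mul hk ha
  z_mul h a h1 ha := by
    obtain ⟨k, hk, rfl⟩ := U.exists_lam_eq h1
    exact U.zf_mul hk ha
  collision a a' d d' ha ha' hd hd' h1 hne h2 h3 h4 := by
    have h5 := U.s_fix ha ha' h2
    have h6 := U.s_fix hd hd' h3
    rw [← h1, ← h4] at h6
    refine U.s_inj ha hd (U.eq_of_mem_I (U.s_mem a ha) (U.s_mem d hd) (fun e => ?_)
      (U.s_o a ha) h5 (U.s_o d hd) h6)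
    rw [← U.pt_zero] at e
    exact hne (sub_eq_zero.1 (U.pt_inj e).1.symm)

theorem exists_e : ∃ e, ∀ a ≠ 0, U.la a = nrm a ∧ U.zf a = e * nrm a :=
  U.data.exists_eq U.la_one

end US

/-- The involutions `s a` with their normalized coordinates. -/
structure UE (G Ω : Type*) [Group G] [MulAction G Ω] [Finite G] [Finite Ω] extends US G Ω where
  e : ZMod 59
  la_eq : ∀ a ≠ 0, la a = nrm a
  zf_eq : ∀ a ≠ 0, zf a = e * nrm a

theorem US.nonempty_uE {G Ω : Type*} [Group G] [MulAction G Ω] [Finite G] [Finite Ω]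
    (U : US G Ω) : Nonempty (UE G Ω) := by
  obtain ⟨e, he⟩ := U.exists_e
  exact ⟨{ U with e := e, la_eq := fun a ha => (he a ha).1, zf_eq := fun a ha => (he a ha).2 }⟩

theorem card_nrm_one : Nat.card {u : F59 // nrm u = 1} = 60 := by
  have h1 : Nat.card {u : F59 // nrm u = 1} =
      Nat.card {p : ZMod 59 × ZMod 59 // p.1 * p.1 + p.2 * p.2 = 1} :=
    Nat.card_congr
      { toFun := fun u => ⟨(u.1.re, u.1.im), u.2⟩
        invFun := fun p => ⟨⟨p.1.1, p.1.2⟩, p.2⟩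
        left_inv := fun u => rfl
        right_inv := fun p => rfl }
  rw [h1, Nat.card_eq_fintype_card]
  decide +kernel

theorem card_nrm_eq {d : F59} (hd : d ≠ 0) : Nat.card {u : F59 // nrm u = nrm d} = 60 := by
  rw [← card_nrm_one]
  refine Nat.card_congr ((Equiv.mulRight₀ d hd).subtypeEquiv fun u => ?_).symm
  rw [Equiv.mulRight₀_apply, nrm_mul]
  exact ⟨fun h => by rw [h, one_mul], fun h => (mul_eq_right₀ (nrm_ne_zero hd)).1 h⟩

namespace UE

variable {G Ω : Type*} [Group G] [MulAction G Ω] [Finite G] [Finite Ω] (U : UE G Ω)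

theorem s_smul {d : F59} (hd : d ≠ 0) : ∃ h ∈ U.H, U.lam h = ⟨nrm d, 0⟩ ∧
    U.s d = U.al d (U.e * nrm d) * (h * U.w) * (U.al d (U.e * nrm d))⁻¹ := by
  have h := U.s_eq hd
  rwa [U.la_eq d hd, U.zf_eq d hd] at h

theorem nrm_mk (x : ZMod 59) : nrm ⟨x, 0⟩ = x * x := by simp [nrm]

theorem nrm_star (a : F59) : nrm (star a) = nrm a := by
  simp only [nrm, QuadraticAlgebra.re_star, QuadraticAlgebra.im_star]
  ring

theorem w_pt_e {a : F59} (ha : a ≠ 0) :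
    U.w • U.pt a (-(U.e * nrm a)) = U.pt (star a)⁻¹ (-(U.e / nrm a)) := by
  obtain ⟨h, hh, h1, h2⟩ := U.s_smul (d := -a) (neg_ne_zero.2 ha)
  have h3 := U.s_o (-a) (neg_ne_zero.2 ha)
  have hn := nrm_ne_zero ha
  rw [nrm_neg] at h1 h2
  rw [h2, mul_smul, mul_smul, U.al_inv, neg_neg, ← eq_inv_smul_iff, U.al_inv, neg_neg,
    mul_smul] at h3
  change h • U.w • U.pt a _ = U.pt a _ at h3
  obtain ⟨p, hp⟩ : ∃ p, p = U.pt (star a)⁻¹ (-(U.e / nrm a)) := ⟨_, rfl⟩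
  have h4 : h • p = U.pt a (-(U.e * nrm a)) := by
    rw [hp, U.H_smul_pt hh, h1, nrm_mk, mk_nrm, mul_inv_cancel_right₀ (star_ne_zero.2 ha)]
    congr 1
    field_simp
  rw [← hp]
  exact smul_left_cancel h (h3.trans h4.symm)

theorem s_fix_of {d u : F59} (hd : d ≠ 0) (h : nrm u = nrm d) :
    U.s d • U.pt (u + d) (2 * sym d u) = U.pt (u + d) (2 * sym d u) := by
  obtain ⟨k, hk, h1, h2⟩ := U.s_smul hd
  have hu : u ≠ 0 := by
    rintro rfl
    exact nrm_ne_zero hd (h.symm.trans (by decide))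
  have hn := nrm_ne_zero hd
  have h3 : (U.al d (U.e * nrm d))⁻¹ • U.pt (u + d) (2 * sym d u) =
      U.pt u (-(U.e * nrm d)) := by
    rw [U.al_inv, U.al_smul_pt, sym_neg_left, sym_add_right, sym_self]
    congr 1 <;> ring
  rw [h2, mul_smul, mul_smul, h3, mul_smul, ← h, U.w_pt_e hu, U.H_smul_pt hk, h1, nrm_mk, ← h,
    mk_nrm, mul_inv_cancel_right₀ (star_ne_zero.2 hu), U.al_smul_pt]
  rw [← h] at hn
  congr 1
  · ring
  · field_simp
    ring

theorem s_i_ne {d : F59} (hd : d ≠ 0) : U.s d • U.i ≠ U.i := by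
  rw [U.s_i d hd]
  exact U.pt_ne_i _ _

theorem fix_s {d a : F59} {b : ZMod 59} (hd : d ≠ 0) (h : U.s d • U.pt a b = U.pt a b) :
    ∃ u, nrm u = nrm d ∧ a = u + d ∧ b = 2 * sym d u := by
  have h1 : Function.Injective (fun u : {u : F59 // nrm u = nrm d} =>
      (⟨U.pt (u + d) (2 * sym d u), U.s_fix_of hd u.2⟩ : {q : Ω // U.s d • q = q})) := by
    intro u u' e
    exact Subtype.ext (add_right_cancel (U.pt_inj (congrArg Subtype.val e)).1)
  have h2 := h1.bijective_of_nat_card_le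
    (by rw [U.card_fix_of_mem_I (U.s_mem d hd), card_nrm_eq hd])
  obtain ⟨u, hu⟩ := h2.2 ⟨U.pt a b, h⟩
  have h3 := U.pt_inj (congrArg Subtype.val hu)
  exact ⟨u, u.2, h3.1.symm, h3.2.symm⟩

theorem s_fix_iff {d a : F59} {b : ZMod 59} (hd : d ≠ 0) :
    U.s d • U.pt a b = U.pt a b ↔ 2 * star a * d = ⟨nrm a, -b⟩ := by
  have key : ∀ u, (nrm u = nrm d ∧ a = u + d ∧ b = 2 * sym d u) ↔
      (2 * star a * d = ⟨nrm a, -b⟩ ∧ a = u + d) := by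
    intro u
    have h2 : (2 : F59).re = 2 ∧ (2 : F59).im = 0 := ⟨rfl, rfl⟩
    constructor
    · rintro ⟨e1, rfl, rfl⟩
      refine ⟨QuadraticAlgebra.ext ?_ ?_, rfl⟩ <;>
        simp only [nrm, sym, QuadraticAlgebra.re_mul, QuadraticAlgebra.im_mul,
          QuadraticAlgebra.re_star, QuadraticAlgebra.im_star, h2.1, h2.2,
          QuadraticAlgebra.re_add, QuadraticAlgebra.im_add] at e1 ⊢
      · linear_combination -e1
      · ring
    · rintro ⟨e, rfl⟩
      have e1 := congrArg QuadraticAlgebra.re e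
      have e2 := congrArg QuadraticAlgebra.im e
      simp only [nrm, QuadraticAlgebra.re_mul, QuadraticAlgebra.im_mul,
          QuadraticAlgebra.re_star, QuadraticAlgebra.im_star, h2.1, h2.2,
          QuadraticAlgebra.re_add, QuadraticAlgebra.im_add] at e1 e2
      refine ⟨?_, rfl, ?_⟩ <;> simp only [nrm, sym]
      · linear_combination -e1
      · linear_combination e2
  constructor
  · intro h
    obtain ⟨u, hu⟩ := U.fix_s hd h
    exact ((key u).1 hu).1
  · intro h
    obtain ⟨h1, h2, h3⟩ := (key (a - d)).2 ⟨h, by ring⟩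
    have h4 := U.s_fix_of hd h1
    rwa [← h2, ← h3] at h4

end UE

theorem mk_ne_zero {N b : ZMod 59} (h : N ≠ 0) : (⟨N, b⟩ : F59) ≠ 0 := fun e =>
  h (congrArg QuadraticAlgebra.re e)

theorem mk_mul_star (N b : ZMod 59) : (⟨N, b⟩ : F59) * ⟨N, -b⟩ = ⟨N * N + b * b, 0⟩ := by
  ext
  · simp
  · simp
    ring

theorem sq_add_sq_ne {N b : ZMod 59} (h : N ≠ 0) : N * N + b * b ≠ 0 :=
  nrm_ne_zero (mk_ne_zero h (b := b))

theorem mk_smul (c N b : ZMod 59) : (⟨c, 0⟩ : F59) * ⟨N, b⟩ = ⟨c * N, c * b⟩ := by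
  ext <;> simp

namespace UE

variable {G Ω : Type*} [Group G] [MulAction G Ω] [Finite G] [Finite Ω] (U : UE G Ω)

theorem exists_conj_w_s {a : F59} (ha : a ≠ 0) : ∃ c ≠ 0, U.w * U.s a * U.w⁻¹ = U.r c := by
  obtain ⟨c, hc⟩ := U.eq_r_of_fix_i (U.conj_mem_I (U.s_mem a ha) U.w)
    (by rw [U.w_inv, mul_smul, mul_smul, U.w_i, U.s_o a ha, U.w_o])
  refine ⟨c, ?_, hc⟩
  rintro rfl
  have h1 : U.r 0 • U.o = U.o := by rw [U.r_o, add_zero, U.pt_zero]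
  rw [← hc, U.w_inv, mul_smul, mul_smul, U.w_o] at h1
  refine U.s_i_ne ha ?_
  have h2 := congrArg (U.w • ·) h1
  simpa only [U.w_smul_smul, U.w_o] using h2

theorem eq_of_commute {a d : F59} (hd : d ≠ 0) (ha : a ≠ 0) (h : Commute (U.r a) (U.s d)) :
    a = d := by
  have h1 : U.s d • U.pt (a + a) 0 = U.pt (a + a) 0 := by
    rw [← U.r_o, ← mul_smul, ← h.eq, mul_smul, U.s_o d hd]
  rw [U.s_fix_iff hd, neg_zero, mk_nrm, ← mul_right_inj' (star_ne_zero.2 (F59_add_self_ne ha))] at h1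
  have h2 : star (a + a) ≠ 0 := star_ne_zero.2 (F59_add_self_ne ha)
  have h3 : 2 * d = a + a := by
    refine mul_left_cancel₀ h2 (mul_left_cancel₀ h2 ?_)
    linear_combination h1
  rw [← two_mul] at h3
  exact (mul_left_cancel₀ F59_two_ne h3).symm

theorem commute_r_s {a : F59} (ha : a ≠ 0) : Commute (U.r a) (U.s a) := by
  refine mul_inv_eq_iff_eq_mul.1 <| U.eq_of_mem_I (U.conj_mem_I (U.s_mem a ha) _)
    (U.s_mem a ha) (p := U.o) (q := U.pt (a + a) 0) (fun e => ?_)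
      (by rw [U.inv_of_mem_I (U.r_mem a), mul_smul, mul_smul, U.r_o, U.s_pt a ha, U.r_pt_two])
      (by rw [U.inv_of_mem_I (U.r_mem a), mul_smul, mul_smul, U.r_pt_two, U.s_o a ha, U.r_o])
      (U.s_o a ha) (U.s_pt a ha)
  rw [← U.pt_zero] at e
  exact F59_add_self_ne ha (U.pt_inj e).1.symm

theorem exists_tau : ∃ τ : F59 → F59, ∀ a ≠ 0, τ a ≠ 0 ∧ τ (τ a) = a ∧
    U.w * U.s a * U.w⁻¹ = U.r (τ a) ∧ U.w * U.r a * U.w⁻¹ = U.s (τ a) := by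
  classical
  have h1 : ∀ a : F59, ∃ c, (a = 0 → c = 0) ∧ (a ≠ 0 → c ≠ 0 ∧ U.w * U.s a * U.w⁻¹ = U.r c) := by
    intro a
    by_cases ha : a = 0
    · exact ⟨0, fun _ => rfl, fun h => absurd ha h⟩
    · obtain ⟨c, hc⟩ := U.exists_conj_w_s ha
      exact ⟨c, fun h => absurd h ha, fun _ => hc⟩
  choose τ h1 using h1
  have hw : ∀ g : G, U.w * (U.w * g * U.w⁻¹) * U.w⁻¹ = g := fun g => by
    have h2 : U.w * U.w = 1 := by rw [← sq, U.w_sq]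
    calc _ = (U.w * U.w) * g * (U.w * U.w)⁻¹ := by group
      _ = g := by rw [h2]; group
  have hinj : Function.Injective τ := by
    intro a a' h
    by_cases ha : a = 0
    · by_contra hne
      have ha' : a' ≠ 0 := fun h' => hne (ha.trans h'.symm)
      exact ((h1 a').2 ha').1 (h.symm.trans ((h1 a).1 ha))
    · by_cases ha' : a' = 0
      · exact (((h1 a).2 ha).1 (h.trans ((h1 a').1 ha'))).elim
      · have h2 := ((h1 a).2 ha).2
        rw [h, ← ((h1 a').2 ha').2, mul_left_inj, mul_right_inj] at h2
        exact U.s_inj ha ha' h2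
  have hsurj := Finite.surjective_of_injective hinj
  have key : ∀ a ≠ 0, U.w * U.r a * U.w⁻¹ = U.s (τ a) := by
    intro a ha
    obtain ⟨d, rfl⟩ := hsurj a
    have hd : d ≠ 0 := fun h => ha ((h1 d).1 h)
    have h3 := ((h1 d).2 hd).2
    have h4 : U.w * U.r (τ d) * U.w⁻¹ = U.s d := by rw [← h3, hw]
    have hc := (Commute.conj_iff U.w).2 (U.commute_r_s ha)
    rw [h4, ((h1 _).2 ha).2] at hc
    rw [h4, U.eq_of_commute hd ((h1 _).2 ha).1 hc.symm]
  refine ⟨τ, fun a ha => ⟨((h1 a).2 ha).1, ?_, ((h1 a).2 ha).2, key a ha⟩⟩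
  refine U.r_inj ?_
  rw [← ((h1 _).2 ((h1 a).2 ha).1).2, ← key a ha, hw]

theorem w_fix {g g' : G} {q : Ω} (h : U.w * g * U.w⁻¹ = g') (hq : g • q = q) :
    g' • U.w • q = U.w • q := by
  rw [← h, U.w_inv, mul_smul, mul_smul, U.w_smul_smul, hq]

theorem star_mul_tau {τ : F59 → F59} (hτ : ∀ a ≠ 0, τ a ≠ 0 ∧ τ (τ a) = a ∧
    U.w * U.s a * U.w⁻¹ = U.r (τ a) ∧ U.w * U.r a * U.w⁻¹ = U.s (τ a)) {a : F59} (ha : a ≠ 0) :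
    2 * (star a * τ a) = ⟨1, U.e⟩ := by
  have h1 := U.w_fix (hτ a ha).2.2.2 (U.r_pt_self a (-(U.e * nrm a)))
  rw [U.w_pt_e ha, U.s_fix_iff (hτ a ha).1, neg_neg] at h1
  have hn := nrm_ne_zero ha
  have hsa := star_ne_zero.2 ha
  have h2 : nrm (star a)⁻¹ * nrm a = 1 := by
    rw [← nrm_star a, ← nrm_mul, inv_mul_cancel₀ hsa, nrm_one]
  have h3 : (⟨nrm a, 0⟩ : F59) * (2 * star (star a)⁻¹ * τ a) = ⟨1, U.e⟩ := by
    rw [h1, mk_smul, mul_comm (nrm a), h2, mul_div_cancel₀ _ hn]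
  rw [← h3, mk_nrm, star_inv₀, star_star]
  field_simp

theorem e_eq_zero : U.e = 0 := by
  obtain ⟨τ, hτ⟩ := U.exists_tau
  have h1 := U.star_mul_tau hτ one_ne_zero
  have h2 := U.star_mul_tau hτ (hτ 1 one_ne_zero).1
  rw [(hτ 1 one_ne_zero).2.1, mul_one] at h2
  rw [star_one, one_mul, ← h2] at h1
  have h3 := congrArg QuadraticAlgebra.im (mul_left_cancel₀ F59_two_ne h1)
  have h4 := congrArg QuadraticAlgebra.im h2
  rw [QuadraticAlgebra.im_star] at h3
  have h5 := (by decide : ∀ x : ZMod 59, x = -x → x = 0) _ h3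
  rw [two_mul, QuadraticAlgebra.im_add, QuadraticAlgebra.im_star, h5, neg_zero, add_zero] at h4
  exact h4.symm

theorem w_pt {a : F59} (ha : a ≠ 0) (b : ZMod 59) :
    U.w • U.pt a b = U.pt (a / ⟨nrm a, b⟩) (-b / (nrm a * nrm a + b * b)) := by
  obtain ⟨τ, hτ⟩ := U.exists_tau
  have hm : ∀ a ≠ 0, 2 * (star a * τ a) = 1 := fun a ha => by
    rw [U.star_mul_tau hτ ha, e_eq_zero]
    rfl
  have hsa := star_ne_zero.2 ha
  have hn := nrm_ne_zero ha
  obtain ⟨d, hd⟩ : ∃ d, d = (⟨nrm a, -b⟩ : F59) / (2 * star a) := ⟨_, rfl⟩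
  have hN : (⟨nrm a, -b⟩ : F59) ≠ 0 := mk_ne_zero hn
  have hN' : (⟨nrm a, b⟩ : F59) ≠ 0 := mk_ne_zero hn
  have hd' : 2 * star a * d = ⟨nrm a, -b⟩ := by
    rw [hd, mul_div_cancel₀]
    exact mul_ne_zero F59_two_ne hsa
  have hd0 : d ≠ 0 := by
    rw [hd]
    exact div_ne_zero hN (mul_ne_zero F59_two_ne hsa)
  have h1 := U.w_fix (hτ d hd0).2.2.1 ((U.s_fix_iff hd0).2 hd')
  have h2 := U.w_fix (hτ a ha).2.2.2 (U.r_pt_self a b)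
  have hne : U.w • U.pt a b ≠ U.i := by
    rw [← U.w_o, Ne, smul_left_cancel_iff, ← U.pt_zero]
    exact fun h => ha (U.pt_inj h).1
  obtain ⟨a', b', h'⟩ := U.exists_pt hne
  rw [h'] at h1 h2 ⊢
  rw [U.s_fix_iff (hτ a ha).1] at h2
  have h3 := U.eq_of_r_fix h1
  have h4 : a' = a / ⟨nrm a, b⟩ := by
    have h5 := congrArg star hd'
    have h6 : star (⟨nrm a, -b⟩ : F59) = ⟨nrm a, b⟩ := by
      ext <;> simp
    have h7 : star (2 : F59) = 2 := by decide
    rw [h6, star_mul, star_mul, star_star, h7] at h5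
    rw [eq_div_iff hN', h3, ← h5]
    linear_combination a * hm d hd0
  rw [← h4]
  congr 1
  have h8 := hm a ha
  have h9 : star a' * star (⟨nrm a, b⟩ : F59) = star a := by
    rw [← star_mul', h4, div_mul_cancel₀ _ hN']
  have h6 : star (⟨nrm a, b⟩ : F59) = ⟨nrm a, -b⟩ := by
    ext <;> simp
  rw [h6] at h9
  have h10 : (⟨nrm a', -b'⟩ : F59) * ⟨nrm a, -b⟩ = 1 := by
    rw [← h2]
    linear_combination 2 * τ a * h9 + h8
  have h11 : (⟨nrm a', -b'⟩ : F59) * ⟨nrm a * nrm a + b * b, 0⟩ = ⟨nrm a, b⟩ := by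
    rw [← mk_mul_star]
    linear_combination ⟨nrm a, b⟩ * h10
  rw [mul_comm, mk_smul] at h11
  have h12 := congrArg QuadraticAlgebra.im h11
  rw [eq_div_iff (sq_add_sq_ne hn)]
  simp only at h12
  linear_combination -h12

theorem exists_kappa : ∃ κ : ZMod 59, κ ≠ 0 ∧ ∀ b ≠ 0, U.w • U.pt 0 b = U.pt 0 (κ / b) := by
  have h1 : U.t • U.w • U.pt 0 1 = U.w • U.pt 0 1 := by
    rw [← mul_smul, ← U.commute_w_t.eq, mul_smul, U.t_smul_pt, neg_zero]
  have hne : U.w • U.pt 0 1 ≠ U.i := by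
    rw [← U.w_o, Ne, smul_left_cancel_iff, ← U.pt_zero]
    exact fun h => one_ne_zero (U.pt_inj h).2
  obtain ⟨a', κ, h'⟩ := U.exists_pt hne
  rw [h', U.t_smul_pt] at h1
  have h2 : a' = 0 := by
    refine mul_left_cancel₀ F59_two_ne ?_
    linear_combination -(U.pt_inj h1).1
  subst h2
  refine ⟨κ, ?_, fun b hb => ?_⟩
  · rintro rfl
    rw [U.pt_zero, ← U.w_i, smul_left_cancel_iff] at h'
    exact U.pt_ne_i _ _ h'
  · obtain ⟨x, y, hxy⟩ := ZMod.sq_add_sq 59 (b ^ 39)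
    have hb3 : (b ^ 39) ^ 3 = b := by
      rw [← pow_mul, show 39 * 3 = 58 * 2 + 1 from rfl, pow_succ, pow_mul, UW.zmod59_pow_card hb,
        one_pow, one_mul]
    obtain ⟨k, hk⟩ : ∃ k : F59, nrm k = b ^ 39 := ⟨⟨x, y⟩, by rw [← hxy, sq, sq]; rfl⟩
    have hk0 : k ≠ 0 := by
      rintro rfl
      have h0 : nrm 0 = 0 := by decide
      exact pow_ne_zero 39 hb (hk.symm.trans h0)
    obtain ⟨h, hh, hl⟩ := U.exists_lam_eq (cube_pow hk0)
    have hn : nrm (U.lam h) = b := by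
      rw [hl, nrm_mul, nrm_mul, hk]
      refine Eq.trans ?_ hb3
      ring
    have h3 : U.pt 0 b = h • U.pt 0 1 := by rw [U.H_smul_pt hh, hn, mul_zero, mul_one]
    rw [h3, ← mul_smul, U.w_mul hh, mul_smul, h', inv_smul_eq_iff,
      U.H_smul_pt (pow_mem hh _), mul_zero, U.lam_pow (U.mem_A_of_mem_H hh), F59_frob, nrm_star, hn,
      mul_div_cancel₀ _ hb]

theorem al_zero_smul_pt (a : F59) (b b' : ZMod 59) : U.al 0 b • U.pt a b' = U.pt a (b + b') := by
  rw [U.al_smul_pt, sym_zero_left, zero_add, mul_zero, add_zero]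

theorem kappa_eq {κ : ZMod 59} (hκ : κ ≠ 0) (h : ∀ b ≠ 0, U.w • U.pt 0 b = U.pt 0 (κ / b)) :
    κ = -1 := by
  have h1 : ∀ b, U.al 0 b • U.o = U.pt 0 b := fun _ => rfl
  have hw1 : U.w • U.pt 0 1 = U.pt 0 κ := by rw [h 1 one_ne_zero, div_one]
  obtain ⟨n, hn⟩ : ∃ n, n = U.w * U.al 0 (-κ) * U.w * U.al 0 1 * U.w := ⟨_, rfl⟩
  have hni : n • U.i = U.i := by
    simp only [hn, mul_smul]
    rw [U.w_i, h1, hw1, U.al_zero_smul_pt, neg_add_cancel, U.pt_zero, U.w_o]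
  have hno : n • U.o = U.pt 0 (-1) := by
    simp only [hn, mul_smul]
    rw [U.w_o, U.al_smul_i, U.w_i, h1, h _ (neg_ne_zero.2 hκ), div_neg, div_self hκ]
  obtain ⟨k, hk⟩ : ∃ k, k = (U.al 0 (-1))⁻¹ * n := ⟨_, rfl⟩
  have hkH : k ∈ U.H := U.mem_H.2
    ⟨by rw [hk, mul_smul, hni, U.al_inv, U.al_smul_i],
      by rw [hk, mul_smul, hno, UC.pt, inv_smul_smul]⟩
  have hnk : n = U.al 0 (-1) * k := by rw [hk, mul_inv_cancel_left]
  have key : ∀ (u a₁ a₂ : F59) (b₂ : ZMod 59), u ≠ 0 → a₁ ≠ 0 → a₂ ≠ 0 →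
      u / ⟨nrm u, 0⟩ = a₁ → a₁ / ⟨nrm a₁, 1⟩ = a₂ → -1 / (nrm a₁ * nrm a₁ + 1 * 1) = b₂ →
      a₂ / ⟨nrm a₂, -κ + b₂⟩ = U.lam k * u := by
    intro u a₁ a₂ b₂ hu ha₁ ha₂ e1 e2 e3
    have h2 : n • U.pt u 0 = U.w • U.pt a₂ (-κ + b₂) := by
      simp only [hn, mul_smul]
      rw [U.w_pt hu, e1, neg_zero, zero_div, U.al_zero_smul_pt, add_zero, U.w_pt ha₁, e2, e3,
        U.al_zero_smul_pt]
    rw [hnk, mul_smul, U.H_smul_pt hkH, U.al_zero_smul_pt, U.w_pt ha₂] at h2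
    exact (U.pt_inj h2).1.symm
  have c1 := key 1 1 ⟨30, 29⟩ 29 (by decide) (by decide) (by decide)
    ((div_eq_iff (by decide)).2 (by decide)) ((div_eq_iff (by decide)).2 (by decide))
    ((div_eq_iff (by decide)).2 (by decide))
  have c2 := key ⟨1, 1⟩ ⟨30, 30⟩ ⟨36, 47⟩ 11 (by decide) (by decide) (by decide)
    ((div_eq_iff (by decide)).2 (by decide)) ((div_eq_iff (by decide)).2 (by decide))
    ((div_eq_iff (by decide)).2 (by decide))
  rw [mul_one] at c1
  rw [← c1, div_mul_eq_mul_div, div_eq_div_iff (mk_ne_zero (by decide)) (mk_ne_zero (by decide))]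
    at c2
  exact (by decide : ∀ κ : ZMod 59, (⟨36, 47⟩ : F59) * ⟨nrm ⟨30, 29⟩, -κ + 29⟩ =
    ⟨30, 29⟩ * ⟨1, 1⟩ * ⟨nrm ⟨36, 47⟩, -κ + 11⟩ → κ = -1) κ c2

/-- The action of `w` in coordinates. -/
theorem w_smul_pt {a : F59} {b : ZMod 59} (h : ¬ (a = 0 ∧ b = 0)) :
    U.w • U.pt a b = U.pt (a / ⟨nrm a, b⟩) (-b / (nrm a * nrm a + b * b)) := by
  by_cases ha : a = 0
  · subst ha
    have hb : b ≠ 0 := fun hb => h ⟨rfl, hb⟩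
    obtain ⟨κ, hκ, h1⟩ := U.exists_kappa
    have h0 : nrm 0 = 0 := by decide
    rw [h1 b hb, U.kappa_eq hκ h1, h0, zero_div]
    congr 1
    field_simp
    ring
  · exact U.w_pt ha b

end UE

/-- Coordinates on the projective Hermitian curve. -/
abbrev UPoint : Type := Option (F59 × ZMod 59)

namespace UPoint

/-- The translations of the coordinate model. -/
def trans (a : F59) (b : ZMod 59) : UPoint → UPoint
  | none => none
  | some p => some (a + p.1, b + p.2 + 2 * sym a p.1)

/-- The diagonal maps of the coordinate model. -/
def scale (l : F59) : UPoint → UPoint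
  | none => none
  | some p => some (l * p.1, nrm l * p.2)

open Classical in
/-- The inversion of the coordinate model. -/
noncomputable def invol : UPoint → UPoint
  | none => some (0, 0)
  | some p => if p.1 = 0 ∧ p.2 = 0 then none else
      some (p.1 / ⟨nrm p.1, p.2⟩, -p.2 / (nrm p.1 * nrm p.1 + p.2 * p.2))

/-- The generators of the coordinate model. -/
def gens : Set (Equiv.Perm UPoint) :=
  {σ | (∃ a b, ⇑σ = trans a b) ∨ (∃ l, l ^ 1160 = 1 ∧ ⇑σ = scale l) ∨ ⇑σ = invol}

/-- The coordinate model of the unitary group. -/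
def model : Subgroup (Equiv.Perm UPoint) := Subgroup.closure gens

end UPoint

namespace UE

variable {G Ω : Type*} [Group G] [MulAction G Ω] [Finite G] [Finite Ω] (U : UE G Ω)

/-- The point with given coordinates. -/
def point : UPoint → Ω
  | none => U.i
  | some p => U.pt p.1 p.2

theorem point_bijective : Function.Bijective U.point := by
  constructor
  · rintro (_ | p) (_ | q) h
    · rfl
    · exact (U.pt_ne_i _ _ h.symm).elim
    · exact (U.pt_ne_i _ _ h).elim
    · obtain ⟨h1, h2⟩ := U.pt_inj h
      rw [Prod.ext h1 h2]
  · intro q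
    by_cases hq : q = U.i
    · exact ⟨none, hq.symm⟩
    · obtain ⟨a, b, h⟩ := U.exists_pt hq
      exact ⟨some (a, b), h.symm⟩

theorem al_smul_point (a : F59) (b : ZMod 59) (x : UPoint) :
    U.al a b • U.point x = U.point (UPoint.trans a b x) := by
  rcases x with _ | p
  · exact U.al_smul_i a b
  · exact U.al_smul_pt a p.1 b p.2

theorem H_smul_point {h : G} (hh : h ∈ U.H) (x : UPoint) :
    h • U.point x = U.point (UPoint.scale (U.lam h) x) := by
  rcases x with _ | p
  · exact (U.mem_H.1 hh).1
  · exact U.H_smul_pt hh p.1 p.2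

theorem w_smul_point (x : UPoint) : U.w • U.point x = U.point (UPoint.invol x) := by
  rcases x with _ | p
  · exact U.w_i.trans U.pt_zero.symm
  · by_cases h : p.1 = 0 ∧ p.2 = 0
    · rw [UPoint.invol, if_pos h, point, point, h.1, h.2, U.pt_zero, U.w_o]
    · rw [UPoint.invol, if_neg h]
      exact U.w_smul_pt h

/-- The permutation representation in coordinates. -/
noncomputable def coordHom : G →* Equiv.Perm UPoint :=
  (Equiv.ofBijective _ U.point_bijective).symm.permCongrHom.toMonoidHom.comp
    (MulAction.toPermHom G Ω)

theorem point_coordHom (g : G) (x : UPoint) : U.point (U.coordHom g x) = g • U.point x :=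
  (Equiv.ofBijective _ U.point_bijective).apply_symm_apply _

theorem coordHom_eq_iff {g : G} {f : UPoint → UPoint} :
    ⇑(U.coordHom g) = f ↔ ∀ x, g • U.point x = U.point (f x) := by
  constructor
  · rintro rfl x
    exact (U.point_coordHom g x).symm
  · intro h
    funext x
    exact U.point_bijective.1 ((U.point_coordHom g x).trans (h x))

theorem coordHom_injective : Function.Injective U.coordHom := by
  rw [injective_iff_map_eq_one]
  intro g hg
  refine U.faithful g fun q => ?_
  obtain ⟨x, rfl⟩ := U.point_bijective.2 q
  rw [← U.point_coordHom, hg]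
  rfl

theorem coordHom_mem_of_fix {g : G} (hg : g • U.i = U.i) : U.coordHom g ∈ UPoint.model := by
  have hgo : g • U.o ≠ U.i := fun h => U.ne (smul_left_cancel g (h.trans hg.symm))
  obtain ⟨a, b, h⟩ := U.exists_pt hgo
  have hH : (U.al a b)⁻¹ * g ∈ U.H := U.mem_H.2
    ⟨by rw [mul_smul, hg, U.al_inv, U.al_smul_i], by rw [mul_smul, h, UC.pt, inv_smul_smul]⟩
  rw [← mul_inv_cancel_left (U.al a b) g, map_mul]
  refine mul_mem (Subgroup.subset_closure (.inl ⟨a, b, ?_⟩))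
    (Subgroup.subset_closure (.inr (.inl ⟨_, U.pow_lam hH, ?_⟩)))
  · exact U.coordHom_eq_iff.2 (U.al_smul_point a b)
  · exact U.coordHom_eq_iff.2 (U.H_smul_point hH)

theorem coordHom_mem (g : G) : U.coordHom g ∈ UPoint.model := by
  by_cases hg : g • U.i = U.i
  · exact U.coordHom_mem_of_fix hg
  obtain ⟨a, b, h⟩ := U.exists_pt hg
  have h1 : U.coordHom U.w ∈ UPoint.model :=
    Subgroup.subset_closure (.inr (.inr (U.coordHom_eq_iff.2 U.w_smul_point)))
  have h2 := U.coordHom_mem_of_fix (U.al_smul_i a b)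
  have h3 := U.coordHom_mem_of_fix (g := U.w * ((U.al a b)⁻¹ * g))
    (by rw [mul_smul, mul_smul, h, UC.pt, inv_smul_smul, U.w_o])
  rw [map_mul, Subgroup.mul_mem_cancel_left _ h1, map_mul, map_inv,
    Subgroup.mul_mem_cancel_left _ (inv_mem h2)] at h3
  exact h3

theorem range_coordHom : U.coordHom.range = UPoint.model := by
  refine le_antisymm ?_ ?_
  · rintro _ ⟨g, rfl⟩
    exact U.coordHom_mem g
  · rw [UPoint.model, Subgroup.closure_le]
    rintro σ (⟨a, b, h⟩ | ⟨l, hl, h⟩ | h)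
    · exact ⟨U.al a b, DFunLike.coe_injective
        ((U.coordHom_eq_iff.2 (U.al_smul_point a b)).trans h.symm)⟩
    · obtain ⟨k, hk, rfl⟩ := U.exists_lam_eq hl
      exact ⟨k, DFunLike.coe_injective ((U.coordHom_eq_iff.2 (U.H_smul_point hk)).trans h.symm)⟩
    · exact ⟨U.w, DFunLike.coe_injective ((U.coordHom_eq_iff.2 U.w_smul_point).trans h.symm)⟩

theorem nonempty_mulEquiv_model (U : UE G Ω) : Nonempty (G ≃* UPoint.model) :=
  ⟨(MonoidHom.ofInjective U.coordHom_injective).trans (MulEquiv.subgroupCongr U.range_coordHom)⟩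

end UE

theorem UAction.nonempty_mulEquiv_model {G Ω : Type*} [Group G] [MulAction G Ω] [Finite G]
    [Finite Ω] (U : UAction G Ω) : Nonempty (G ≃* UPoint.model) := by
  obtain ⟨U⟩ := U.nonempty_uPair
  obtain ⟨U, -⟩ := U.nonempty_uElt
  obtain ⟨U⟩ := U.nonempty_uPi
  obtain ⟨U⟩ := U.nonempty_uT
  obtain ⟨U⟩ := U.nonempty_uW
  obtain ⟨U⟩ := U.nonempty_uC
  obtain ⟨U⟩ := U.nonempty_uS
  obtain ⟨U⟩ := U.nonempty_uE
  exact U.nonempty_mulEquiv_model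

/-- Any two finite groups of order `2^5 * 3^2 * 5^2 * 7 * 29 * 59^3 * 163` whose prime graphs have
vertex degrees deg 2 = 4, deg 3 = 2, deg 5 = 4, deg 7 = 1, deg 29 = 2, deg 59 = 2, deg 163 = 1 are isomorphic (the
order and degree pattern of the simple unitary group `U_3(59)`). -/
theorem od_characterization_U_3_59
    (G H : Type*) [Group G] [Finite G] [Group H] [Finite H]
    (hG : Nat.card G = 2^5 * 3^2 * 5^2 * 7 * 29 * 59^3 * 163)
    (hH : Nat.card H = 2^5 * 3^2 * 5^2 * 7 * 29 * 59^3 * 163)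
    (hG2 : gkDegree G 2 = 4)
    (hG3 : gkDegree G 3 = 2)
    (hG5 : gkDegree G 5 = 4)
    (hG7 : gkDegree G 7 = 1)
    (hG29 : gkDegree G 29 = 2)
    (hG59 : gkDegree G 59 = 2)
    (hG163 : gkDegree G 163 = 1)
    (hH2 : gkDegree H 2 = 4)
    (hH3 : gkDegree H 3 = 2)
    (hH5 : gkDegree H 5 = 4)
    (hH7 : gkDegree H 7 = 1)
    (hH29 : gkDegree H 29 = 2)
    (hH59 : gkDegree H 59 = 2)
    (hH163 : gkDegree H 163 = 1) :
    Nonempty (G ≃* H) := by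
  obtain ⟨f⟩ := (arithU_of_gkDegree hG hG2 hG5 hG7 hG29 hG59 hG163).uAction.nonempty_mulEquiv_model
  obtain ⟨f'⟩ := (arithU_of_gkDegree hH hH2 hH5 hH7 hH29 hH59 hH163).uAction.nonempty_mulEquiv_model
  exact ⟨f.trans f'.symm⟩
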